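/- Fix θ ∈ (0,1), 1/2 < β < 1 − θ/2, and r ∈ (0,1), under the IF-PCA calibration. (i) If r > ρ*_θ(β), set q* = (β − θ/2 + r)²/(4r) when r > (β − θ/2)/3 and q* = 4r otherwise; then there exist sequences δ_p → 0 and η_p with p²·η_p → 0 such that P(cos(ξ^{(q*)}, ℓ) ≥ 1 − δ_p) ≥ 1 − η_p for all large p. (ii) If r < ρ*_θ(β), then there exists a constant c_0 ∈ (0,1) such that for every fixed q ∈ (0,1) there is a sequence η_p with n·η_p → 0 and P(cos(ξ^{(q)}, ℓ) ≤ c_0) ≥ 1 − η_p for all large p. -/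

import Mathlib

open MeasureTheory ProbabilityTheory Filter
open scoped ENNReal NNReal Classical BigOperators

namespace ARWPaper

/-- `n = ⌈p^θ⌉`. -/
noncomputable def nDim (p : ℕ) (θ : ℝ) : ℕ := ⌈(p : ℝ) ^ θ⌉₊

/-- Law of a single class label: uniform on `{-1, 1}`. -/
noncomputable def signLaw : Measure ℝ :=
  (1 / 2 : ℝ≥0∞) • Measure.dirac (1 : ℝ) + (1 / 2 : ℝ≥0∞) • Measure.dirac (-1 : ℝ)

/-- Law of a single coordinate of `μ`: `τ` w.p. `ε`, `0` w.p. `1 - ε`. -/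
noncomputable def muLaw (ε τ : ℝ) : Measure ℝ :=
  ENNReal.ofReal (1 - ε) • Measure.dirac (0 : ℝ) + ENNReal.ofReal ε • Measure.dirac τ

/-- Standard Gaussian product measure on `ℝ^n`. -/
noncomputable def gaussPi (n : ℕ) : Measure (Fin n → ℝ) :=
  Measure.pi fun _ => gaussianReal 0 1

/-- Law of the noise matrix `Z` (i.i.d. `N(0,1)` entries, rows indexed by `Fin n`). -/
noncomputable def noiseLaw (n p : ℕ) : Measure (Fin n → Fin p → ℝ) :=
  Measure.pi fun _ => gaussPi p

/-- Sample space for `(ℓ, μ, Z)`. -/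
abbrev Omega (n p : ℕ) := (Fin n → ℝ) × (Fin p → ℝ) × (Fin n → Fin p → ℝ)

/-- Joint law of `(ℓ, μ, Z)`. -/
noncomputable def jointLaw (n p : ℕ) (ε τ : ℝ) : Measure (Omega n p) :=
  (Measure.pi fun _ : Fin n => signLaw).prod
    ((Measure.pi fun _ : Fin p => muLaw ε τ).prod (noiseLaw n p))

/-- Data matrix `X = ℓ μ' + Z`. -/
def dataMap {n p : ℕ} (ω : Omega n p) : Fin n → Fin p → ℝ :=
  fun i j => ω.1 i * ω.2.1 j + ω.2.2 i j

/-- Hamming clustering error of a clustering procedure `ell`, where the observed data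
matrix is `D ω`. -/
noncomputable def hammingClu (n p : ℕ) (ε τ : ℝ)
    (D : Omega n p → Fin n → Fin p → ℝ)
    (ell : (Fin n → Fin p → ℝ) → Fin n → ℝ) : ℝ :=
  (n : ℝ)⁻¹ * min
    (∑ i : Fin n, ((jointLaw n p ε τ) {ω | ell (D ω) i ≠ ω.1 i}).toReal)
    (∑ i : Fin n, ((jointLaw n p ε τ) {ω | ell (D ω) i ≠ -ω.1 i}).toReal)

/-- Hamming error for signal (support) recovery. -/
noncomputable def hammingSig (n p : ℕ) (ε τ : ℝ)
    (D : Omega n p → Fin n → Fin p → ℝ)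
    (S : (Fin n → Fin p → ℝ) → Finset (Fin p)) : ℝ :=
  ((p : ℝ) * ε)⁻¹ * ∑ j : Fin p,
    (((jointLaw n p ε τ) {ω | ω.2.1 j = 0 ∧ j ∈ S (D ω)}).toReal +
      ((jointLaw n p ε τ) {ω | ω.2.1 j ≠ 0 ∧ j ∉ S (D ω)}).toReal)

/-- Sum of type I and type II testing errors of the rejection region `R`. -/
noncomputable def testErr (n p : ℕ) (ε τ : ℝ)
    (R : Set (Fin n → Fin p → ℝ)) : ℝ :=
  ((noiseLaw n p) R).toReal + ((jointLaw n p ε τ) {ω | dataMap ω ∉ R}).toReal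

/-- Statistical boundary for clustering. -/
noncomputable def etaClu (θ β : ℝ) : ℝ :=
  if β < (1 - θ) / 2 then (1 - 2 * β) / 2
  else if β < 1 - θ then θ / 2
  else (1 - β) / 2

/-- CTUB boundary for clustering. -/
noncomputable def etaCluT (θ β : ℝ) : ℝ :=
  if β < (1 - θ) / 2 then (1 - 2 * β) / 2
  else if β < 1 / 2 then (1 + θ - 2 * β) / 4
  else if β < 1 - θ / 2 then θ / 4
  else (1 - β) / 2

/-- Statistical boundary for signal recovery. -/
noncomputable def etaSig (θ β : ℝ) : ℝ :=
  if β < 1 - θ then θ / 2 else (1 + θ - β) / 4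

/-- CTUB boundary for signal recovery. -/
noncomputable def etaSigT (θ β : ℝ) : ℝ :=
  if β < (1 - θ) / 2 then θ / 2
  else if β < 1 / 2 then (1 + θ - 2 * β) / 4
  else θ / 4

noncomputable def etaHyp1 (θ β : ℝ) : ℝ := (2 + θ - 4 * β) / 4
noncomputable def etaHyp2 (θ β : ℝ) : ℝ := min (θ / 2) ((1 + θ - β) / 4)
noncomputable def etaHyp (θ β : ℝ) : ℝ := max (etaHyp1 θ β) (etaHyp2 θ β)
noncomputable def etaHypT (θ β : ℝ) : ℝ := max (etaHyp1 θ β) (θ / 4)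

/-- Standard phase function `ρ*`. -/
noncomputable def rhoStar (b : ℝ) : ℝ :=
  if b < 3 / 4 then b - 1 / 2 else (1 - Real.sqrt (1 - b)) ^ 2

/-- Phase function for IF-PCA. -/
noncomputable def rhoStarTheta (θ β : ℝ) : ℝ :=
  (1 - θ) * rhoStar (1 / 2 + (β - 1 / 2) / (1 - θ))

/-- Euclidean norm of a vector. -/
noncomputable def l2 {n : ℕ} (v : Fin n → ℝ) : ℝ := Real.sqrt (∑ i, v i ^ 2)

/-- Entrywise sup-norm of a vector. -/
noncomputable def linf {n : ℕ} (v : Fin n → ℝ) : ℝ := ⨆ i, |v i|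

/-- `cos(x, y) = |⟨x/‖x‖, y/‖y‖⟩|`. -/
noncomputable def cosv {n : ℕ} (x y : Fin n → ℝ) : ℝ :=
  |∑ i, x i * y i| / (l2 x * l2 y)

/-- Spectral (operator) norm of a matrix. -/
noncomputable def specNorm {m k : ℕ} (A : Matrix (Fin m) (Fin k) ℝ) : ℝ :=
  sSup ((fun v => l2 (A.mulVec v)) '' {v | l2 v ≤ 1})

/-- Simple Aggregation clustering: entrywise sign of the sum of all columns. -/
noncomputable def ellSimpleAgg {n p : ℕ} (X : Fin n → Fin p → ℝ) : Fin n → ℝ :=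
  fun i => Real.sign (∑ j, X i j)

/-- `S` picks, for every data matrix, a size-`N` subset maximizing `‖∑_{j ∈ S} x_j‖₁`. -/
def IsSparseAggMaximizer {n p : ℕ} (N : ℕ)
    (S : (Fin n → Fin p → ℝ) → Finset (Fin p)) : Prop :=
  ∀ X, (S X).card = N ∧
    ∀ T : Finset (Fin p), T.card = N →
      ∑ i, |∑ j ∈ T, X i j| ≤ ∑ i, |∑ j ∈ S X, X i j|

/-- Sparse Aggregation clustering. -/
noncomputable def ellSparseAgg {n p : ℕ}
    (S : (Fin n → Fin p → ℝ) → Finset (Fin p)) (X : Fin n → Fin p → ℝ) :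
    Fin n → ℝ :=
  fun i => Real.sign (∑ j ∈ S X, X i j)

/-- Gram matrix `X X'`. -/
def gram {n p : ℕ} (X : Fin n → Fin p → ℝ) : Matrix (Fin n) (Fin n) ℝ :=
  Matrix.of fun i i' => ∑ j, X i j * X i' j

/-- `ξ` is a unit eigenvector of `A` associated with its largest eigenvalue. -/
def IsTopEigenvector {n : ℕ} (A : Matrix (Fin n) (Fin n) ℝ) (ξ : Fin n → ℝ) : Prop :=
  (∑ i, ξ i ^ 2) = 1 ∧
    ∃ lam : ℝ, A.mulVec ξ = lam • ξ ∧
      ∀ (lam' : ℝ) (v : Fin n → ℝ), v ≠ 0 → A.mulVec v = lam' • v → lam' ≤ lam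

/-- χ²-screening: the set of selected features. -/
noncomputable def chiSel {n p : ℕ} (q : ℝ) (X : Fin n → Fin p → ℝ) : Finset (Fin p) :=
  Finset.univ.filter fun j =>
    Real.sqrt (2 * q * Real.log p) ≤ ((∑ i, X i j ^ 2) - n) / Real.sqrt (2 * n)

/-- Post-selection Gram matrix `X^{(q)} (X^{(q)})'`. -/
noncomputable def gramSel {n p : ℕ} (q : ℝ) (X : Fin n → Fin p → ℝ) :
    Matrix (Fin n) (Fin n) ℝ :=
  Matrix.of fun i i' => ∑ j ∈ chiSel q X, X i j * X i' j

/-- IF-PCA calibration `τ_p* = p^{-θ/4} (4 r log p)^{1/4}`. -/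
noncomputable def tauStar (p : ℕ) (θ r : ℝ) : ℝ :=
  (p : ℝ) ^ (-(θ / 4)) * (4 * r * Real.log p) ^ ((1 : ℝ) / 4)

/-- The ideal threshold `q*` of IF-PCA in the Region of Possibility. -/
noncomputable def qStar (θ β r : ℝ) : ℝ :=
  if (β - θ / 2) / 3 < r then (β - θ / 2 + r) ^ 2 / (4 * r) else 4 * r

/-- Support of `μ`. -/
noncomputable def suppSet {p : ℕ} (μ : Fin p → ℝ) : Finset (Fin p) :=
  Finset.univ.filter fun j => μ j ≠ 0

/-- The event `D_p`: `| |S(μ)| - p ε_p | ≤ √(6 p ε_p log p)` with `ε_p = p^{-β}`. -/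
def inDp (β : ℝ) {p : ℕ} (μ : Fin p → ℝ) : Prop :=
  |((suppSet μ).card : ℝ) - (p : ℝ) * (p : ℝ) ^ (-β)| ≤
    Real.sqrt (6 * ((p : ℝ) * (p : ℝ) ^ (-β)) * Real.log p)

/-- Selection threshold `n + 2√(q n log p)` for the squared column norm. -/
noncomputable def thresh (p n : ℕ) (q : ℝ) : ℝ :=
  (n : ℝ) + 2 * Real.sqrt (q * n * Real.log p)

/-- `π₀ = P(‖z‖² > n + 2√(q n log p))`, `z ~ N(0, I_n)`. -/
noncomputable def pi0 (p n : ℕ) (q : ℝ) : ℝ :=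
  ((gaussPi n) {z | thresh p n q < ∑ i, z i ^ 2}).toReal

/-- `π₁ = P(‖z + τ ℓ‖² > n + 2√(q n log p))`, `z ~ N(0, I_n)`. -/
noncomputable def pi1 (p : ℕ) {n : ℕ} (q τ : ℝ) (ℓ : Fin n → ℝ) : ℝ :=
  ((gaussPi n) {z | thresh p n q < ∑ i, (z i + τ * ℓ i) ^ 2}).toReal

/-- Expected number of selected useless features (`s = |S(μ)|`). -/
noncomputable def m0q (p n : ℕ) (q : ℝ) (s : ℕ) : ℝ := ((p : ℝ) - s) * pi0 p n q

/-- Expected number of selected useful features. -/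
noncomputable def m1q (p : ℕ) {n : ℕ} (q τ : ℝ) (ℓ : Fin n → ℝ) (s : ℕ) : ℝ :=
  (s : ℝ) * pi1 p q τ ℓ

/-- `m^{(q)}`. -/
noncomputable def mq (p : ℕ) {n : ℕ} (q τ : ℝ) (ℓ : Fin n → ℝ) (s : ℕ) : ℝ :=
  m0q p n q s + m1q p q τ ℓ s

/-- `m_*^{(q)}`. -/
noncomputable def mstarq (p : ℕ) {n : ℕ} (q τ : ℝ) (ℓ : Fin n → ℝ) (s : ℕ) : ℝ :=
  ((p : ℝ) - s) * (n : ℝ)⁻¹ *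
      (∫ z in {z : Fin n → ℝ | thresh p n q < ∑ i, z i ^ 2}, (∑ i, z i ^ 2) ∂gaussPi n) +
    (s : ℝ) * (n : ℝ)⁻¹ *
      (∫ z in {z : Fin n → ℝ | thresh p n q < ∑ i, (z i + τ * ℓ i) ^ 2},
        (∑ i, z i ^ 2) ∂gaussPi n)

/-- The threshold `q̃(β, θ, r)` separating the "fat" and "skinny" cases. -/
noncomputable def qTilde (β θ r : ℝ) : ℝ :=
  if β < 1 - θ then max (1 - θ) ((Real.sqrt (1 - β - θ) + Real.sqrt r) ^ 2)
  else 1 - θ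

/-- The set of features selected by χ²-screening, in terms of `(ℓ, μ, Z)`. -/
noncomputable def selSet {n p : ℕ} (q : ℝ) (ℓ : Fin n → ℝ) (μ : Fin p → ℝ)
    (Z : Fin n → Fin p → ℝ) : Finset (Fin p) :=
  chiSel q fun i j => ℓ i * μ j + Z i j

/-- `Z^{(q)} (Z^{(q)})'`. -/
noncomputable def gramZq {n p : ℕ} (q : ℝ) (ℓ : Fin n → ℝ) (μ : Fin p → ℝ)
    (Z : Fin n → Fin p → ℝ) : Matrix (Fin n) (Fin n) ℝ :=
  Matrix.of fun i i' => ∑ j ∈ selSet q ℓ μ Z, Z i j * Z i' j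

/-- `X^{(q)} (X^{(q)})'`. -/
noncomputable def gramXq {n p : ℕ} (q : ℝ) (ℓ : Fin n → ℝ) (μ : Fin p → ℝ)
    (Z : Fin n → Fin p → ℝ) : Matrix (Fin n) (Fin n) ℝ :=
  Matrix.of fun i i' =>
    ∑ j ∈ selSet q ℓ μ Z, (ℓ i * μ j + Z i j) * (ℓ i' * μ j + Z i' j)

/-- The matrix `ℓ (μ^{(q)})' (Z^{(q)})' + Z^{(q)} μ^{(q)} ℓ'`. -/
noncomputable def crossMat {n p : ℕ} (q : ℝ) (ℓ : Fin n → ℝ) (μ : Fin p → ℝ)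
    (Z : Fin n → Fin p → ℝ) : Matrix (Fin n) (Fin n) ℝ :=
  Matrix.of fun i i' =>
    ℓ i * (∑ j ∈ selSet q ℓ μ Z, Z i' j * μ j) +
      (∑ j ∈ selSet q ℓ μ Z, Z i j * μ j) * ℓ i'

/-- Colored-noise data matrix `X = ℓ μ' + A Z B`. -/
noncomputable def dataColored {n p : ℕ} (A : Matrix (Fin n) (Fin n) ℝ)
    (B : Matrix (Fin p) (Fin p) ℝ) (ω : Omega n p) : Fin n → Fin p → ℝ :=
  fun i j => ω.1 i * ω.2.1 j + (A * Matrix.of ω.2.2 * B) i j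

/-- Colored-noise data matrix `X = ℓ μ' + Z B`. -/
noncomputable def dataColoredB {n p : ℕ} (B : Matrix (Fin p) (Fin p) ℝ)
    (ω : Omega n p) : Fin n → Fin p → ℝ :=
  fun i j => ω.1 i * ω.2.1 j + (Matrix.of ω.2.2 * B) i j

/-- `y_*^{(sa)} = n^{-1/2} X' ℓ̂_*^{(sa)}`. -/
noncomputable def ySA {n p : ℕ} (X : Fin n → Fin p → ℝ) : Fin p → ℝ :=
  fun j => (Real.sqrt n)⁻¹ * ∑ i, X i j * ellSimpleAgg X i

/-- `Ŝ_*^{(sa)}`: thresholding `y_*^{(sa)}` at the universal threshold. -/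
noncomputable def ShatSA {n p : ℕ} (X : Fin n → Fin p → ℝ) : Finset (Fin p) :=
  Finset.univ.filter fun j => Real.sqrt (2 * Real.log p) ≤ |ySA X j|

/-- `y_*^{(if)} = n^{-1/2} X' sgn(ξ)` for a given vector `ξ`. -/
noncomputable def yIF {n p : ℕ} (ξ : Fin n → ℝ) (X : Fin n → Fin p → ℝ) : Fin p → ℝ :=
  fun j => (Real.sqrt n)⁻¹ * ∑ i, X i j * Real.sign (ξ i)

/-- `Ŝ_*^{(if)}`: thresholding `y_*^{(if)}` at the universal threshold. -/
noncomputable def ShatIF {n p : ℕ} (ξ : Fin n → ℝ) (X : Fin n → Fin p → ℝ) : Finset (Fin p) :=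
  Finset.univ.filter fun j => Real.sqrt (2 * Real.log p) ≤ |yIF ξ X j|

/-- Rejection region of the Simple Aggregation test `T̂_*^{(sa)}`. -/
noncomputable def rejSA {n p : ℕ} : Set (Fin n → Fin p → ℝ) :=
  {X | 2 * Real.sqrt (2 * Real.log p) ≤
    ((p : ℝ) * (∑ i, ((p : ℝ)⁻¹ * ∑ j, X i j) ^ 2) - n) / Real.sqrt (2 * n)}

/-- Rejection region of the Sparse Aggregation test `T̂_N^{(sa)}`. -/
noncomputable def rejSparse {n p : ℕ} (N : ℕ)
    (S : (Fin n → Fin p → ℝ) → Finset (Fin p)) : Set (Fin n → Fin p → ℝ) :=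
  {X | Real.sqrt (2 / Real.pi) * n + Real.sqrt (2 * n * (N + 2) * Real.log p) ≤
    (Real.sqrt N)⁻¹ * ∑ i, |∑ j ∈ S X, X i j|}

/-- χ² P-value of feature `j`. -/
noncomputable def pvalue {n p : ℕ} (X : Fin n → Fin p → ℝ) (j : Fin p) : ℝ :=
  ((gaussPi n) {z | (∑ i, X i j ^ 2) ≤ ∑ i, z i ^ 2}).toReal

/-- Higher Criticism statistic. -/
noncomputable def HCstat {n p : ℕ} (X : Fin n → Fin p → ℝ) : ℝ :=
  sSup {h : ℝ | ∃ i : Fin p, 2 * (i.val + 1) ≤ p ∧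
    h = Real.sqrt p * (((i.val : ℝ) + 1) / p - pvalue X (Tuple.sort (pvalue X) i)) /
      Real.sqrt (pvalue X (Tuple.sort (pvalue X) i) *
        (1 - pvalue X (Tuple.sort (pvalue X) i)))}

/-- Rejection region of the Higher Criticism test. -/
noncomputable def rejHC {n p : ℕ} : Set (Fin n → Fin p → ℝ) :=
  {X | 2 * Real.sqrt (2 * Real.log (Real.log p)) ≤ HCstat X}

/-- Lebesgue measure on the space of `n × p` matrices. -/
noncomputable def lebPi (n p : ℕ) : Measure (Fin n → Fin p → ℝ) :=
  Measure.pi fun _ : Fin n => Measure.pi fun _ : Fin p => (volume : Measure ℝ)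

/-- Law of `X` in Experiment 1 (`X = ℓ μ' + c_p Z`) with `ℓ_i` forced to be `s`. -/
noncomputable def condLaw1 (n p : ℕ) (ε τ cp : ℝ) (i : Fin n) (s : ℝ) :
    Measure (Fin n → Fin p → ℝ) :=
  (jointLaw n p ε τ).map fun ω => fun i' j =>
    Function.update ω.1 i s i' * ω.2.1 j + cp * ω.2.2 i' j

/-- Law of `X` in Experiment 2 (`X = ℓ μ' + c_p Z + W`) with `ℓ_i` forced to be `s`,
where `W ~ ν` is independent of `(ℓ, μ, Z)`. -/
noncomputable def condLaw2 (n p : ℕ) (ε τ cp : ℝ)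
    (ν : Measure (Fin n → Fin p → ℝ)) (i : Fin n) (s : ℝ) :
    Measure (Fin n → Fin p → ℝ) :=
  ((jointLaw n p ε τ).prod ν).map fun ωw => fun i' j =>
    Function.update ωw.1.1 i s i' * ωw.1.2.1 j + cp * ωw.1.2.2 i' j + ωw.2 i' j

end ARWPaper

namespace ARWPaper

open MeasureTheory ProbabilityTheory Filter
open scoped ENNReal NNReal Classical BigOperators

/-- `n`-dimensional Euclidean space. -/
abbrev Euc (n : ℕ) := EuclideanSpace ℝ (Fin n)

/-- Standard Gaussian measure on `n`-dimensional Euclidean space. -/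
noncomputable abbrev stdG (n : ℕ) : Measure (Euc n) := stdGaussian (Euc n)

lemma integrable_exp_sq_gaussianReal {s : ℝ} (hs : s < 1 / 2) :
    Integrable (fun x : ℝ => Real.exp (s * x ^ 2)) (gaussianReal 0 1) := by
  rw [gaussianReal_of_var_ne_zero _ one_ne_zero]
  rw [integrable_withDensity_iff_integrable_smul' (measurable_gaussianPDF 0 1)
    (ae_of_all _ fun x => by simp [gaussianPDF])]
  have h := (integrable_exp_neg_mul_sq (b := 1 / 2 - s) (by linarith)).const_mul
    ((√(2 * Real.pi * (1 : ℝ≥0)))⁻¹)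
  refine h.congr (ae_of_all _ fun x => ?_)
  simp only [toReal_gaussianPDF, gaussianPDFReal, smul_eq_mul]
  rw [mul_assoc _ (Real.exp _) (Real.exp _), ← Real.exp_add]
  congr 2
  simp
  ring

lemma integral_exp_sq_gaussianReal {s : ℝ} (hs : s < 1 / 2) :
    ∫ x : ℝ, Real.exp (s * x ^ 2) ∂(gaussianReal 0 1) = (√(1 - 2 * s))⁻¹ := by
  rw [integral_gaussianReal_eq_integral_smul one_ne_zero]
  have : ∀ x : ℝ, gaussianPDFReal 0 1 x • Real.exp (s * x ^ 2)
      = (√(2 * Real.pi * (1 : ℝ≥0)))⁻¹ * Real.exp (-(1 / 2 - s) * x ^ 2) := by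
    intro x
    simp only [gaussianPDFReal, smul_eq_mul]
    rw [mul_assoc, ← Real.exp_add]
    congr 2
    simp
    ring
  simp_rw [this]
  rw [integral_const_mul, integral_gaussian, ← Real.sqrt_inv, ← Real.sqrt_inv,
    ← Real.sqrt_mul (by positivity)]
  congr 1
  have h1 : (1 : ℝ) - 2 * s ≠ 0 := by linarith
  have h2 : (1 : ℝ) / 2 - s ≠ 0 := by linarith
  have := Real.pi_ne_zero
  simp only [NNReal.coe_one, mul_one]
  field_simp

lemma map_toLp_gaussPi (n : ℕ) : (gaussPi n).map (WithLp.toLp 2) = stdG n :=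
  map_pi_eq_stdGaussian

lemma exp_mul_norm_sq_toLp {n : ℕ} (s : ℝ) (z : Fin n → ℝ) :
    Real.exp (s * ‖(WithLp.toLp 2 z : Euc n)‖ ^ 2) = ∏ i, Real.exp (s * z i ^ 2) := by
  rw [EuclideanSpace.real_norm_sq_eq, Finset.mul_sum, Real.exp_sum]

lemma integrable_exp_norm_sq {n : ℕ} {s : ℝ} (hs : s < 1 / 2) :
    Integrable (fun z : Euc n => Real.exp (s * ‖z‖ ^ 2)) (stdG n) := by
  rw [← map_toLp_gaussPi]
  refine (integrable_map_measure (Measurable.aestronglyMeasurable (by fun_prop))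
    (by fun_prop)).2 ?_
  have : ((fun z : Euc n => Real.exp (s * ‖z‖ ^ 2)) ∘ WithLp.toLp 2)
      = fun z : Fin n → ℝ => ∏ i, Real.exp (s * z i ^ 2) :=
    funext fun z => exp_mul_norm_sq_toLp s z
  rw [this]
  exact Integrable.fintype_prod (fun _ => integrable_exp_sq_gaussianReal hs)

lemma integral_exp_norm_sq {n : ℕ} {s : ℝ} (hs : s < 1 / 2) :
    ∫ z : Euc n, Real.exp (s * ‖z‖ ^ 2) ∂(stdG n) = ((√(1 - 2 * s))⁻¹) ^ n := by
  rw [← map_toLp_gaussPi, integral_map (by fun_prop)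
    (Measurable.aestronglyMeasurable (by fun_prop))]
  simp_rw [exp_mul_norm_sq_toLp]
  rw [gaussPi, integral_fintype_prod_eq_pow (fun x : ℝ => Real.exp (s * x ^ 2)),
    integral_exp_sq_gaussianReal hs]
  simp

lemma map_inner_stdG {n : ℕ} (v : Euc n) :
    (stdG n).map (fun z => inner ℝ z v) = gaussianReal 0 (‖v‖₊ ^ 2) := by
  have h := IsGaussian.map_eq_gaussianReal (μ := stdG n) (innerSL ℝ v)
  rw [integral_strongDual_stdGaussian, variance_dual_stdGaussian] at h
  have h2 : (fun z : Euc n => inner ℝ z v) = (innerSL ℝ v : Euc n → ℝ) := by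
    ext z; simp [real_inner_comm]
  rw [h2, h]
  congr 1
  rw [innerSL_apply_norm]
  ext
  simp

lemma integrable_exp_inner {n : ℕ} (v : Euc n) (c : ℝ) :
    Integrable (fun z : Euc n => Real.exp (c * inner ℝ z v)) (stdG n) := by
  have h := integrable_exp_mul_gaussianReal (μ := 0) (v := ‖v‖₊ ^ 2) c
  rw [← map_inner_stdG v] at h
  exact h.comp_measurable (by fun_prop)

lemma integral_exp_inner {n : ℕ} (v : Euc n) (c : ℝ) :
    ∫ z : Euc n, Real.exp (c * inner ℝ z v) ∂(stdG n) = Real.exp (c ^ 2 * ‖v‖ ^ 2 / 2) := by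
  have h := mgf_gaussianReal (p := stdG n) (map_inner_stdG v) c
  rw [mgf] at h
  rw [h]
  simp
  ring_nf

lemma integral_exp_inner_sq {n : ℕ} {v : Euc n} (hv : ‖v‖ = 1) {s : ℝ} (hs : s < 1 / 2) :
    ∫ z : Euc n, Real.exp (s * inner ℝ z v ^ 2) ∂(stdG n) = (√(1 - 2 * s))⁻¹ := by
  rw [← integral_exp_sq_gaussianReal hs]
  have h := map_inner_stdG v
  have h1 : ‖v‖₊ ^ 2 = 1 := by ext; simp [hv]
  rw [h1] at h
  rw [← h, integral_map (by fun_prop) (Measurable.aestronglyMeasurable (by fun_prop))]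

lemma integrable_exp_inner_sq {n : ℕ} {v : Euc n} (hv : ‖v‖ = 1) {s : ℝ} (hs : s < 1 / 2) :
    Integrable (fun z : Euc n => Real.exp (s * inner ℝ z v ^ 2)) (stdG n) := by
  have h := integrable_exp_sq_gaussianReal hs
  have h1 : ‖v‖₊ ^ 2 = 1 := by ext; simp [hv]
  rw [← h1, ← map_inner_stdG v] at h
  exact h.comp_measurable (by fun_prop)

/-- The standard Gaussian is invariant under linear isometries. -/
lemma integral_comp_isometry_stdG {n : ℕ} {F : Type*} [NormedAddCommGroup F] [NormedSpace ℝ F]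
    (f : Euc n ≃ₗᵢ[ℝ] Euc n) (φ : Euc n → F) :
    ∫ z, φ (f z) ∂(stdG n) = ∫ z, φ z ∂(stdG n) := by
  have h : MeasurePreserving f (stdG n) (stdG n) :=
    ⟨f.continuous.measurable, stdGaussian_map f⟩
  exact h.integral_comp f.toHomeomorph.measurableEmbedding φ

/-- Two vectors of the same norm are related by a linear isometry. -/
lemma exists_isometry_apply_eq {n : ℕ} {v w : Euc n} (h : ‖v‖ = ‖w‖) :
    ∃ f : Euc n ≃ₗᵢ[ℝ] Euc n, f v = w := by
  refine ⟨(Submodule.span ℝ {v - w})ᗮ.reflection, ?_⟩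
  exact Submodule.reflection_sub h

/-- Integrals of functions of `(‖z‖, ⟪z, v⟫)` depend on `v` only through its norm. -/
lemma integral_norm_inner_congr {n : ℕ} {F : Type*} [NormedAddCommGroup F] [NormedSpace ℝ F]
    {v w : Euc n} (h : ‖v‖ = ‖w‖) (φ : ℝ → ℝ → F) :
    ∫ z : Euc n, φ ‖z‖ (inner ℝ z v) ∂(stdG n) = ∫ z : Euc n, φ ‖z‖ (inner ℝ z w) ∂(stdG n) := by
  obtain ⟨f, rfl⟩ := exists_isometry_apply_eq h
  rw [← integral_comp_isometry_stdG f (fun z => φ ‖z‖ (inner ℝ z (f v)))]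
  simp

/-- Exponential Markov inequality for a sum over the coordinates of a product measure. -/
lemma measure_sum_ge_le {α : Type*} [MeasurableSpace α] (ν : Measure α) [IsProbabilityMeasure ν]
    (p : ℕ) {f : α → ℝ} (hf : Integrable (fun a => Real.exp (f a)) ν) {b : ℝ}
    (hb : ∫ a, Real.exp (f a) ∂ν ≤ Real.exp b) (s : ℝ) :
    Measure.pi (fun _ : Fin p => ν) {y | s ≤ ∑ j, f (y j)} ≤
      ENNReal.ofReal (Real.exp (p * b - s)) := by
  have h_int : Integrable (fun y : Fin p → α => ∏ j, Real.exp (f (y j)))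
      (Measure.pi (fun _ : Fin p => ν)) := Integrable.fintype_prod (fun _ => hf)
  have hset : {y : Fin p → α | s ≤ ∑ j, f (y j)} =
      {y | Real.exp s ≤ ∏ j, Real.exp (f (y j))} := by
    ext y
    simp only [Set.mem_ofPred_eq]
    rw [← Real.exp_sum, Real.exp_le_exp]
  have hm := mul_meas_ge_le_integral_of_nonneg (μ := Measure.pi (fun _ : Fin p => ν))
    (ae_of_all _ fun y => Finset.prod_nonneg fun j _ => (Real.exp_pos (f (y j))).le) h_int
    (Real.exp s)
  rw [integral_fintype_prod_eq_pow (fun a => Real.exp (f a)), Fintype.card_fin] at hm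
  rw [hset, ← ENNReal.ofReal_toReal (measure_ne_top _ _)]
  apply ENNReal.ofReal_le_ofReal
  have h0 : 0 ≤ ∫ a, Real.exp (f a) ∂ν := integral_nonneg fun a => (Real.exp_pos _).le
  have h1 : (∫ a, Real.exp (f a) ∂ν) ^ p ≤ Real.exp (p * b) := by
    rw [Real.exp_nat_mul]; exact pow_le_pow_left₀ h0 hb p
  rw [Real.exp_sub, le_div_iff₀ (Real.exp_pos s), mul_comm]
  exact hm.trans h1

lemma measure_exists_le {α : Type*} [MeasurableSpace α] (ν : Measure α) [IsProbabilityMeasure ν]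
    (p : ℕ) (A : Set α) :
    Measure.pi (fun _ : Fin p => ν) {y | ∃ j, y j ∈ A} ≤ p * ν A := by
  have : {y : Fin p → α | ∃ j, y j ∈ A} = ⋃ j, {y | y j ∈ A} := by ext; simp
  rw [this]
  refine (measure_iUnion_fintype_le _ _).trans ?_
  have h : ∀ j : Fin p, Measure.pi (fun _ : Fin p => ν) {y | y j ∈ A} ≤ ν A := by
    intro j
    have hm := measurePreserving_eval (fun _ : Fin p => ν) j
    calc Measure.pi (fun _ : Fin p => ν) {y | y j ∈ A}
        ≤ (Measure.pi (fun _ : Fin p => ν)).map (Function.eval j) A :=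
          Measure.le_map_apply hm.measurable.aemeasurable A
      _ = ν A := by rw [hm.map_eq]
  refine (Finset.sum_le_sum fun j _ => h j).trans ?_
  simp

instance (ε τ : ℝ) : SFinite (muLaw ε τ) := by unfold muLaw; infer_instance

lemma isProbabilityMeasure_muLaw {ε τ : ℝ} (h0 : 0 ≤ ε) (h1 : ε ≤ 1) :
    IsProbabilityMeasure (muLaw ε τ) := by
  constructor
  simp only [muLaw, Measure.coe_add, Measure.coe_smul, Pi.add_apply, Pi.smul_apply, measure_univ,
    smul_eq_mul, mul_one]
  rw [← ENNReal.ofReal_add (by linarith) h0]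
  simp

instance : IsProbabilityMeasure signLaw := by
  constructor
  simp only [signLaw, Measure.coe_add, Measure.coe_smul, Pi.add_apply, Pi.smul_apply, measure_univ,
    smul_eq_mul, mul_one]
  exact ENNReal.add_halves 1

/-- Law of one pair `(μ(j), z_j)` of signal coordinate and noise column. -/
noncomputable def colLaw (n : ℕ) (ε τ : ℝ) : Measure (ℝ × Euc n) :=
  (muLaw ε τ).prod (stdG n)

lemma noiseLaw_eq (n p : ℕ) : noiseLaw n p =
    (Measure.pi fun _ : Fin p × Fin n => gaussianReal 0 1).map fun w i j => w (j, i) := by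
  have h1 : noiseLaw n p = (Measure.pi fun _ : Fin n × Fin p => gaussianReal 0 1).map
      (MeasurableEquiv.curry (Fin n) (Fin p) ℝ) := by
    have := Measure.infinitePi_map_curry (ι := Fin n) (κ := Fin p) (fun _ _ => gaussianReal 0 1)
    simp only [Measure.infinitePi_eq_pi] at this
    exact this.symm
  have h2 := (measurePreserving_arrowCongr' (fun _ : Fin p × Fin n => gaussianReal 0 1)
    (fun _ : Fin n × Fin p => gaussianReal 0 1)
    (Equiv.prodComm (Fin p) (Fin n)) (MeasurableEquiv.refl ℝ)
    (fun _ => MeasurePreserving.id _)).map_eq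
  rw [h1, ← h2, Measure.map_map (by fun_prop) (by fun_prop)]
  rfl

lemma map_columns_noiseLaw (n p : ℕ) :
    (noiseLaw n p).map (fun Z j => (WithLp.toLp 2 (fun i => Z i j) : Euc n)) =
      Measure.pi (fun _ : Fin p => stdG n) := by
  have h1 : (Measure.pi fun _ : Fin p => gaussPi n) =
      (Measure.pi fun _ : Fin p × Fin n => gaussianReal 0 1).map
      (MeasurableEquiv.curry (Fin p) (Fin n) ℝ) := by
    have := Measure.infinitePi_map_curry (ι := Fin p) (κ := Fin n) (fun _ _ => gaussianReal 0 1)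
    simp only [Measure.infinitePi_eq_pi] at this
    exact this.symm
  have : SigmaFinite ((gaussPi n).map (WithLp.toLp 2 : (Fin n → ℝ) → Euc n)) := by
    rw [map_toLp_gaussPi]; infer_instance
  have h2 := Measure.pi_map_pi (μ := fun _ : Fin p => gaussPi n)
    (f := fun _ => (WithLp.toLp 2 : (Fin n → ℝ) → Euc n)) (fun _ => by fun_prop)
  simp only [map_toLp_gaussPi] at h2
  rw [← h2, h1, noiseLaw_eq, Measure.map_map (by fun_prop) (by fun_prop),
    Measure.map_map (by fun_prop) (by fun_prop)]
  rfl

instance (n : ℕ) : IsProbabilityMeasure (gaussPi n) := by unfold gaussPi; infer_instance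
instance (n p : ℕ) : IsProbabilityMeasure (noiseLaw n p) := by unfold noiseLaw; infer_instance

lemma map_pairs_law (n p : ℕ) {ε τ : ℝ} (h0 : 0 ≤ ε) (h1 : ε ≤ 1) :
    ((Measure.pi fun _ : Fin p => muLaw ε τ).prod (noiseLaw n p)).map
      (fun w j => (w.1 j, (WithLp.toLp 2 (fun i => w.2 i j) : Euc n))) =
      Measure.pi (fun _ : Fin p => colLaw n ε τ) := by
  have := isProbabilityMeasure_muLaw (τ := τ) h0 h1
  have h2 := (measurePreserving_arrowProdEquivProdArrow ℝ (Euc n) (Fin p)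
    (fun _ => muLaw ε τ) (fun _ => stdG n)).symm.map_eq
  have h3 := Measure.map_prod_map (Measure.pi fun _ : Fin p => muLaw ε τ) (noiseLaw n p)
    (f := id) (g := fun Z j => (WithLp.toLp 2 (fun i => Z i j) : Euc n)) (by fun_prop)
    (by fun_prop)
  rw [Measure.map_id, map_columns_noiseLaw] at h3
  unfold colLaw
  rw [← h2, h3, Measure.map_map (by fun_prop) (by fun_prop)]
  rfl

lemma jointLaw_le_of_forall {n p : ℕ} {ε τ : ℝ} (h0 : 0 ≤ ε) (h1 : ε ≤ 1) {η : ℝ≥0∞}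
    (B : (Fin n → ℝ) → Set (Fin p → ℝ × Euc n))
    (hB : ∀ ℓ : Fin n → ℝ, (∀ i, ℓ i = 1 ∨ ℓ i = -1) →
      Measure.pi (fun _ : Fin p => colLaw n ε τ) (B ℓ) ≤ η) :
    jointLaw n p ε τ {ω | (fun j => (ω.2.1 j, (WithLp.toLp 2 (fun i => ω.2.2 i j) : Euc n)))
      ∈ B ω.1} ≤ η := by
  have := isProbabilityMeasure_muLaw (τ := τ) h0 h1
  set T : (Fin p → ℝ) × (Fin n → Fin p → ℝ) → (Fin p → ℝ × Euc n) :=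
    fun w j => (w.1 j, (WithLp.toLp 2 (fun i => w.2 i j) : Euc n)) with hT
  have hTm : Measurable T := by fun_prop
  set F : Set (Fin n → ℝ) := Set.univ.pi fun _ => {1, -1} with hF
  have hFfin : F.Finite := Set.Finite.pi fun _ => Set.toFinite _
  have hFae : ∀ᵐ ℓ ∂(Measure.pi fun _ : Fin n => signLaw), ℓ ∈ F := by
    have : ∀ᵐ x ∂signLaw, x = 1 ∨ x = -1 := by
      simp only [signLaw]
      rw [ae_add_measure_iff]
      constructor <;> apply Measure.ae_smul_measure <;> rw [ae_dirac_eq] <;> simp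
    have h := eventually_all.2 fun i : Fin n =>
      (Measure.tendsto_eval_ae_ae (μ := fun _ : Fin n => signLaw) (i := i)).eventually this
    filter_upwards [h] with ℓ hℓ i _
    simpa using hℓ i
  set ρ := (Measure.pi fun _ : Fin p => muLaw ε τ).prod (noiseLaw n p) with hρ
  set D : Set (Omega n p) := ⋃ ℓ ∈ F, {ℓ} ×ˢ (toMeasurable ρ (T ⁻¹' (B ℓ))) with hD
  have hDm : MeasurableSet D := by
    refine MeasurableSet.biUnion hFfin.countable fun ℓ _ => ?_
    exact (measurableSet_singleton ℓ).prod (measurableSet_toMeasurable _ _)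
  have hsub : {ω : Omega n p | T ω.2 ∈ B ω.1} ⊆ D ∪ {ω | ω.1 ∉ F} := by
    rintro ⟨ℓ, w⟩ hw
    by_cases hl : ℓ ∈ F
    · left
      refine Set.mem_biUnion hl ⟨rfl, subset_toMeasurable _ _ hw⟩
    · right; exact hl
  have hN : jointLaw n p ε τ {ω | ω.1 ∉ F} = 0 := by
    have hmp : MeasurePreserving (Prod.fst : Omega n p → _) (jointLaw n p ε τ)
        (Measure.pi fun _ : Fin n => signLaw) := measurePreserving_fst
    exact hmp.quasiMeasurePreserving.ae hFae
  refine (measure_mono hsub).trans ((measure_union_le _ _).trans ?_)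
  rw [hN, add_zero]
  unfold jointLaw
  rw [Measure.prod_apply hDm]
  have hb : ∀ᵐ ℓ ∂(Measure.pi fun _ : Fin n => signLaw), ρ (Prod.mk ℓ ⁻¹' D) ≤ η := by
    filter_upwards [hFae] with ℓ hℓ
    have : Prod.mk ℓ ⁻¹' D ⊆ toMeasurable ρ (T ⁻¹' (B ℓ)) := by
      intro w hw
      simp only [hD, Set.mem_preimage, Set.mem_iUnion, Set.mem_prod, Set.mem_singleton_iff] at hw
      obtain ⟨ℓ', _, h1, h2⟩ := hw
      rw [h1]; exact h2
    refine (measure_mono this).trans ?_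
    rw [measure_toMeasurable]
    refine (Measure.le_map_apply hTm.aemeasurable _).trans ?_
    rw [hρ, hT, map_pairs_law n p h0 h1]
    refine hB ℓ fun i => ?_
    have := hℓ i (Set.mem_univ i)
    simpa using this
  refine (lintegral_mono_ae hb).trans ?_
  simp

section

section Deterministic

variable {E : Type*} [NormedAddCommGroup E] [InnerProductSpace ℝ E]

/-- The operator `∑_{j ∈ S} x_j ⊗ x_j - c`. -/
noncomputable def gramOp {ι : Type*} (S : Finset ι) (x : ι → E) (c : ℝ) : E →L[ℝ] E :=
  ∑ j ∈ S, (innerSL ℝ (x j)).smulRight (x j) - c • ContinuousLinearMap.id ℝ E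

lemma gramOp_apply {ι : Type*} (S : Finset ι) (x : ι → E) (c : ℝ) (v : E) :
    gramOp S x c v = ∑ j ∈ S, inner ℝ (x j) v • x j - c • v := by
  simp [gramOp]

lemma inner_gramOp {ι : Type*} (S : Finset ι) (x : ι → E) (c : ℝ) (v w : E) :
    inner ℝ (gramOp S x c v) w =
      ∑ j ∈ S, inner ℝ (x j) v * inner ℝ (x j) w - c * inner ℝ v w := by
  rw [gramOp_apply, inner_sub_left, sum_inner, real_inner_smul_left]
  simp [real_inner_smul_left]

lemma inner_gramOp_self {ι : Type*} (S : Finset ι) (x : ι → E) (c : ℝ) (v : E) :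
    inner ℝ (gramOp S x c v) v = ∑ j ∈ S, inner ℝ (x j) v ^ 2 - c * ‖v‖ ^ 2 := by
  rw [inner_gramOp, real_inner_self_eq_norm_sq]
  simp [sq]

lemma gramOp_isSymmetric {ι : Type*} (S : Finset ι) (x : ι → E) (c : ℝ) :
    (gramOp S x c : E →ₗ[ℝ] E).IsSymmetric := by
  intro v w
  simp only [ContinuousLinearMap.coe_coe]
  rw [real_inner_comm (gramOp S x c w) v, inner_gramOp, inner_gramOp, real_inner_comm v w]
  congr 1
  exact Finset.sum_congr rfl fun j _ => mul_comm _ _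

lemma opNorm_le_of_abs_inner_le {T : E →L[ℝ] E} (hT : (T : E →ₗ[ℝ] E).IsSymmetric) {K : ℝ}
    (hK : 0 ≤ K) (h : ∀ v, |inner ℝ (T v) v| ≤ K * ‖v‖ ^ 2) : ‖T‖ ≤ K := by
  rw [ContinuousLinearMap.norm_eq_iSup_rayleighQuotient T hT]
  refine ciSup_le fun v => ?_
  rw [ContinuousLinearMap.rayleighQuotient, ContinuousLinearMap.reApplyInnerSelf_apply]
  simp only [RCLike.re_to_real]
  rw [abs_div, abs_of_nonneg (sq_nonneg ‖v‖)]
  exact div_le_of_le_mul₀ (by positivity) hK (h v)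

/-- `ξ` is a top unit eigenvector, with eigenvalue `lam`, of `∑_{j ∈ S} x_j ⊗ x_j`. -/
structure TopEig {ι : Type*} (S : Finset ι) (x : ι → E) (ξ : E) (lam : ℝ) : Prop where
  norm_eq : ‖ξ‖ = 1
  eig : ∑ j ∈ S, inner ℝ (x j) ξ • x j = lam • ξ
  le : ∀ v, ∑ j ∈ S, inner ℝ (x j) v ^ 2 ≤ lam * ‖v‖ ^ 2

lemma TopEig.sum_sq {ι : Type*} {S : Finset ι} {x : ι → E} {ξ : E} {lam : ℝ}
    (h : TopEig S x ξ lam) : ∑ j ∈ S, inner ℝ (x j) ξ ^ 2 = lam := by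
  have h1 : inner ℝ (∑ j ∈ S, inner ℝ (x j) ξ • x j) ξ = inner ℝ (lam • ξ) ξ := by rw [h.eig]
  rw [sum_inner, real_inner_smul_left, real_inner_self_eq_norm_sq, h.norm_eq] at h1
  simp only [real_inner_smul_left] at h1
  simpa [sq] using h1

lemma TopEig.one_sub_le {ι : Type*} {S : Finset ι} {x : ι → E} {ξ : E} {lam : ℝ}
    (h : TopEig S x ξ lam) {u : E} (hu : ‖u‖ = 1) {c κ e : ℝ} (hκ : 0 < κ)
    (hQ : ∀ v, |∑ j ∈ S, inner ℝ (x j) v ^ 2 - c * ‖v‖ ^ 2 - κ * inner ℝ u v ^ 2| ≤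
      e * ‖v‖ ^ 2) : 1 - 2 * e / κ ≤ |inner ℝ u ξ| := by
  have h1 := hQ ξ
  have h2 := hQ u
  have h3 := h.le u
  rw [h.sum_sq, h.norm_eq, abs_le] at h1
  rw [hu, real_inner_self_eq_norm_sq, hu, abs_le] at h2
  rw [hu] at h3
  have h4 : κ ≤ κ * inner ℝ u ξ ^ 2 + 2 * e := by nlinarith [h1.1, h1.2, h2.1, h2.2]
  have h5 : 1 - 2 * e / κ ≤ inner ℝ u ξ ^ 2 := by
    rw [sub_le_iff_le_add, ← sub_le_iff_le_add', le_div_iff₀ hκ]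
    nlinarith
  have h6 : |inner ℝ u ξ| ≤ 1 := by
    have := abs_real_inner_le_norm u ξ
    rwa [hu, h.norm_eq, one_mul] at this
  refine h5.trans ?_
  rw [← sq_abs]
  nlinarith [abs_nonneg (inner ℝ u ξ)]

lemma TopEig.sq_inner_mul_le {ι : Type*} {S : Finset ι} {x : ι → E} {ξ : E} {lam : ℝ}
    (h : TopEig S x ξ lam) (u : E) :
    lam * inner ℝ u ξ ^ 2 ≤ ∑ j ∈ S, inner ℝ (x j) u ^ 2 := by
  set α := inner ℝ u ξ
  have h1 : ∑ j ∈ S, inner ℝ (x j) u * inner ℝ (x j) ξ = lam * α := by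
    have : inner ℝ (∑ j ∈ S, inner ℝ (x j) ξ • x j) u = inner ℝ (lam • ξ) u := by rw [h.eig]
    rw [sum_inner, real_inner_smul_left, real_inner_comm] at this
    simp only [real_inner_smul_left] at this
    rw [← this]
    exact Finset.sum_congr rfl fun j _ => mul_comm _ _
  have h2 : 0 ≤ ∑ j ∈ S, (inner ℝ (x j) u - α * inner ℝ (x j) ξ) ^ 2 :=
    Finset.sum_nonneg fun j _ => sq_nonneg _
  have h3 : ∑ j ∈ S, (inner ℝ (x j) u - α * inner ℝ (x j) ξ) ^ 2 =
      ∑ j ∈ S, inner ℝ (x j) u ^ 2 - 2 * α * ∑ j ∈ S, inner ℝ (x j) u * inner ℝ (x j) ξ +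
        α ^ 2 * ∑ j ∈ S, inner ℝ (x j) ξ ^ 2 := by
    rw [Finset.mul_sum, Finset.mul_sum, ← Finset.sum_sub_distrib, ← Finset.sum_add_distrib]
    exact Finset.sum_congr rfl fun j _ => by ring
  rw [h3, h1, h.sum_sq] at h2
  nlinarith

/-- The component of `x` orthogonal to the unit vector `u`. -/
noncomputable def orthPart (u x : E) : E := x - inner ℝ u x • u

lemma inner_orthPart {u : E} (hu : ‖u‖ = 1) (x : E) : inner ℝ u (orthPart u x) = 0 := by
  rw [orthPart, inner_sub_right, real_inner_smul_right, real_inner_self_eq_norm_sq, hu]; ring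

lemma norm_sq_orthPart {u : E} (hu : ‖u‖ = 1) (x : E) :
    ‖orthPart u x‖ ^ 2 = ‖x‖ ^ 2 - inner ℝ u x ^ 2 := by
  rw [orthPart, @norm_sub_sq_real, norm_smul, real_inner_smul_right, real_inner_comm, hu,
    Real.norm_eq_abs, mul_one, sq_abs]
  ring

lemma norm_orthPart_le {u : E} (hu : ‖u‖ = 1) (x : E) : ‖orthPart u x‖ ≤ ‖x‖ := by
  have := norm_sq_orthPart hu x
  exact le_of_sq_le_sq (by nlinarith [sq_nonneg (inner ℝ u x)]) (norm_nonneg _)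

lemma orthPart_add (u x y : E) : orthPart u (x + y) = orthPart u x + orthPart u y := by
  simp only [orthPart, inner_add_right, add_smul]; abel

lemma orthPart_smul (u x : E) (a : ℝ) : orthPart u (a • x) = a • orthPart u x := by
  simp only [orthPart, inner_smul_right, smul_sub, smul_smul]

lemma orthPart_self {u : E} (hu : ‖u‖ = 1) : orthPart u u = 0 := by
  simp [orthPart, hu]

lemma orthPart_sum {ι : Type*} (u : E) (S : Finset ι) (x : ι → E) :
    orthPart u (∑ j ∈ S, x j) = ∑ j ∈ S, orthPart u (x j) := by
  simp only [orthPart, inner_sum, Finset.sum_smul, Finset.sum_sub_distrib]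

lemma inner_orthPart_comm (u x y : E) :
    inner ℝ (orthPart u x) y = inner ℝ x (orthPart u y) := by
  simp only [orthPart, inner_sub_left, inner_sub_right, real_inner_smul_left,
    real_inner_smul_right, real_inner_comm u x]
  ring

lemma TopEig.sq_inner_le {ι : Type*} {S : Finset ι} {x : ι → E} {ξ : E} {lam : ℝ}
    (h : TopEig S x ξ lam) {u : E} (hu : ‖u‖ = 1) {c K H : ℝ} (hK : 0 ≤ K)
    (hQ : ∀ v, |∑ j ∈ S, inner ℝ (x j) v ^ 2 - c * ‖v‖ ^ 2| ≤ K * ‖v‖ ^ 2)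
    (hH : H ≤ ‖∑ j ∈ S, inner ℝ (x j) u • orthPart u (x j)‖ ^ 2) :
    inner ℝ u ξ ^ 2 * H ≤ 4 * K ^ 2 * (1 - inner ℝ u ξ ^ 2) := by
  set T := gramOp S x c with hT
  have hTn : ‖T‖ ≤ K := opNorm_le_of_abs_inner_le (gramOp_isSymmetric S x c) hK fun v => by
    rw [inner_gramOp_self]; exact hQ v
  set α := inner ℝ u ξ with hα
  set ζ := orthPart u ξ with hζ
  have hξ : ξ = α • u + ζ := by rw [hζ, orthPart]; abel
  have hTξ : T ξ = (lam - c) • ξ := by rw [hT, gramOp_apply, h.eig, sub_smul]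
  have hl : |lam - c| ≤ K := by
    have := hQ ξ
    rwa [h.sum_sq, h.norm_eq, one_pow, mul_one, mul_one] at this
  have hw : orthPart u (T u) = ∑ j ∈ S, inner ℝ (x j) u • orthPart u (x j) := by
    rw [hT, gramOp_apply, sub_eq_add_neg, orthPart_add, orthPart_sum, ← neg_smul, orthPart_smul,
      orthPart_self hu, smul_zero, add_zero]
    simp [orthPart_smul]
  have hkey : α • orthPart u (T u) = (lam - c) • ζ - orthPart u (T ζ) := by
    have h1 : orthPart u (T ξ) = (lam - c) • ζ := by rw [hTξ, orthPart_smul]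
    have h2 : orthPart u (T ξ) = α • orthPart u (T u) + orthPart u (T ζ) := by
      conv_lhs => rw [hξ]
      rw [map_add, map_smul, orthPart_add, orthPart_smul]
    rw [← h1, h2]; abel
  have hn : ‖α • orthPart u (T u)‖ ≤ 2 * K * ‖ζ‖ := by
    rw [hkey]
    refine (norm_sub_le _ _).trans ?_
    rw [norm_smul, Real.norm_eq_abs]
    have h1 := norm_orthPart_le hu (T ζ)
    have h2 := T.le_of_opNorm_le hTn ζ
    have h3 := mul_le_mul_of_nonneg_right hl (norm_nonneg ζ)
    linarith
  have hsq : ‖α • orthPart u (T u)‖ ^ 2 ≤ (2 * K * ‖ζ‖) ^ 2 :=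
    pow_le_pow_left₀ (norm_nonneg _) hn 2
  rw [norm_smul, mul_pow, Real.norm_eq_abs, sq_abs, hw, mul_pow, hζ, norm_sq_orthPart hu,
    h.norm_eq] at hsq
  have := mul_le_mul_of_nonneg_left hH (sq_nonneg α)
  nlinarith

lemma abs_quad_sub_le {ι : Type*} {S S0 S1 : Finset ι} (hS : S = S0 ∪ S1) (hd : Disjoint S0 S1)
    {x z : ι → E} {u : E} (hu : ‖u‖ = 1) {b c e B : ℝ} (hb : 0 ≤ b) (hB : 0 ≤ B)
    (hx0 : ∀ j ∈ S0, x j = z j) (hx1 : ∀ j ∈ S1, x j = b • u + z j)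
    (h0 : ∀ v, |∑ j ∈ S0, inner ℝ (z j) v ^ 2 - c * ‖v‖ ^ 2| ≤ e * ‖v‖ ^ 2)
    (h1 : ∀ v, ∑ j ∈ S1, inner ℝ (z j) v ^ 2 ≤ B * ‖v‖ ^ 2) (v : E) :
    |∑ j ∈ S, inner ℝ (x j) v ^ 2 - c * ‖v‖ ^ 2 - (S1.card * b ^ 2) * inner ℝ u v ^ 2| ≤
      (e + B + 2 * b * √(S1.card * B)) * ‖v‖ ^ 2 := by
  have e0 : ∑ j ∈ S0, inner ℝ (x j) v ^ 2 = ∑ j ∈ S0, inner ℝ (z j) v ^ 2 :=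
    Finset.sum_congr rfl fun j hj => by rw [hx0 j hj]
  have e1 : ∑ j ∈ S1, inner ℝ (x j) v ^ 2 = (S1.card * b ^ 2) * inner ℝ u v ^ 2 +
      2 * b * inner ℝ u v * ∑ j ∈ S1, inner ℝ (z j) v + ∑ j ∈ S1, inner ℝ (z j) v ^ 2 := by
    rw [Finset.mul_sum, mul_assoc (S1.card : ℝ), ← nsmul_eq_mul, ← Finset.sum_const,
      ← Finset.sum_add_distrib, ← Finset.sum_add_distrib]
    refine Finset.sum_congr rfl fun j hj => ?_
    rw [hx1 j hj, inner_add_left, real_inner_smul_left]; ring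
  rw [hS, Finset.sum_union hd, e0, e1]
  have hcs : |∑ j ∈ S1, inner ℝ (z j) v| ≤ √(S1.card * B) * ‖v‖ := by
    apply abs_le_of_sq_le_sq _ (by positivity)
    rw [mul_pow, Real.sq_sqrt (by positivity)]
    refine sq_sum_le_card_mul_sum_sq.trans ?_
    rw [mul_assoc]
    exact mul_le_mul_of_nonneg_left (h1 v) (by positivity)
  have huv : |inner ℝ u v| ≤ ‖v‖ := by
    have := abs_real_inner_le_norm u v
    rwa [hu, one_mul] at this
  have hcr : |2 * b * inner ℝ u v * ∑ j ∈ S1, inner ℝ (z j) v| ≤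
      2 * b * √(S1.card * B) * ‖v‖ ^ 2 := by
    rw [abs_mul, abs_mul, abs_of_nonneg (by positivity : 0 ≤ 2 * b)]
    calc 2 * b * |inner ℝ u v| * |∑ j ∈ S1, inner ℝ (z j) v|
        ≤ 2 * b * ‖v‖ * (√(S1.card * B) * ‖v‖) := by gcongr
      _ = _ := by ring
  have hn1 : 0 ≤ ∑ j ∈ S1, inner ℝ (z j) v ^ 2 := Finset.sum_nonneg fun j _ => sq_nonneg _
  have a0 := abs_le.1 (h0 v)
  have a1 := abs_le.1 hcr
  have a2 := h1 v
  rw [abs_le]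
  constructor <;> nlinarith [a0.1, a0.2, a1.1, a1.2, mul_nonneg hB (sq_nonneg ‖v‖)]

lemma exists_topEig_of_isTopEigenvector {n p : ℕ} {S : Finset (Fin p)} {X : Fin n → Fin p → ℝ}
    {ξ : Fin n → ℝ}
    (h : IsTopEigenvector (Matrix.of fun i i' => ∑ j ∈ S, X i j * X i' j) ξ) :
    ∃ lam, TopEig S (fun j => (WithLp.toLp 2 (fun i => X i j) : Euc n)) (WithLp.toLp 2 ξ) lam := by
  obtain ⟨hn, lam, heig, hmax⟩ := h
  set x : Fin p → Euc n := fun j => WithLp.toLp 2 (fun i => X i j) with hx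
  set M : Matrix (Fin n) (Fin n) ℝ := Matrix.of fun i i' => ∑ j ∈ S, X i j * X i' j with hM
  have hMv : ∀ v : Fin n → ℝ, (WithLp.toLp 2 (M.mulVec v) : Euc n) =
      gramOp S x 0 (WithLp.toLp 2 v) := by
    intro v
    rw [gramOp_apply, zero_smul, sub_zero]
    ext i
    simp only [hM, hx, Matrix.mulVec, dotProduct, Matrix.of_apply, WithLp.ofLp_sum,
      WithLp.ofLp_smul, Finset.sum_apply, Pi.smul_apply, smul_eq_mul, PiLp.inner_apply,
      RCLike.inner_apply, conj_trivial, Finset.sum_mul]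
    rw [Finset.sum_comm]
    refine Finset.sum_congr rfl fun j _ => Finset.sum_congr rfl fun k _ => ?_
    ring
  have hnorm : ‖(WithLp.toLp 2 ξ : Euc n)‖ = 1 := by
    have : ‖(WithLp.toLp 2 ξ : Euc n)‖ ^ 2 = 1 := by
      rw [EuclideanSpace.real_norm_sq_eq]; exact hn
    exact (pow_eq_one_iff_of_nonneg (norm_nonneg _) two_ne_zero).1 this
  refine ⟨lam, hnorm, ?_, ?_⟩
  · have h1 := hMv ξ
    rw [heig, gramOp_apply, zero_smul, sub_zero] at h1
    rw [← h1]; rfl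
  · have : Nontrivial (Euc n) := ⟨⟨WithLp.toLp 2 ξ, 0, fun h0 => by simp [h0] at hnorm⟩⟩
    have hsym := gramOp_isSymmetric S x 0
    have hev := hsym.hasEigenvalue_iSup_of_finiteDimensional
    obtain ⟨v, hv⟩ := hev.exists_hasEigenvector
    have hle := hmax _ (WithLp.ofLp v) (by
      intro h0; exact hv.2 (by ext i; exact congrFun h0 i)) (by
      have h2 := hv.apply_eq_smul
      rw [ContinuousLinearMap.coe_coe] at h2
      have h3 := hMv (WithLp.ofLp v)
      rw [WithLp.toLp_ofLp, h2] at h3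
      exact congrArg WithLp.ofLp h3)
    intro w
    rcases eq_or_ne w 0 with rfl | hw
    · simp
    have hwn : 0 < ‖w‖ ^ 2 := by positivity
    rw [← div_le_iff₀ hwn]
    refine le_trans ?_ hle
    have hbdd : BddAbove (Set.range fun v : {v : Euc n // v ≠ 0} =>
        RCLike.re (inner ℝ ((gramOp S x 0 : Euc n →ₗ[ℝ] Euc n) v) (v : Euc n)) /
          ‖(v : Euc n)‖ ^ 2) := by
      refine ⟨‖gramOp S x 0‖, ?_⟩
      rintro _ ⟨y, rfl⟩
      have hy : 0 < ‖(y : Euc n)‖ ^ 2 := by have := y.2; positivity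
      simp only [RCLike.re_to_real, ContinuousLinearMap.coe_coe]
      rw [div_le_iff₀ hy]
      have h1 := real_inner_le_norm (gramOp S x 0 y) (y : Euc n)
      have h2 := (gramOp S x 0).le_opNorm (y : Euc n)
      nlinarith [norm_nonneg (y : Euc n)]
    refine le_trans (le_of_eq ?_) (le_ciSup hbdd ⟨w, hw⟩)
    simp only [RCLike.re_to_real, ContinuousLinearMap.coe_coe]
    rw [inner_gramOp_self]; simp

lemma cosv_eq {n : ℕ} {ξ ℓ : Fin n → ℝ} {u : Euc n} (hn : 0 < n)
    (hℓ : ∀ i, ℓ i = 1 ∨ ℓ i = -1) (hξ : ‖(WithLp.toLp 2 ξ : Euc n)‖ = 1)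
    (hu : u = (√n)⁻¹ • (WithLp.toLp 2 ℓ : Euc n)) :
    cosv ξ ℓ = |inner ℝ u (WithLp.toLp 2 ξ : Euc n)| := by
  have h1 : l2 ξ = 1 := by
    rw [l2, ← hξ, EuclideanSpace.norm_eq]; simp
  have h2 : l2 ℓ = √n := by
    rw [l2]; congr 1
    rw [Finset.sum_congr rfl (fun i _ => show ℓ i ^ 2 = 1 by rcases hℓ i with h | h <;> simp [h])]
    simp
  rw [cosv, h1, h2, one_mul, hu, real_inner_smul_left, abs_mul,
    abs_of_nonneg (by positivity : 0 ≤ (√(n : ℝ))⁻¹), div_eq_inv_mul]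
  rfl

lemma norm_label {n : ℕ} {ℓ : Fin n → ℝ} (hn : 0 < n) (hℓ : ∀ i, ℓ i = 1 ∨ ℓ i = -1) :
    ‖(√n)⁻¹ • (WithLp.toLp 2 ℓ : Euc n)‖ = 1 := by
  have h2 : ‖(WithLp.toLp 2 ℓ : Euc n)‖ = √n := by
    rw [EuclideanSpace.norm_eq]; congr 1
    rw [Finset.sum_congr rfl (fun i _ => show ‖ℓ i‖ ^ 2 = 1 by rcases hℓ i with h | h <;> simp [h])]
    simp
  rw [norm_smul, h2, norm_inv, Real.norm_of_nonneg (by positivity)]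
  exact inv_mul_cancel₀ (by positivity)

end Deterministic

/-- Quadratic forms of symmetric operators are controlled on a finite set of unit vectors. -/
lemma exists_net (n : ℕ) : ∃ N : Finset (Euc n), N.card ≤ 25 ^ n ∧ (∀ v ∈ N, ‖v‖ = 1) ∧
    ∀ (T : Euc n →L[ℝ] Euc n), (T : Euc n →ₗ[ℝ] Euc n).IsSymmetric → ∀ s : ℝ, 0 ≤ s →
      (∀ v ∈ N, |inner ℝ (T v) v| ≤ s) → ∀ v, |inner ℝ (T v) v| ≤ 4 * s * ‖v‖ ^ 2 := by
  let P : Finset (Euc n) → Prop := fun A => (∀ a ∈ A, ‖a‖ ≤ 2) ∧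
    ∀ a ∈ A, ∀ b ∈ A, a ≠ b → 1 ≤ ‖a - b‖
  have hcard : ∀ A, P A → A.card ≤ 5 ^ n := fun A hA => by
    have := Besicovitch.card_le_of_separated A hA.1 hA.2
    simpa using this
  obtain ⟨A, hA, hmax⟩ : ∃ A, P A ∧ ∀ A', P A' → A'.card ≤ A.card := by
    have hbd : BddAbove (Finset.card '' {A | P A}) :=
      ⟨5 ^ n, by rintro _ ⟨A, hA, rfl⟩; exact hcard A hA⟩
    have hne : (Finset.card '' {A | P A}).Nonempty := ⟨_, ∅, ⟨by simp, by simp⟩, rfl⟩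
    obtain ⟨A, hA, hAe⟩ := Nat.sSup_mem hne hbd
    refine ⟨A, hA, fun A' hA' => ?_⟩
    rw [hAe]
    exact le_csSup hbd ⟨A', hA', rfl⟩
  have hcov : ∀ v : Euc n, ‖v‖ ≤ 2 → ∃ a ∈ A, ‖v - a‖ ≤ 1 := by
    intro v hv
    by_contra! hcon
    have hvA : v ∉ A := fun h => by have := hcon v h; simp at this; linarith
    have := hmax (insert v A) ⟨fun a ha => by
      rcases Finset.mem_insert.1 ha with rfl | ha
      · exact hv
      · exact hA.1 a ha, fun a ha b hb hab => by
      rcases Finset.mem_insert.1 ha with rfl | ha' <;>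
        rcases Finset.mem_insert.1 hb with rfl | hb'
      · exact absurd rfl hab
      · exact (hcon b hb').le
      · rw [norm_sub_rev]; exact (hcon a ha').le
      · exact hA.2 a ha' b hb' hab⟩
    rw [Finset.card_insert_of_notMem hvA] at this
    omega
  let f : Euc n × Euc n → Euc n := fun ab => (1 / 2 : ℝ) • ab.1 + (1 / 4 : ℝ) • ab.2
  let N : Finset (Euc n) := (((A ×ˢ A).image f).filter (· ≠ 0)).image fun y => ‖y‖⁻¹ • y
  refine ⟨N, ?_, ?_, ?_⟩
  · refine Finset.card_image_le.trans ((Finset.card_filter_le _ _).trans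
      (Finset.card_image_le.trans ?_))
    rw [Finset.card_product]
    calc A.card * A.card ≤ 5 ^ n * 5 ^ n := Nat.mul_le_mul (hcard A hA) (hcard A hA)
      _ = 25 ^ n := by rw [← mul_pow]; norm_num
  · intro v hv
    obtain ⟨y, hy, rfl⟩ := Finset.mem_image.1 hv
    exact norm_smul_inv_norm (𝕜 := ℝ) (Finset.mem_filter.1 hy).2
  · intro T hT s hs hN
    have hy : ∀ a ∈ A, ∀ b ∈ A, |inner ℝ (T (f (a, b))) (f (a, b))| ≤ s * ‖f (a, b)‖ ^ 2 := by
      intro a ha b hb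
      set y := f (a, b)
      rcases eq_or_ne y 0 with h0 | h0
      · simp [h0]
      have hmem : ‖y‖⁻¹ • y ∈ N := Finset.mem_image.2 ⟨y, Finset.mem_filter.2
        ⟨Finset.mem_image.2 ⟨(a, b), Finset.mk_mem_product ha hb, rfl⟩, h0⟩, rfl⟩
      have h1 := hN _ hmem
      rw [map_smul, real_inner_smul_left, real_inner_smul_right, ← mul_assoc, abs_mul,
        abs_of_nonneg (by positivity : 0 ≤ ‖y‖⁻¹ * ‖y‖⁻¹)] at h1
      have hyn : 0 < ‖y‖ := norm_pos_iff.2 h0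
      field_simp at h1
      linarith
    have hunit : ∀ v : Euc n, ‖v‖ = 1 → |inner ℝ (T v) v| ≤ 25 / 16 * s + 9 / 16 * ‖T‖ := by
      intro v hv
      obtain ⟨a, ha, hva⟩ := hcov ((2 : ℝ) • v) (by rw [norm_smul, hv]; simp)
      obtain ⟨b, hb, hvb⟩ := hcov ((4 : ℝ) • v - (2 : ℝ) • a) (by
        have : (4 : ℝ) • v - (2 : ℝ) • a = (2 : ℝ) • ((2 : ℝ) • v - a) := by
          rw [smul_sub, smul_smul]; norm_num
        rw [this, norm_smul]; simp; linarith)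
      set y := f (a, b) with hyd
      have hd : ‖v - y‖ ≤ 1 / 4 := by
        have : v - y = (1 / 4 : ℝ) • ((4 : ℝ) • v - (2 : ℝ) • a - b) := by
          simp only [hyd, f, smul_sub, smul_smul]; norm_num; abel
        rw [this, norm_smul, Real.norm_of_nonneg (by norm_num)]; linarith
      have hyn : ‖y‖ ≤ 5 / 4 := by
        have h2 := norm_sub_norm_le y v
        rw [norm_sub_rev] at h2; linarith
      have hvy : ‖v + y‖ ≤ 9 / 4 := (norm_add_le _ _).trans (by linarith)
      have hident : inner ℝ (T v) v = inner ℝ (T y) y + inner ℝ (T (v - y)) (v + y) := by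
        have h3 : inner ℝ (T v) y = inner ℝ (T y) v := by
          have := hT v y
          simp only [ContinuousLinearMap.coe_coe] at this
          rw [this, real_inner_comm]
        rw [map_sub, inner_sub_left, inner_add_right (T v) v y, inner_add_right (T y) v y, h3]; ring
      have h4 : |inner ℝ (T (v - y)) (v + y)| ≤ ‖T‖ * (1 / 4) * (9 / 4) := by
        refine (abs_real_inner_le_norm _ _).trans ?_
        have h5 := T.le_opNorm (v - y)
        have h6 : ‖T‖ * ‖v - y‖ ≤ ‖T‖ * (1 / 4) := by gcongr
        exact mul_le_mul (h5.trans h6) hvy (norm_nonneg _) (by positivity)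
      have h7 : s * ‖y‖ ^ 2 ≤ s * (5 / 4) ^ 2 := by gcongr
      rw [hident]
      refine (abs_add_le _ _).trans ?_
      have := hy a ha b hb
      linarith
    have hTn : ‖T‖ ≤ 25 / 16 * s + 9 / 16 * ‖T‖ := by
      refine opNorm_le_of_abs_inner_le hT (by positivity) fun v => ?_
      rcases eq_or_ne v 0 with rfl | h0
      · simp
      have h1 := hunit (‖v‖⁻¹ • v) (norm_smul_inv_norm (𝕜 := ℝ) h0)
      rw [map_smul, real_inner_smul_left, real_inner_smul_right, ← mul_assoc, abs_mul,
        abs_of_nonneg (by positivity : 0 ≤ ‖v‖⁻¹ * ‖v‖⁻¹)] at h1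
      have hvn : 0 < ‖v‖ := norm_pos_iff.2 h0
      have h2 : |inner ℝ (T v) v| = ‖v‖ ^ 2 * (‖v‖⁻¹ * ‖v‖⁻¹ * |inner ℝ (T v) v|) := by
        field_simp
      rw [h2, mul_comm]
      exact mul_le_mul_of_nonneg_right h1 (by positivity)
    intro v
    have h1 := abs_real_inner_le_norm (T v) v
    have h2 := T.le_opNorm v
    nlinarith [norm_nonneg v, mul_nonneg (norm_nonneg v) (norm_nonneg v)]

end

section

/-- `χ` is the indicator function of a set of radii `ρ` with `n ≤ ρ² ≤ 2n`. -/
structure IsTrunc (n : ℕ) (χ : ℝ → ℝ) : Prop where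
  meas : Measurable χ
  zero_or_one : ∀ ρ, χ ρ = 0 ∨ χ ρ = 1
  lower : ∀ ρ, χ ρ = 1 → (n : ℝ) ≤ ρ ^ 2
  upper : ∀ ρ, χ ρ = 1 → ρ ^ 2 ≤ 2 * n

namespace IsTrunc

variable {n : ℕ} {χ : ℝ → ℝ}

lemma nonneg (hχ : IsTrunc n χ) (ρ : ℝ) : 0 ≤ χ ρ := by
  rcases hχ.zero_or_one ρ with h | h <;> simp [h]

lemma le_one (hχ : IsTrunc n χ) (ρ : ℝ) : χ ρ ≤ 1 := by
  rcases hχ.zero_or_one ρ with h | h <;> simp [h]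

lemma integrable_mul (hχ : IsTrunc n χ) {f : Euc n → ℝ} (hf : Continuous f) :
    Integrable (fun z => χ ‖z‖ * f z) (stdG n) := by
  obtain ⟨C, hC⟩ := (isCompact_closedBall (0 : Euc n) (√(2 * n))).exists_bound_of_continuousOn
    hf.continuousOn
  refine Integrable.of_bound (C := max C 0) ?_ (ae_of_all _ fun z => ?_)
  · exact ((hχ.meas.comp measurable_norm).mul hf.measurable).aestronglyMeasurable
  · rcases hχ.zero_or_one ‖z‖ with h | h
    · simp [h]
    · rw [h, one_mul]
      refine (hC z ?_).trans (le_max_left _ _)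
      rw [mem_closedBall_zero_iff]
      exact Real.le_sqrt_of_sq_le (hχ.upper _ h)

lemma integrable (hχ : IsTrunc n χ) : Integrable (fun z : Euc n => χ ‖z‖) (stdG n) := by
  simpa using hχ.integrable_mul (f := fun _ => 1) continuous_const

lemma integral_mono (hχ : IsTrunc n χ) {f g : Euc n → ℝ} (hf : Continuous f) (hg : Continuous g)
    (h : ∀ z, χ ‖z‖ = 1 → f z ≤ g z) :
    ∫ z, χ ‖z‖ * f z ∂(stdG n) ≤ ∫ z, χ ‖z‖ * g z ∂(stdG n) := by
  refine MeasureTheory.integral_mono (hχ.integrable_mul hf) (hχ.integrable_mul hg) fun z => ?_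
  rcases hχ.zero_or_one ‖z‖ with h1 | h1
  · simp [h1]
  · simpa [h1] using h z h1

lemma integral_const_mul_le (hχ : IsTrunc n χ) {f : Euc n → ℝ} (hf : Continuous f) {c : ℝ}
    (h : ∀ z, χ ‖z‖ = 1 → f z ≤ c) :
    ∫ z, χ ‖z‖ * f z ∂(stdG n) ≤ c * ∫ z : Euc n, χ ‖z‖ ∂(stdG n) := by
  rw [← MeasureTheory.integral_const_mul]
  simp_rw [mul_comm c]
  exact hχ.integral_mono hf continuous_const h

lemma mass_nonneg (hχ : IsTrunc n χ) : 0 ≤ ∫ z : Euc n, χ ‖z‖ ∂(stdG n) :=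
  integral_nonneg fun _ => hχ.nonneg _

lemma mass_le_one (hχ : IsTrunc n χ) : ∫ z : Euc n, χ ‖z‖ ∂(stdG n) ≤ 1 := by
  have := MeasureTheory.integral_mono hχ.integrable (integrable_const (1 : ℝ))
    (fun z => hχ.le_one ‖z‖)
  simpa using this

end IsTrunc

lemma integral_inner_symm {n : ℕ} (χ : ℝ → ℝ) (v : Euc n) (c : ℝ) :
    ∫ z : Euc n, χ ‖z‖ * Real.exp (c * inner ℝ z v) ∂(stdG n) =
      ∫ z : Euc n, χ ‖z‖ * Real.exp (-(c * inner ℝ z v)) ∂(stdG n) := by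
  have := integral_norm_inner_congr (v := v) (w := -v) (by simp)
    (fun a b => χ a * Real.exp (c * b))
  simpa using this

lemma IsTrunc.integral_exp_eq_cosh {n : ℕ} {χ : ℝ → ℝ} (hχ : IsTrunc n χ) (v : Euc n) (c : ℝ) :
    ∫ z : Euc n, χ ‖z‖ * Real.exp (c * inner ℝ z v) ∂(stdG n) =
      ∫ z : Euc n, χ ‖z‖ * Real.cosh (c * inner ℝ z v) ∂(stdG n) := by
  have h := integral_inner_symm χ v c
  have h2 : ∫ z : Euc n, χ ‖z‖ * Real.cosh (c * inner ℝ z v) ∂(stdG n) =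
      (∫ z : Euc n, χ ‖z‖ * Real.exp (c * inner ℝ z v) ∂(stdG n) +
      ∫ z : Euc n, χ ‖z‖ * Real.exp (-(c * inner ℝ z v)) ∂(stdG n)) / 2 := by
    rw [← integral_add (hχ.integrable_mul (by fun_prop)) (hχ.integrable_mul (by fun_prop)),
      ← integral_div]
    congr 1; ext z; rw [Real.cosh_eq]; ring
  rw [h2, ← h]; ring

lemma measureReal_norm_sq_le (n : ℕ) {s : ℝ} (hs : 0 ≤ s) (t : ℝ) :
    (stdG n).real {z | ‖z‖ ^ 2 ≤ t} ≤ Real.exp (s * t) * ((√(1 + 2 * s))⁻¹) ^ n := by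
  have h := mul_meas_ge_le_integral_of_nonneg (μ := stdG n)
    (f := fun z => Real.exp (-s * ‖z‖ ^ 2)) (ae_of_all _ fun z => (Real.exp_pos _).le)
    (integrable_exp_norm_sq (by linarith)) (Real.exp (-s * t))
  rw [integral_exp_norm_sq (by linarith)] at h
  have hsub : {z : Euc n | ‖z‖ ^ 2 ≤ t} ⊆ {z | Real.exp (-s * t) ≤ Real.exp (-s * ‖z‖ ^ 2)} := by
    intro z hz
    rw [Set.mem_ofPred_eq] at hz ⊢
    rw [Real.exp_le_exp]; nlinarith
  have h2 := measureReal_mono (μ := stdG n) hsub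
  have h3 : 0 < Real.exp (-s * t) := Real.exp_pos _
  have h4 : Real.exp (s * t) * Real.exp (-s * t) = 1 := by rw [← Real.exp_add]; simp
  have h5 : (1 - 2 * -s) = 1 + 2 * s := by ring
  rw [h5] at h
  rw [← div_le_iff₀' (Real.exp_pos _)]
  rw [div_eq_mul_inv, ← Real.exp_neg]
  have h6 := mul_le_mul_of_nonneg_right h2 h3.le
  have h7 : (stdG n).real {z | Real.exp (-s * t) ≤ Real.exp (-s * ‖z‖ ^ 2)} * Real.exp (-s * t) ≤
      (√(1 + 2 * s))⁻¹ ^ n := by rw [mul_comm]; exact h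
  rw [← neg_mul]
  linarith

lemma measureReal_norm_sq_ge (n : ℕ) {s : ℝ} (hs : 0 ≤ s) (hs2 : s < 1 / 2) (t : ℝ) :
    (stdG n).real {z | t ≤ ‖z‖ ^ 2} ≤ Real.exp (-(s * t)) * ((√(1 - 2 * s))⁻¹) ^ n := by
  have h := mul_meas_ge_le_integral_of_nonneg (μ := stdG n)
    (f := fun z => Real.exp (s * ‖z‖ ^ 2)) (ae_of_all _ fun z => (Real.exp_pos _).le)
    (integrable_exp_norm_sq hs2) (Real.exp (s * t))
  rw [integral_exp_norm_sq hs2] at h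
  have hsub : {z : Euc n | t ≤ ‖z‖ ^ 2} ⊆ {z | Real.exp (s * t) ≤ Real.exp (s * ‖z‖ ^ 2)} := by
    intro z hz
    rw [Set.mem_ofPred_eq] at hz ⊢
    rw [Real.exp_le_exp]; nlinarith
  have h2 := measureReal_mono (μ := stdG n) hsub
  rw [Real.exp_neg, inv_mul_eq_div, le_div_iff₀ (Real.exp_pos _), mul_comm]
  exact (mul_le_mul_of_nonneg_left h2 (Real.exp_pos _).le).trans h

lemma half_le_measureReal_norm_sq {n : ℕ} (hn : 4 ≤ n) :
    1 / 2 ≤ (stdG n).real {z : Euc n | (n : ℝ) / 4 ≤ ‖z‖ ^ 2} := by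
  have h := measureReal_norm_sq_le n (s := 3 / 2) (by norm_num) (n / 4)
  have h1 : √(1 + 2 * (3 / 2 : ℝ)) = 2 := by
    rw [show (1 + 2 * (3 / 2 : ℝ)) = 2 ^ 2 by norm_num]; exact Real.sqrt_sq (by norm_num)
  have h2 : Real.exp (3 / 2 * (n / 4)) * (2⁻¹ : ℝ) ^ n = (Real.exp (3 / 8) * 2⁻¹) ^ n := by
    rw [mul_pow, ← Real.exp_nat_mul]; congr 2; ring
  have h3 : Real.exp (3 / 8) ≤ 8 / 5 := by
    have := Real.add_one_le_exp (-(3 / 8 : ℝ))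
    rw [Real.exp_neg] at this
    have h4 := Real.exp_pos (3 / 8 : ℝ)
    have h5 : (5 / 8 : ℝ) ≤ (Real.exp (3 / 8))⁻¹ := by linarith
    rw [le_inv_comm₀ (by norm_num) h4] at h5
    linarith
  have h4 : (Real.exp (3 / 8) * 2⁻¹) ^ n ≤ 1 / 2 := by
    calc (Real.exp (3 / 8) * 2⁻¹) ^ n ≤ (4 / 5 : ℝ) ^ n :=
          pow_le_pow_left₀ (by positivity) (by linarith) n
      _ ≤ (4 / 5 : ℝ) ^ 4 := pow_le_pow_of_le_one (by norm_num) (by norm_num) hn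
      _ ≤ 1 / 2 := by norm_num
  rw [h1, h2] at h
  have hc : (stdG n).real {z : Euc n | (n : ℝ) / 4 ≤ ‖z‖ ^ 2}ᶜ ≤ 1 / 2 := by
    refine (measureReal_mono ?_).trans (h.trans h4)
    intro z hz
    simp only [Set.mem_compl_iff, Set.mem_ofPred_eq, not_le] at hz ⊢
    exact hz.le
  rw [measureReal_compl (measurableSet_le (by fun_prop) (by fun_prop)), probReal_univ] at hc
  linarith

/-- Subgaussian bound for the inner product with a fixed unit vector, restricted to an event
depending only on the norm. -/
lemma IsTrunc.integral_exp_inner_le {n : ℕ} {χ : ℝ → ℝ} (hχ : IsTrunc n χ) (hn : 4 ≤ n)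
    {v : Euc n} (hv : ‖v‖ = 1) (c : ℝ) :
    ∫ z : Euc n, χ ‖z‖ * Real.exp (c * inner ℝ z v) ∂(stdG n) ≤
      2 * (∫ z : Euc n, χ ‖z‖ ∂(stdG n)) * Real.exp (4 * c ^ 2) := by
  have hn0 : (0 : ℝ) < n := by have : 0 < n := by omega
                               exact_mod_cast this
  set ψ := ∫ z : Euc n, χ ‖z‖ * Real.exp (c * inner ℝ z v) ∂(stdG n) with hψ
  have hψ0 : 0 ≤ ψ := integral_nonneg fun z => mul_nonneg (hχ.nonneg _) (Real.exp_pos _).le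
  set c' := 2 * c / √n with hc'
  have hc'2 : c' ^ 2 * n = 4 * c ^ 2 := by
    rw [hc', div_pow, Real.sq_sqrt hn0.le]; field_simp; ring
  have h_int : Integrable (fun w : Euc n × Euc n => χ ‖w.1‖ * Real.exp (c' * inner ℝ w.1 w.2))
      ((stdG n).prod (stdG n)) := by
    have hm : AEStronglyMeasurable
        (fun w : Euc n × Euc n => χ ‖w.1‖ * Real.exp (c' * inner ℝ w.1 w.2))
        ((stdG n).prod (stdG n)) := by
      refine Measurable.aestronglyMeasurable ?_
      exact ((hχ.meas.comp (measurable_norm.comp measurable_fst)).mul (by fun_prop))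
    rw [integrable_prod_iff hm]
    constructor
    · refine ae_of_all _ fun z => ?_
      have := (integrable_exp_inner z c').const_mul (χ ‖z‖)
      simpa only [real_inner_comm] using this
    · have h1 : ∀ z : Euc n, ∫ w : Euc n, ‖χ ‖z‖ * Real.exp (c' * inner ℝ z w)‖ ∂(stdG n) =
          χ ‖z‖ * Real.exp (c' ^ 2 * ‖z‖ ^ 2 / 2) := by
        intro z
        rw [← integral_exp_inner z c', ← integral_const_mul]
        congr 1; ext w
        rw [Real.norm_of_nonneg (mul_nonneg (hχ.nonneg _) (Real.exp_pos _).le), real_inner_comm]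
      simp_rw [h1]
      exact hχ.integrable_mul (by fun_prop)
  have hA : ∫ w, (∫ z : Euc n, χ ‖z‖ * Real.exp (c' * inner ℝ z w) ∂(stdG n)) ∂(stdG n) ≤
      Real.exp (4 * c ^ 2) * ∫ z : Euc n, χ ‖z‖ ∂(stdG n) := by
    rw [← integral_integral_swap (f := fun z w : Euc n => χ ‖z‖ * Real.exp (c' * inner ℝ z w))
      h_int]
    have h1 : ∀ z : Euc n, ∫ w : Euc n, χ ‖z‖ * Real.exp (c' * inner ℝ z w) ∂(stdG n) =
        χ ‖z‖ * Real.exp (c' ^ 2 * ‖z‖ ^ 2 / 2) := by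
      intro z
      rw [← integral_exp_inner z c', ← integral_const_mul]
      congr 1; ext w; rw [real_inner_comm]
    simp_rw [h1]
    refine hχ.integral_const_mul_le (by fun_prop) fun z hz => ?_
    rw [Real.exp_le_exp, ← hc'2]
    have := hχ.upper _ hz
    nlinarith [sq_nonneg c']
  have hB : ψ * (1 / 2) ≤
      ∫ w, (∫ z : Euc n, χ ‖z‖ * Real.exp (c' * inner ℝ z w) ∂(stdG n)) ∂(stdG n) := by
    have hms : MeasurableSet {z : Euc n | (n : ℝ) / 4 ≤ ‖z‖ ^ 2} :=
      measurableSet_le (by fun_prop) (by fun_prop)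
    calc ψ * (1 / 2) ≤ ψ * (stdG n).real {z : Euc n | (n : ℝ) / 4 ≤ ‖z‖ ^ 2} :=
          mul_le_mul_of_nonneg_left (half_le_measureReal_norm_sq hn) hψ0
      _ = ∫ w, Set.indicator {z : Euc n | (n : ℝ) / 4 ≤ ‖z‖ ^ 2} (fun _ => ψ) w ∂(stdG n) := by
          rw [integral_indicator_const _ hms, smul_eq_mul, mul_comm]
      _ ≤ _ := by
          refine MeasureTheory.integral_mono ((integrable_const _).indicator hms)
            h_int.integral_prod_right fun w => ?_
          refine Set.indicator_apply_le' (fun hw => ?_) (fun _ => integral_nonneg fun z =>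
            mul_nonneg (hχ.nonneg _) (Real.exp_pos _).le)
          rw [Set.mem_ofPred_eq] at hw
          have h1 : ∫ z : Euc n, χ ‖z‖ * Real.exp (c' * inner ℝ z w) ∂(stdG n) =
              ∫ z : Euc n, χ ‖z‖ * Real.exp ((c' * ‖w‖) * inner ℝ z v) ∂(stdG n) := by
            have := integral_norm_inner_congr (v := w) (w := ‖w‖ • v)
              (by rw [norm_smul, hv]; simp) (fun a b => χ a * Real.exp (c' * b))
            rw [this]
            simp only [real_inner_smul_right, mul_assoc]
          simp only
          rw [h1, hψ, hχ.integral_exp_eq_cosh, hχ.integral_exp_eq_cosh]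
          refine hχ.integral_mono (by fun_prop) (by fun_prop) fun z _ => ?_
          rw [Real.cosh_le_cosh, abs_mul, abs_mul]
          refine mul_le_mul_of_nonneg_right ?_ (abs_nonneg _)
          apply sq_le_sq.1
          rw [mul_pow, hc', div_pow, Real.sq_sqrt hn0.le, mul_pow, div_mul_eq_mul_div,
            le_div_iff₀ hn0]
          nlinarith [sq_nonneg c]
  linarith

lemma IsTrunc.integral_exp_inner_sq_le {n : ℕ} {χ : ℝ → ℝ} (hχ : IsTrunc n χ) (hn : 4 ≤ n)
    {v : Euc n} (hv : ‖v‖ = 1) :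
    ∫ z : Euc n, χ ‖z‖ * Real.exp (inner ℝ z v ^ 2 / 32) ∂(stdG n) ≤
      3 * (∫ z : Euc n, χ ‖z‖ ∂(stdG n)) := by
  set π := ∫ z : Euc n, χ ‖z‖ ∂(stdG n) with hπ
  have h1 : ∀ z : Euc n, χ ‖z‖ * Real.exp (inner ℝ z v ^ 2 / 32) =
      ∫ G, χ ‖z‖ * Real.exp (G / 4 * inner ℝ z v) ∂(gaussianReal 0 1) := by
    intro z
    rw [integral_const_mul]
    congr 1
    have h := congrFun (mgf_id_gaussianReal (μ := 0) (v := 1)) (inner ℝ z v / 4)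
    rw [mgf] at h
    simp only [id] at h
    rw [show (fun G : ℝ => Real.exp (G / 4 * inner ℝ z v)) =
      fun G => Real.exp (inner ℝ z v / 4 * G) by ext; congr 1; ring, h]
    congr 1; push_cast; ring
  have h_int : Integrable (fun w : Euc n × ℝ => χ ‖w.1‖ * Real.exp (w.2 / 4 * inner ℝ w.1 v))
      ((stdG n).prod (gaussianReal 0 1)) := by
    have hm : AEStronglyMeasurable
        (fun w : Euc n × ℝ => χ ‖w.1‖ * Real.exp (w.2 / 4 * inner ℝ w.1 v))
        ((stdG n).prod (gaussianReal 0 1)) := by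
      refine Measurable.aestronglyMeasurable ?_
      exact ((hχ.meas.comp (measurable_norm.comp measurable_fst)).mul (by fun_prop))
    rw [integrable_prod_iff hm]
    constructor
    · refine ae_of_all _ fun z => ?_
      have := (integrable_exp_mul_gaussianReal (μ := 0) (v := 1) (inner ℝ z v / 4)).const_mul
        (χ ‖z‖)
      refine this.congr (ae_of_all _ fun G => ?_)
      simp only
      congr 2; ring
    · have h2 : ∀ z : Euc n, ∫ G, ‖χ ‖z‖ * Real.exp (G / 4 * inner ℝ z v)‖ ∂(gaussianReal 0 1) =
          χ ‖z‖ * Real.exp (inner ℝ z v ^ 2 / 32) := by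
        intro z
        rw [h1]
        congr 1; ext w
        rw [Real.norm_of_nonneg (mul_nonneg (hχ.nonneg _) (Real.exp_pos _).le)]
      simp_rw [h2]
      exact hχ.integrable_mul (by fun_prop)
  simp_rw [h1]
  rw [integral_integral_swap (f := fun (z : Euc n) G => χ ‖z‖ * Real.exp (G / 4 * inner ℝ z v))
    h_int]
  have h3 : ∫ G : ℝ, 2 * π * Real.exp (1 / 4 * G ^ 2) ∂(gaussianReal 0 1) ≤ 3 * π := by
    rw [integral_const_mul, integral_exp_sq_gaussianReal (by norm_num)]
    have h4 : (√(1 - 2 * (1 / 4 : ℝ)))⁻¹ ≤ 3 / 2 := by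
      rw [← Real.sqrt_inv, Real.sqrt_le_left (by norm_num)]; norm_num
    have := mul_le_mul_of_nonneg_left h4 (by have := hχ.mass_nonneg; positivity : 0 ≤ 2 * π)
    linarith
  refine le_trans (MeasureTheory.integral_mono h_int.integral_prod_right
    ((integrable_exp_sq_gaussianReal (by norm_num)).const_mul _) fun G => ?_) h3
  have h5 : 1 / 4 * G ^ 2 = 4 * (G / 4) ^ 2 := by ring
  simp only [h5]
  exact hχ.integral_exp_inner_le hn hv (G / 4)

end

section

lemma exp_sub_one_sub_le (y : ℝ) : Real.exp y - 1 - y ≤ y ^ 2 * Real.exp |y| := by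
  have h1 : ∀ x : ℝ, Real.exp x - 1 ≤ x * Real.exp x := by
    intro x
    have h2 := Real.add_one_le_exp (-x)
    have h3 : Real.exp (-x) * Real.exp x = 1 := by rw [← Real.exp_add]; simp
    nlinarith [Real.exp_pos x]
  have h4 := Real.add_one_le_exp y
  have h5 := h1 y
  rcases le_total 0 y with hy | hy
  · rw [abs_of_nonneg hy]; nlinarith
  · rw [abs_of_nonpos hy]
    have h6 : 1 ≤ Real.exp (-y) := Real.one_le_exp (by linarith)
    nlinarith [sq_nonneg y]

namespace IsTrunc

variable {n : ℕ} {χ : ℝ → ℝ}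

lemma integral_comp_eq (hχ : IsTrunc n χ) {f : ℝ → ℝ} {Y : Euc n → ℝ} (hf : Continuous f)
    (hY : Continuous Y) (h0 : f 0 = 1) :
    ∫ z, f (χ ‖z‖ * Y z) ∂(stdG n) = 1 + ∫ z, χ ‖z‖ * (f (Y z) - 1) ∂(stdG n) := by
  have h1 : ∀ z : Euc n, f (χ ‖z‖ * Y z) = 1 + χ ‖z‖ * (f (Y z) - 1) := by
    intro z
    rcases hχ.zero_or_one ‖z‖ with h | h <;> simp [h, h0]
  simp_rw [h1]
  rw [integral_add (integrable_const _) (hχ.integrable_mul (by fun_prop))]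
  simp

lemma integral_inner_sq_eq (hχ : IsTrunc n χ) {v : Euc n} (hv : ‖v‖ = 1) :
    n * ∫ z : Euc n, χ ‖z‖ * inner ℝ z v ^ 2 ∂(stdG n) =
      ∫ z : Euc n, χ ‖z‖ * ‖z‖ ^ 2 ∂(stdG n) := by
  have h1 : ∀ i : Fin n, ∫ z : Euc n, χ ‖z‖ * z i ^ 2 ∂(stdG n) =
      ∫ z : Euc n, χ ‖z‖ * inner ℝ z v ^ 2 ∂(stdG n) := by
    intro i
    have := integral_norm_inner_congr (v := EuclideanSpace.single i (1 : ℝ)) (w := v)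
      (by simp [hv]) (fun a b => χ a * b ^ 2)
    have h2 : ∀ z : Euc n, inner ℝ z (EuclideanSpace.single i (1 : ℝ)) = z i := by
      intro z; simp [EuclideanSpace.inner_single_right]
    simp_rw [h2] at this
    exact this
  have h2 : ∀ z : Euc n, χ ‖z‖ * ‖z‖ ^ 2 = ∑ i, χ ‖z‖ * z i ^ 2 := by
    intro z; rw [EuclideanSpace.real_norm_sq_eq, Finset.mul_sum]
  simp_rw [h2]
  rw [integral_finsetSum _ (fun i _ => hχ.integrable_mul (by fun_prop)),
    Finset.sum_congr rfl (fun i _ => h1 i)]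
  simp

lemma integral_inner_sq_sub (hχ : IsTrunc n χ) (hn : 0 < n) {v : Euc n} (hv : ‖v‖ = 1) :
    ∫ z : Euc n, χ ‖z‖ * (inner ℝ z v ^ 2 - ‖z‖ ^ 2 / n) ∂(stdG n) = 0 := by
  have hn0 : (n : ℝ) ≠ 0 := by positivity
  have h : ∀ z : Euc n, χ ‖z‖ * (inner ℝ z v ^ 2 - ‖z‖ ^ 2 / n) =
      χ ‖z‖ * inner ℝ z v ^ 2 - (n : ℝ)⁻¹ * (χ ‖z‖ * ‖z‖ ^ 2) := by intro z; field_simp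
  simp_rw [h]
  rw [integral_sub (hχ.integrable_mul (by fun_prop))
    ((hχ.integrable_mul (by fun_prop)).const_mul _), integral_const_mul,
    ← hχ.integral_inner_sq_eq hv, ← mul_assoc, inv_mul_cancel₀ hn0, one_mul, sub_self]

lemma mass_le_integral_inner_sq (hχ : IsTrunc n χ) (hn : 0 < n) {v : Euc n} (hv : ‖v‖ = 1) :
    ∫ z : Euc n, χ ‖z‖ ∂(stdG n) ≤ ∫ z : Euc n, χ ‖z‖ * inner ℝ z v ^ 2 ∂(stdG n) := by
  have hn0 : (0 : ℝ) < n := by positivity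
  have h := hχ.integral_inner_sq_eq hv
  have h2 : n * ∫ z : Euc n, χ ‖z‖ ∂(stdG n) ≤ ∫ z : Euc n, χ ‖z‖ * ‖z‖ ^ 2 ∂(stdG n) := by
    rw [← integral_const_mul]
    simp_rw [mul_comm (n : ℝ)]
    exact hχ.integral_mono (by fun_prop) (by fun_prop) fun z hz => hχ.lower _ hz
  rw [← h] at h2
  exact le_of_mul_le_mul_left h2 hn0

/-- Bernstein-type moment bound for the centred truncated squares. -/
lemma integral_exp_centered_le (hχ : IsTrunc n χ) (hn : 4 ≤ n) {v : Euc n} (hv : ‖v‖ = 1) {s : ℝ}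
    (hs : |s| ≤ 1 / 64) :
    ∫ z : Euc n, Real.exp (s * (χ ‖z‖ * (inner ℝ z v ^ 2 - ‖z‖ ^ 2 / n))) ∂(stdG n) ≤
      Real.exp (50000 * s ^ 2 * ∫ z : Euc n, χ ‖z‖ ∂(stdG n)) := by
  have hn0 : (0 : ℝ) < n := by have : 0 < n := by omega
                               exact_mod_cast this
  set π := ∫ z : Euc n, χ ‖z‖ ∂(stdG n) with hπ
  have hπ0 : 0 ≤ π := hχ.mass_nonneg
  have h0 := hχ.integral_comp_eq (f := fun x => Real.exp (s * x))
    (Y := fun z => inner ℝ z v ^ 2 - ‖z‖ ^ 2 / n) (by fun_prop) (by fun_prop) (by simp)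
  rw [h0]
  have h1 : ∫ z : Euc n, χ ‖z‖ * (Real.exp (s * (inner ℝ z v ^ 2 - ‖z‖ ^ 2 / n)) - 1) ∂(stdG n) ≤
      ∫ z : Euc n, χ ‖z‖ * (s * (inner ℝ z v ^ 2 - ‖z‖ ^ 2 / n) +
        s ^ 2 * (16384 * Real.exp (inner ℝ z v ^ 2 / 32))) ∂(stdG n) := by
    refine hχ.integral_mono (by fun_prop) (by fun_prop) fun z hz => ?_
    set Y := inner ℝ z v ^ 2 - ‖z‖ ^ 2 / n with hY
    have hz2 := hχ.upper _ hz
    have hzn : ‖z‖ ^ 2 / n ≤ 2 := by rw [div_le_iff₀ hn0]; exact hz2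
    have hzn0 : 0 ≤ ‖z‖ ^ 2 / n := by positivity
    have hYa : |Y| ≤ inner ℝ z v ^ 2 + 2 := by
      rw [abs_le]; constructor <;> nlinarith [sq_nonneg (inner ℝ z v)]
    have h2 := exp_sub_one_sub_le (s * Y)
    have h3 : Real.exp |s * Y| ≤ Real.exp (|Y| / 64) := by
      rw [Real.exp_le_exp, abs_mul]
      nlinarith [abs_nonneg Y]
    have h4 : Y ^ 2 ≤ 8192 * Real.exp (|Y| / 64) := by
      have := Real.pow_div_factorial_le_exp (|Y| / 64) (by positivity) 2
      rw [div_pow, sq_abs] at this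
      norm_num [Nat.factorial] at this
      linarith
    have h5 : Real.exp (|Y| / 64) * Real.exp (|Y| / 64) ≤ 2 * Real.exp (inner ℝ z v ^ 2 / 32) := by
      rw [← Real.exp_add]
      have h6 : Real.exp (|Y| / 64 + |Y| / 64) ≤ Real.exp (1 / 16 + inner ℝ z v ^ 2 / 32) := by
        rw [Real.exp_le_exp]; linarith
      rw [Real.exp_add (1 / 16)] at h6
      have h7 : Real.exp (1 / 16) ≤ 2 := by
        have h8 : Real.exp (1 / 16) ≤ Real.exp (Real.log 2) := by
          rw [Real.exp_le_exp]; linarith [Real.log_two_gt_d9]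
        rwa [Real.exp_log (by norm_num)] at h8
      exact h6.trans (mul_le_mul_of_nonneg_right h7 (Real.exp_pos _).le)
    have h9 : (s * Y) ^ 2 * Real.exp |s * Y| ≤
        s ^ 2 * (16384 * Real.exp (inner ℝ z v ^ 2 / 32)) := by
      rw [mul_pow, mul_assoc]
      refine mul_le_mul_of_nonneg_left ?_ (sq_nonneg s)
      calc Y ^ 2 * Real.exp |s * Y| ≤ 8192 * Real.exp (|Y| / 64) * Real.exp (|Y| / 64) :=
            mul_le_mul h4 h3 (Real.exp_pos _).le (by positivity)
        _ ≤ _ := by rw [mul_assoc]; linarith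
    linarith
  have h2 : ∫ z : Euc n, χ ‖z‖ * (s * (inner ℝ z v ^ 2 - ‖z‖ ^ 2 / n) +
        s ^ 2 * (16384 * Real.exp (inner ℝ z v ^ 2 / 32))) ∂(stdG n) =
      s * ∫ z : Euc n, χ ‖z‖ * (inner ℝ z v ^ 2 - ‖z‖ ^ 2 / n) ∂(stdG n) +
      16384 * s ^ 2 * ∫ z : Euc n, χ ‖z‖ * Real.exp (inner ℝ z v ^ 2 / 32) ∂(stdG n) := by
    rw [← integral_const_mul, ← integral_const_mul, ← integral_add
      ((hχ.integrable_mul (by fun_prop)).const_mul _)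
      ((hχ.integrable_mul (by fun_prop)).const_mul _)]
    congr 1; ext z; ring
  rw [h2, hχ.integral_inner_sq_sub (by omega) hv, mul_zero, zero_add] at h1
  have h3 := hχ.integral_exp_inner_sq_le hn hv
  have h4 := mul_le_mul_of_nonneg_left h3 (by positivity : 0 ≤ 16384 * s ^ 2)
  have h5 := Real.add_one_le_exp (50000 * s ^ 2 * π)
  nlinarith [mul_nonneg (sq_nonneg s) hπ0]

lemma integral_inner_pow_le (hχ : IsTrunc n χ) (hn : 4 ≤ n) {v : Euc n} (hv : ‖v‖ = 1) (k : ℕ) :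
    ∫ z : Euc n, χ ‖z‖ * inner ℝ z v ^ (2 * k) ∂(stdG n) ≤
      3 * (32 ^ k * k.factorial) * ∫ z : Euc n, χ ‖z‖ ∂(stdG n) := by
  have h1 : ∫ z : Euc n, χ ‖z‖ * inner ℝ z v ^ (2 * k) ∂(stdG n) ≤
      ∫ z : Euc n, χ ‖z‖ * ((32 ^ k * k.factorial) * Real.exp (inner ℝ z v ^ 2 / 32))
        ∂(stdG n) := by
    refine hχ.integral_mono (by fun_prop) (by fun_prop) fun z _ => ?_
    have := Real.pow_div_factorial_le_exp (inner ℝ z v ^ 2 / 32) (by positivity) k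
    rw [div_pow, div_div, div_le_iff₀ (by positivity), ← pow_mul] at this
    linarith
  have h2 : ∫ z : Euc n, χ ‖z‖ * ((32 ^ k * k.factorial) * Real.exp (inner ℝ z v ^ 2 / 32))
      ∂(stdG n) = (32 ^ k * k.factorial) *
        ∫ z : Euc n, χ ‖z‖ * Real.exp (inner ℝ z v ^ 2 / 32) ∂(stdG n) := by
    rw [← integral_const_mul]; congr 1; ext z; ring
  rw [h2] at h1
  have h3 := hχ.integral_exp_inner_sq_le hn hv
  have h4 := mul_le_mul_of_nonneg_left h3 (by positivity : (0 : ℝ) ≤ 32 ^ k * k.factorial)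
  linarith

lemma integral_inner_pow_congr {v w : Euc n} (h : ‖v‖ = ‖w‖) (k : ℕ) :
    ∫ z : Euc n, χ ‖z‖ * inner ℝ z v ^ k ∂(stdG n) =
      ∫ z : Euc n, χ ‖z‖ * inner ℝ z w ^ k ∂(stdG n) :=
  integral_norm_inner_congr h (fun a b => χ a * b ^ k)

lemma integral_inner_sq_mul_inner_sq (hχ : IsTrunc n χ) {u v : Euc n} (hu : ‖u‖ = 1)
    (hv : ‖v‖ = 1) (huv : inner ℝ u v = 0) :
    ∫ z : Euc n, χ ‖z‖ * (inner ℝ z u * inner ℝ z v) ^ 2 ∂(stdG n) =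
      (∫ z : Euc n, χ ‖z‖ * inner ℝ z u ^ 4 ∂(stdG n)) / 3 := by
  set A := ∫ z : Euc n, χ ‖z‖ * inner ℝ z u ^ 4 ∂(stdG n) with hA
  have hAv : ∫ z : Euc n, χ ‖z‖ * inner ℝ z v ^ 4 ∂(stdG n) = A :=
    integral_inner_pow_congr (by rw [hu, hv]) 4
  have hp : ‖u + v‖ = ‖(√2 : ℝ) • u‖ := by
    rw [norm_smul, hu, mul_one, Real.norm_of_nonneg (by positivity),
      ← sq_eq_sq₀ (by positivity) (by positivity), norm_add_sq_real, hu, hv, huv,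
      Real.sq_sqrt (by norm_num)]
    norm_num
  have hm : ‖u - v‖ = ‖(√2 : ℝ) • u‖ := by
    rw [norm_smul, hu, mul_one, Real.norm_of_nonneg (by positivity),
      ← sq_eq_sq₀ (by positivity) (by positivity), norm_sub_sq_real, hu, hv, huv,
      Real.sq_sqrt (by norm_num)]
    norm_num
  have hs4 : (√2 : ℝ) ^ 4 = 4 := by
    rw [show 4 = 2 * 2 by norm_num, pow_mul, Real.sq_sqrt (by norm_num)]; norm_num
  have hsu : ∫ z : Euc n, χ ‖z‖ * inner ℝ z ((√2 : ℝ) • u) ^ 4 ∂(stdG n) = 4 * A := by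
    rw [hA, ← integral_const_mul]
    congr 1; ext z; rw [real_inner_smul_right, mul_pow, hs4]; ring
  have h1 := (integral_inner_pow_congr (χ := χ) hp 4).trans hsu
  have h2 := (integral_inner_pow_congr (χ := χ) hm 4).trans hsu
  have h3 : ∫ z : Euc n, χ ‖z‖ * (inner ℝ z u * inner ℝ z v) ^ 2 ∂(stdG n) =
      (1 / 12 : ℝ) * (∫ z : Euc n, χ ‖z‖ * inner ℝ z (u + v) ^ 4 ∂(stdG n) +
      ∫ z : Euc n, χ ‖z‖ * inner ℝ z (u - v) ^ 4 ∂(stdG n)) -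
      (1 / 6 : ℝ) * (∫ z : Euc n, χ ‖z‖ * inner ℝ z u ^ 4 ∂(stdG n) +
      ∫ z : Euc n, χ ‖z‖ * inner ℝ z v ^ 4 ∂(stdG n)) := by
    rw [← integral_add (hχ.integrable_mul (by fun_prop)) (hχ.integrable_mul (by fun_prop)),
      ← integral_add (hχ.integrable_mul (by fun_prop)) (hχ.integrable_mul (by fun_prop)),
      ← integral_const_mul, ← integral_const_mul, ← integral_sub]
    · congr 1; ext z; rw [inner_add_right, inner_sub_right]; ring
    · exact ((hχ.integrable_mul (by fun_prop)).add (hχ.integrable_mul (by fun_prop))).const_mul _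
    · exact ((hχ.integrable_mul (by fun_prop)).add (hχ.integrable_mul (by fun_prop))).const_mul _
  rw [h3, h1, h2, hAv]; ring

lemma mass_le_integral_inner_pow_four (hχ : IsTrunc n χ) (hn : 0 < n) {v : Euc n}
    (hv : ‖v‖ = 1) :
    ∫ z : Euc n, χ ‖z‖ ∂(stdG n) ≤ ∫ z : Euc n, χ ‖z‖ * inner ℝ z v ^ 4 ∂(stdG n) := by
  have h1 := hχ.mass_le_integral_inner_sq hn hv
  have h2 : 2 * ∫ z : Euc n, χ ‖z‖ * inner ℝ z v ^ 2 ∂(stdG n) - ∫ z : Euc n, χ ‖z‖ ∂(stdG n) ≤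
      ∫ z : Euc n, χ ‖z‖ * inner ℝ z v ^ 4 ∂(stdG n) := by
    rw [← integral_const_mul, ← integral_sub ((hχ.integrable_mul (by fun_prop)).const_mul _)
      hχ.integrable]
    refine le_trans (le_of_eq ?_) (hχ.integral_mono (f := fun z => 2 * inner ℝ z v ^ 2 - 1)
      (by fun_prop) (by fun_prop) fun z _ => ?_)
    · congr 1; ext z; ring
    · nlinarith [sq_nonneg (inner ℝ z v ^ 2 - 1)]
  linarith

/-- Characteristic-function bound for the truncated product of two orthogonal coordinates. -/
lemma norm_integral_cexp_le (hχ : IsTrunc n χ) (hn : 4 ≤ n) {u t : Euc n} (hu : ‖u‖ = 1)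
    (hut : inner ℝ u t = 0) (ht : ‖t‖ ^ 2 ≤ 1 / 10 ^ 9) :
    ‖∫ z : Euc n, Complex.exp ((χ ‖z‖ * (inner ℝ z u * inner ℝ z t) : ℝ) * Complex.I) ∂(stdG n)‖ ≤
      Real.exp (-((∫ z : Euc n, χ ‖z‖ ∂(stdG n)) * ‖t‖ ^ 2 / 12)) := by
  set π := ∫ z : Euc n, χ ‖z‖ ∂(stdG n) with hπ
  have hπ0 : 0 ≤ π := hχ.mass_nonneg
  have hπ1 : π ≤ 1 := hχ.mass_le_one
  set Y : Euc n → ℝ := fun z => inner ℝ z u * inner ℝ z t with hY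
  have hYc : Continuous Y := by fun_prop
  have hmeas : Measurable fun z : Euc n => χ ‖z‖ * Y z :=
    (hχ.meas.comp measurable_norm).mul hYc.measurable
  have hci : Integrable (fun z => Real.cos (χ ‖z‖ * Y z)) (stdG n) :=
    Integrable.of_bound (C := 1) (Real.measurable_cos.comp hmeas).aestronglyMeasurable
      (ae_of_all _ fun z => Real.abs_cos_le_one _)
  have hsi : Integrable (fun z => Real.sin (χ ‖z‖ * Y z)) (stdG n) :=
    Integrable.of_bound (C := 1) (Real.measurable_sin.comp hmeas).aestronglyMeasurable
      (ae_of_all _ fun z => Real.abs_sin_le_one _)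
  have hsin : ∫ z, Real.sin (χ ‖z‖ * Y z) ∂(stdG n) = 0 := by
    set f := (Submodule.span ℝ {u})ᗮ.reflection with hf
    have hfu : f u = -u := Submodule.reflection_orthogonalComplement_singleton_eq_neg u
    have hft : f t = t := by
      apply Submodule.reflection_mem_subspace_eq_self
      rw [Submodule.mem_orthogonal_singleton_iff_inner_right]
      exact hut
    have h := integral_comp_isometry_stdG f (fun z => Real.sin (χ ‖z‖ * Y z))
    have h2 : ∀ z, Real.sin (χ ‖f z‖ * Y (f z)) = -Real.sin (χ ‖z‖ * Y z) := by
      intro z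
      have e1 : inner ℝ (f z) u = -inner ℝ z u := by
        rw [← neg_eq_iff_eq_neg, ← inner_neg_right, ← hfu]; exact f.inner_map_map z u
      have e2 : inner ℝ (f z) t = inner ℝ z t := by
        conv_lhs => rw [← hft]
        exact f.inner_map_map z t
      simp only [hY, e1, e2, f.norm_map]
      rw [← Real.sin_neg]; congr 1; ring
    simp_rw [h2] at h
    rw [integral_neg] at h
    linarith
  have hcomb : ∫ z : Euc n, Complex.exp ((χ ‖z‖ * Y z : ℝ) * Complex.I) ∂(stdG n) =
      ((∫ z, Real.cos (χ ‖z‖ * Y z) ∂(stdG n) : ℝ) : ℂ) := by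
    have : ∀ z : Euc n, Complex.exp ((χ ‖z‖ * Y z : ℝ) * Complex.I) =
        ((Real.cos (χ ‖z‖ * Y z) : ℝ) : ℂ) + ((Real.sin (χ ‖z‖ * Y z) : ℝ) : ℂ) * Complex.I := by
      intro z; rw [Complex.exp_mul_I, Complex.ofReal_cos, Complex.ofReal_sin]
    simp_rw [this]
    rw [integral_add hci.ofReal (hsi.ofReal.mul_const _), integral_mul_const,
      integral_complex_ofReal, integral_complex_ofReal, hsin]
    simp
  rw [hcomb, Complex.norm_real, Real.norm_eq_abs]
  rw [hχ.integral_comp_eq Real.continuous_cos hYc Real.cos_zero]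
  rcases eq_or_ne t 0 with h0 | h0
  · simp [h0, hY]
  set ρ := ‖t‖ with hρ
  have hρ0 : 0 < ρ := norm_pos_iff.2 h0
  set v : Euc n := ρ⁻¹ • t with hv
  have hvn : ‖v‖ = 1 := norm_smul_inv_norm (𝕜 := ℝ) h0
  have hvt : t = ρ • v := by rw [hv, smul_smul, mul_inv_cancel₀ hρ0.ne', one_smul]
  have huv : inner ℝ u v = 0 := by rw [hv, real_inner_smul_right, hut, mul_zero]
  have hYρ : ∀ z, Y z = ρ * (inner ℝ z u * inner ℝ z v) := by
    intro z; simp only [hY]; rw [hvt, real_inner_smul_right]; ring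
  set A := ∫ z : Euc n, χ ‖z‖ * inner ℝ z u ^ 4 ∂(stdG n) with hA
  have hA1 : π ≤ A := hχ.mass_le_integral_inner_pow_four (by omega) hu
  have hA2 : A ≤ 6144 * π := by
    have := hχ.integral_inner_pow_le hn hu 2
    norm_num [Nat.factorial] at this
    exact this
  have hY2 : ∫ z, χ ‖z‖ * Y z ^ 2 ∂(stdG n) = ρ ^ 2 * (A / 3) := by
    rw [hA, ← hχ.integral_inner_sq_mul_inner_sq hu hvn huv, ← integral_const_mul]
    congr 1; ext z; rw [hYρ]; ring
  have hY4 : ∫ z, χ ‖z‖ * Y z ^ 4 ∂(stdG n) ≤ ρ ^ 4 * (75497472 * π) := by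
    have h1 : ∫ z, χ ‖z‖ * Y z ^ 4 ∂(stdG n) ≤
        ∫ z, χ ‖z‖ * (ρ ^ 4 / 2 * inner ℝ z u ^ 8 + ρ ^ 4 / 2 * inner ℝ z v ^ 8) ∂(stdG n) := by
      refine hχ.integral_mono (by fun_prop) (by fun_prop) fun z _ => ?_
      rw [hYρ]
      have := mul_nonneg (pow_nonneg hρ0.le 4)
        (sq_nonneg (inner ℝ z u ^ 4 - inner ℝ z v ^ 4 : ℝ))
      nlinarith
    have h2 : ∫ z, χ ‖z‖ * (ρ ^ 4 / 2 * inner ℝ z u ^ 8 + ρ ^ 4 / 2 * inner ℝ z v ^ 8) ∂(stdG n) =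
        ρ ^ 4 / 2 * ∫ z, χ ‖z‖ * inner ℝ z u ^ 8 ∂(stdG n) +
        ρ ^ 4 / 2 * ∫ z, χ ‖z‖ * inner ℝ z v ^ 8 ∂(stdG n) := by
      rw [← integral_const_mul, ← integral_const_mul, ← integral_add
        ((hχ.integrable_mul (by fun_prop)).const_mul _)
        ((hχ.integrable_mul (by fun_prop)).const_mul _)]
      congr 1; ext z; ring
    have h3 := hχ.integral_inner_pow_le hn hu 4
    have h4 := hχ.integral_inner_pow_le hn hvn 4
    norm_num [Nat.factorial] at h3 h4
    have h5 : 0 ≤ ρ ^ 4 / 2 := by positivity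
    have h6 := mul_le_mul_of_nonneg_left h3 h5
    have h7 := mul_le_mul_of_nonneg_left h4 h5
    rw [h2] at h1
    linarith
  have hup : ∫ z, χ ‖z‖ * (Real.cos (Y z) - 1) ∂(stdG n) ≤ -(ρ ^ 2 * (A / 3)) / 2 +
      ρ ^ 4 * (75497472 * π) := by
    have h1 : ∫ z, χ ‖z‖ * (Real.cos (Y z) - 1) ∂(stdG n) ≤
        ∫ z, χ ‖z‖ * (-(1 / 2) * Y z ^ 2 + Y z ^ 4) ∂(stdG n) := by
      refine hχ.integral_mono (by fun_prop) (by fun_prop) fun z _ => ?_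
      rcases le_or_gt |Y z| 1 with h | h
      · have h2 := (abs_le.1 (Real.cos_bound h)).2
        have h3 : |Y z| ^ 4 = Y z ^ 4 := by
          rw [show 4 = 2 * 2 by norm_num, pow_mul, sq_abs, pow_mul]
        rw [h3] at h2
        nlinarith [sq_nonneg (Y z ^ 2)]
      · have h2 : 1 < Y z ^ 2 := by rw [← sq_abs]; nlinarith
        nlinarith [Real.cos_le_one (Y z)]
    have h2 : ∫ z, χ ‖z‖ * (-(1 / 2) * Y z ^ 2 + Y z ^ 4) ∂(stdG n) =
        -(1 / 2) * ∫ z, χ ‖z‖ * Y z ^ 2 ∂(stdG n) + ∫ z, χ ‖z‖ * Y z ^ 4 ∂(stdG n) := by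
      rw [← integral_const_mul, ← integral_add
        ((hχ.integrable_mul (by fun_prop)).const_mul _) (hχ.integrable_mul (by fun_prop))]
      congr 1; ext z; ring
    rw [h2, hY2] at h1
    linarith
  have hlow : -(ρ ^ 2 * (A / 3)) / 2 ≤ ∫ z, χ ‖z‖ * (Real.cos (Y z) - 1) ∂(stdG n) := by
    have h1 : ∫ z, χ ‖z‖ * (-(1 / 2) * Y z ^ 2) ∂(stdG n) ≤
        ∫ z, χ ‖z‖ * (Real.cos (Y z) - 1) ∂(stdG n) := by
      refine hχ.integral_mono (by fun_prop) (by fun_prop) fun z _ => ?_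
      have := Real.one_sub_sq_div_two_le_cos (x := Y z)
      linarith
    have h2 : ∫ z, χ ‖z‖ * (-(1 / 2) * Y z ^ 2) ∂(stdG n) =
        -(1 / 2) * ∫ z, χ ‖z‖ * Y z ^ 2 ∂(stdG n) := by
      rw [← integral_const_mul]; congr 1; ext z; ring
    rw [h2, hY2] at h1
    linarith
  have hρ2 : 0 ≤ ρ ^ 2 := by positivity
  have hexp := Real.add_one_le_exp (-(π * ρ ^ 2 / 12))
  rw [abs_of_nonneg]
  · have : ρ ^ 4 * (75497472 * π) ≤ ρ ^ 2 * π / 12 := by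
      have h1 : ρ ^ 4 = ρ ^ 2 * ρ ^ 2 := by ring
      rw [h1]
      have h2 := mul_le_mul_of_nonneg_right ht (mul_nonneg hρ2 hπ0)
      nlinarith
    have h2 := mul_le_mul_of_nonneg_left hA1 hρ2
    nlinarith
  · have h2 := mul_le_mul_of_nonneg_left hA2 hρ2
    have h3 : ρ ^ 2 * π ≤ 1 / 10 ^ 9 * 1 := mul_le_mul ht hπ1 hπ0 (by norm_num)
    nlinarith

end IsTrunc

end

section

variable {n : ℕ} {ε τ : ℝ}

lemma colLaw_eq (n : ℕ) (ε τ : ℝ) : colLaw n ε τ =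
    ENNReal.ofReal (1 - ε) • (stdG n).map (Prod.mk 0) +
      ENNReal.ofReal ε • (stdG n).map (Prod.mk τ) := by
  unfold colLaw muLaw
  rw [Measure.add_prod, Measure.prod_smul_left, Measure.prod_smul_left, Measure.dirac_prod,
    Measure.dirac_prod]

lemma isProbabilityMeasure_colLaw (h0 : 0 ≤ ε) (h1 : ε ≤ 1) :
    IsProbabilityMeasure (colLaw n ε τ) := by
  have := isProbabilityMeasure_muLaw (τ := τ) h0 h1
  unfold colLaw; infer_instance

section integral

variable {F : Type*} [NormedAddCommGroup F] {f : ℝ × Euc n → F}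

lemma integrable_colLaw (hm : StronglyMeasurable f)
    (i0 : Integrable (fun z => f (0, z)) (stdG n))
    (i1 : Integrable (fun z => f (τ, z)) (stdG n)) : Integrable f (colLaw n ε τ) := by
  rw [colLaw_eq]
  refine Integrable.add_measure (Integrable.smul_measure ?_ (by simp))
    (Integrable.smul_measure ?_ (by simp))
  · rw [integrable_map_measure hm.aestronglyMeasurable (by fun_prop)]; exact i0
  · rw [integrable_map_measure hm.aestronglyMeasurable (by fun_prop)]; exact i1

lemma integral_colLaw [NormedSpace ℝ F] (h0 : 0 ≤ ε) (h1 : ε ≤ 1) (hm : StronglyMeasurable f)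
    (i0 : Integrable (fun z => f (0, z)) (stdG n))
    (i1 : Integrable (fun z => f (τ, z)) (stdG n)) :
    ∫ y, f y ∂(colLaw n ε τ) = (1 - ε) • ∫ z, f (0, z) ∂(stdG n) +
      ε • ∫ z, f (τ, z) ∂(stdG n) := by
  have j0 : Integrable f ((stdG n).map (Prod.mk 0)) := by
    rw [integrable_map_measure hm.aestronglyMeasurable (by fun_prop)]; exact i0
  have j1 : Integrable f ((stdG n).map (Prod.mk τ)) := by
    rw [integrable_map_measure hm.aestronglyMeasurable (by fun_prop)]; exact i1
  rw [colLaw_eq, integral_add_measure (j0.smul_measure (by simp)) (j1.smul_measure (by simp)),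
    integral_smul_measure, integral_smul_measure,
    integral_map (by fun_prop) hm.aestronglyMeasurable,
    integral_map (by fun_prop) hm.aestronglyMeasurable,
    ENNReal.toReal_ofReal (by linarith), ENNReal.toReal_ofReal h0]

end integral

lemma colLaw_apply {A : Set (ℝ × Euc n)} (hA : MeasurableSet A) :
    colLaw n ε τ A = ENNReal.ofReal (1 - ε) * stdG n {z | (0, z) ∈ A} +
      ENNReal.ofReal ε * stdG n {z | (τ, z) ∈ A} := by
  rw [colLaw_eq, Measure.add_apply, Measure.smul_apply, Measure.smul_apply,
    Measure.map_apply (by fun_prop) hA, Measure.map_apply (by fun_prop) hA]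
  rfl

lemma measureReal_colLaw (h0 : 0 ≤ ε) (h1 : ε ≤ 1) {A : Set (ℝ × Euc n)} (hA : MeasurableSet A) :
    (colLaw n ε τ).real A = (1 - ε) * (stdG n).real {z | (0, z) ∈ A} +
      ε * (stdG n).real {z | (τ, z) ∈ A} := by
  rw [Measure.real, colLaw_apply hA, ENNReal.toReal_add (by finiteness) (by finiteness),
    ENNReal.toReal_mul, ENNReal.toReal_mul, ENNReal.toReal_ofReal (by linarith),
    ENNReal.toReal_ofReal h0]
  rfl

lemma measure_pi_fst_notMem (p : ℕ) (h0 : 0 ≤ ε) (h1 : ε ≤ 1) :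
    Measure.pi (fun _ : Fin p => colLaw n ε τ) {y | ∃ j, (y j).1 ≠ 0 ∧ (y j).1 ≠ τ} = 0 := by
  have := isProbabilityMeasure_colLaw (n := n) (τ := τ) h0 h1
  have h := measure_exists_le (colLaw n ε τ) p {y | y.1 ≠ 0 ∧ y.1 ≠ τ}
  have hm : MeasurableSet {y : ℝ × Euc n | y.1 ≠ 0 ∧ y.1 ≠ τ} :=
    ((measurableSet_singleton 0).compl.inter (measurableSet_singleton τ).compl).preimage
      measurable_fst
  rw [colLaw_apply hm] at h
  simpa using h

lemma sum_indicator_eq_card {α : Type*} {p : ℕ} (A : Set α) (c : ℝ) (y : Fin p → α) :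
    ∑ j, A.indicator (fun _ => c) (y j) = (Finset.univ.filter fun j => y j ∈ A).card * c := by
  simp [Set.indicator_apply, Finset.sum_ite]

section counting

variable {α : Type*} [MeasurableSpace α] (ν : Measure α) [IsProbabilityMeasure ν]

lemma integral_exp_indicator {A : Set α} (hA : MeasurableSet A) (c : ℝ) :
    Integrable (fun a => Real.exp (A.indicator (fun _ => c) a)) ν ∧
    ∫ a, Real.exp (A.indicator (fun _ => c) a) ∂ν = 1 + ν.real A * (Real.exp c - 1) := by
  have h : ∀ a, Real.exp (A.indicator (fun _ => c) a) =
      1 + A.indicator (fun _ => Real.exp c - 1) a := by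
    intro a; by_cases ha : a ∈ A <;> simp [ha]
  have hi : Integrable (A.indicator (fun _ => Real.exp c - 1)) ν :=
    (integrable_const _).indicator hA
  simp_rw [h]
  refine ⟨(integrable_const _).add hi, ?_⟩
  rw [integral_add (integrable_const _) hi, integral_indicator hA]
  simp

lemma measure_card_le (p : ℕ) {A : Set α} (hA : MeasurableSet A) :
    Measure.pi (fun _ : Fin p => ν)
      {y | ((Finset.univ.filter fun j => y j ∈ A).card : ℝ) ≤ p * ν.real A / 4} ≤
      ENNReal.ofReal (Real.exp (-(p * ν.real A / 4))) := by
  obtain ⟨hi, he⟩ := integral_exp_indicator ν hA (-1)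
  have hexp : Real.exp (-1) ≤ 1 / 2 := by
    rw [Real.exp_neg, inv_le_comm₀ (Real.exp_pos _) (by norm_num)]
    have := Real.add_one_le_exp (1 : ℝ); linarith
  have hb : ∫ a, Real.exp (A.indicator (fun _ => -1) a) ∂ν ≤ Real.exp (-(ν.real A / 2)) := by
    rw [he]
    have := Real.add_one_le_exp (-(ν.real A / 2))
    have h2 : 0 ≤ ν.real A := measureReal_nonneg
    nlinarith
  have h := measure_sum_ge_le ν p hi hb (-(p * ν.real A / 4))
  refine (measure_mono ?_).trans (h.trans (ENNReal.ofReal_le_ofReal ?_))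
  · intro y hy
    simp only [Set.mem_ofPred_eq] at hy ⊢
    rw [sum_indicator_eq_card]; linarith
  · rw [Real.exp_le_exp]; linarith

lemma measure_le_card (p : ℕ) {A : Set α} (hA : MeasurableSet A) (t : ℝ) :
    Measure.pi (fun _ : Fin p => ν)
      {y | t ≤ ((Finset.univ.filter fun j => y j ∈ A).card : ℝ)} ≤
      ENNReal.ofReal (Real.exp (2 * (p * ν.real A) - t)) := by
  obtain ⟨hi, he⟩ := integral_exp_indicator ν hA 1
  have hb : ∫ a, Real.exp (A.indicator (fun _ => 1) a) ∂ν ≤ Real.exp (2 * ν.real A) := by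
    rw [he]
    have := Real.add_one_le_exp (2 * ν.real A)
    have h2 : 0 ≤ ν.real A := measureReal_nonneg
    have h3 := Real.exp_one_lt_d9
    nlinarith
  have h := measure_sum_ge_le ν p hi hb t
  refine (measure_mono ?_).trans (h.trans (ENNReal.ofReal_le_ofReal ?_))
  · intro y hy
    simp only [Set.mem_ofPred_eq] at hy ⊢
    rw [sum_indicator_eq_card]; linarith
  · rw [Real.exp_le_exp]; linarith

end counting

end

section

variable {n : ℕ} {ε τ : ℝ} {χ : ℝ → ℝ}

lemma twentyFive_pow_le (n : ℕ) : (25 : ℝ) ^ n ≤ Real.exp (4 * n) := by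
  have h : (25 : ℝ) ≤ Real.exp 4 := by
    have h1 : Real.exp 4 = Real.exp 1 ^ 4 := by rw [← Real.exp_nat_mul]; norm_num
    rw [h1]
    have h2 := Real.exp_one_gt_d9
    have : (2.7 : ℝ) ^ 4 ≤ Real.exp 1 ^ 4 := pow_le_pow_left₀ (by norm_num) (by linarith) 4
    linarith [show (25 : ℝ) ≤ 2.7 ^ 4 by norm_num]
  rw [mul_comm, Real.exp_nat_mul]
  exact pow_le_pow_left₀ (by norm_num) h n

lemma measure_biUnion_finset_le_const {α β : Type*} [MeasurableSpace α] (μ : Measure α)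
    (N : Finset β) (A : β → Set α) {c K : ℝ} (hN : (N.card : ℝ) ≤ K) (hc : 0 ≤ c)
    (h : ∀ v ∈ N, μ (A v) ≤ ENNReal.ofReal c) :
    μ {a | ∃ v ∈ N, a ∈ A v} ≤ ENNReal.ofReal (K * c) := by
  have h1 : {a | ∃ v ∈ N, a ∈ A v} = ⋃ v ∈ N, A v := by ext; simp
  rw [h1]
  refine (measure_biUnion_finset_le N A).trans ((Finset.sum_le_sum h).trans ?_)
  rw [Finset.sum_const, nsmul_eq_mul, ← ENNReal.ofReal_natCast,
    ← ENNReal.ofReal_mul (by positivity)]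
  exact ENNReal.ofReal_le_ofReal (mul_le_mul_of_nonneg_right hN hc)

/-- Indicator of a null column inside the truncation window. -/
noncomputable def nullSel (χ : ℝ → ℝ) (y : ℝ × Euc n) : ℝ := if y.1 = 0 then χ ‖y.2‖ else 0

lemma IsTrunc.measurable_nullSel (hχ : IsTrunc n χ) : Measurable (nullSel (n := n) χ) := by
  unfold nullSel
  refine Measurable.ite (measurable_fst (measurableSet_singleton 0)) ?_ measurable_const
  exact hχ.meas.comp (measurable_norm.comp measurable_snd)

/-- Moment generating function of a truncated null statistic. -/
lemma IsTrunc.exp_nullSel (hχ : IsTrunc n χ) (h0 : 0 ≤ ε) (h1 : ε ≤ 1) (hτ : τ ≠ 0)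
    {Y : Euc n → ℝ} (hY : Continuous Y) {b : ℝ} (hb0 : 0 ≤ b)
    (hb : ∫ z, Real.exp (χ ‖z‖ * Y z) ∂(stdG n) ≤ Real.exp b) :
    Integrable (fun y : ℝ × Euc n => Real.exp (nullSel χ y * Y y.2)) (colLaw n ε τ) ∧
    ∫ y, Real.exp (nullSel χ y * Y y.2) ∂(colLaw n ε τ) ≤ Real.exp b := by
  have hm : StronglyMeasurable (fun y : ℝ × Euc n => Real.exp (nullSel χ y * Y y.2)) :=
    (Real.measurable_exp.comp (hχ.measurable_nullSel.mul
      (hY.measurable.comp measurable_snd))).stronglyMeasurable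
  have i0 : Integrable (fun z : Euc n => Real.exp (nullSel χ ((0 : ℝ), z) * Y z)) (stdG n) := by
    have : ∀ z : Euc n, Real.exp (nullSel χ ((0 : ℝ), z) * Y z) =
        1 + χ ‖z‖ * (Real.exp (Y z) - 1) := by
      intro z
      rcases hχ.zero_or_one ‖z‖ with h | h <;> simp [nullSel, h]
    simp_rw [this]
    exact (integrable_const _).add (hχ.integrable_mul (by fun_prop))
  have e1 : ∀ z : Euc n, Real.exp (nullSel χ (τ, z) * Y z) = 1 := by
    intro z; simp [nullSel, hτ]
  have i1 : Integrable (fun z : Euc n => Real.exp (nullSel χ (τ, z) * Y z)) (stdG n) := by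
    simp_rw [e1]; exact integrable_const _
  refine ⟨integrable_colLaw hm i0 i1, ?_⟩
  rw [integral_colLaw h0 h1 hm i0 i1]
  simp_rw [e1]
  simp only [nullSel, if_true, integral_const, probReal_univ, smul_eq_mul, mul_one]
  have : (1 : ℝ) ≤ Real.exp b := Real.one_le_exp hb0
  nlinarith

lemma IsTrunc.measure_sum_nullSel_ge_le (hχ : IsTrunc n χ) (p : ℕ) (h0 : 0 ≤ ε) (h1 : ε ≤ 1)
    (hτ : τ ≠ 0) {Y : Euc n → ℝ} (hY : Continuous Y) {b : ℝ} (hb0 : 0 ≤ b)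
    (hb : ∫ z, Real.exp (χ ‖z‖ * Y z) ∂(stdG n) ≤ Real.exp b) (s : ℝ) :
    Measure.pi (fun _ : Fin p => colLaw n ε τ) {y | s ≤ ∑ j, nullSel χ (y j) * Y (y j).2} ≤
      ENNReal.ofReal (Real.exp (p * b - s)) := by
  have := isProbabilityMeasure_colLaw (n := n) (τ := τ) h0 h1
  obtain ⟨hi, hle⟩ := hχ.exp_nullSel h0 h1 hτ hY hb0 hb
  exact measure_sum_ge_le (colLaw n ε τ) p hi hle s

/-- Concentration of the null part of the post-selection Gram matrix over a finite set of
directions. -/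
lemma IsTrunc.measure_exists_abs_sum_ge_le (hχ : IsTrunc n χ) (hn : 4 ≤ n) (p : ℕ) (h0 : 0 ≤ ε)
    (h1 : ε ≤ 1) (hτ : τ ≠ 0) {N : Finset (Euc n)} (hN : N.card ≤ 25 ^ n)
    (hN1 : ∀ v ∈ N, ‖v‖ = 1) {m : ℝ} (hm : p * ∫ z : Euc n, χ ‖z‖ ∂(stdG n) ≤ m) :
    Measure.pi (fun _ : Fin p => colLaw n ε τ)
      {y | ∃ v ∈ N, 1600 * √(n * (m + n)) ≤
        |∑ j, nullSel χ (y j) * (inner ℝ (y j).2 v ^ 2 - ‖(y j).2‖ ^ 2 / n)|} ≤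
      ENNReal.ofReal (Real.exp (-n)) := by
  have hn0 : (4 : ℝ) ≤ n := by exact_mod_cast hn
  set π := ∫ z : Euc n, χ ‖z‖ ∂(stdG n) with hπ
  have hπ0 : 0 ≤ π := hχ.mass_nonneg
  have hm0 : 0 ≤ m := le_trans (by positivity) hm
  set l := √(n / (m + n)) / 64 with hl
  have hl0 : 0 ≤ l := by positivity
  have hl1 : l ≤ 1 / 64 := by
    have : √(n / (m + n)) ≤ 1 := by
      rw [Real.sqrt_le_one, div_le_one (by linarith)]; linarith
    rw [hl]; linarith
  have hl2 : l ^ 2 * m ≤ n / 4096 := by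
    rw [hl, div_pow, Real.sq_sqrt (by positivity)]
    have : n / (m + n) * m ≤ n := by
      rw [div_mul_eq_mul_div, div_le_iff₀ (by linarith)]; nlinarith
    linarith
  have hls : l * (1600 * √(n * (m + n))) = 25 * n := by
    have : √(n / (m + n)) * √(n * (m + n)) = n := by
      rw [← Real.sqrt_mul (by positivity)]
      have : (n : ℝ) / (m + n) * (n * (m + n)) = n ^ 2 := by field_simp
      rw [this, Real.sqrt_sq (by linarith)]
    rw [hl]; linear_combination 25 * this
  have key : ∀ v ∈ N, Measure.pi (fun _ : Fin p => colLaw n ε τ)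
      {y | 1600 * √(n * (m + n)) ≤
        |∑ j, nullSel χ (y j) * (inner ℝ (y j).2 v ^ 2 - ‖(y j).2‖ ^ 2 / n)|} ≤
      ENNReal.ofReal (2 * Real.exp (-(12 * n))) := by
    intro v hv
    have hs : ∀ s : ℝ, |s| = l → Measure.pi (fun _ : Fin p => colLaw n ε τ)
        {y | 25 * n ≤ ∑ j, nullSel χ (y j) *
          (s * (inner ℝ (y j).2 v ^ 2 - ‖(y j).2‖ ^ 2 / n))} ≤
        ENNReal.ofReal (Real.exp (-(12 * n))) := by
      intro s hs
      have hb := hχ.integral_exp_centered_le hn (hN1 v hv) (s := s) (hs.trans_le hl1)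
      simp_rw [mul_left_comm s] at hb
      refine (hχ.measure_sum_nullSel_ge_le p h0 h1 hτ
        (Y := fun z => s * (inner ℝ z v ^ 2 - ‖z‖ ^ 2 / n)) (by fun_prop)
        (by positivity) hb (25 * n)).trans (ENNReal.ofReal_le_ofReal ?_)
      rw [Real.exp_le_exp, ← sq_abs s, hs]
      have : l ^ 2 * (p * π) ≤ l ^ 2 * m := mul_le_mul_of_nonneg_left hm (sq_nonneg l)
      nlinarith
    have hsub : {y : Fin p → ℝ × Euc n | 1600 * √(n * (m + n)) ≤
        |∑ j, nullSel χ (y j) * (inner ℝ (y j).2 v ^ 2 - ‖(y j).2‖ ^ 2 / n)|} ⊆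
        {y | 25 * n ≤ ∑ j, nullSel χ (y j) *
          (l * (inner ℝ (y j).2 v ^ 2 - ‖(y j).2‖ ^ 2 / n))} ∪
        {y | 25 * n ≤ ∑ j, nullSel χ (y j) *
          (-l * (inner ℝ (y j).2 v ^ 2 - ‖(y j).2‖ ^ 2 / n))} := by
      intro y hy
      simp only [Set.mem_ofPred_eq, Set.mem_union] at hy ⊢
      simp_rw [mul_left_comm (nullSel χ _)]
      rw [← Finset.mul_sum, ← Finset.mul_sum, ← hls]
      rcases le_abs.1 hy with h | h
      · left; exact mul_le_mul_of_nonneg_left h hl0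
      · right; nlinarith [mul_le_mul_of_nonneg_left h hl0]
    refine (measure_mono hsub).trans ((measure_union_le _ _).trans ?_)
    rw [two_mul, ENNReal.ofReal_add (by positivity) (by positivity)]
    exact add_le_add (hs l (abs_of_nonneg hl0)) (hs (-l) (by rw [abs_neg, abs_of_nonneg hl0]))
  refine (measure_biUnion_finset_le_const _ N _ (K := Real.exp (4 * n)) ?_ (by positivity)
    key).trans (ENNReal.ofReal_le_ofReal ?_)
  · refine le_trans ?_ (twentyFive_pow_le n)
    exact_mod_cast hN
  · have h2 : (2 : ℝ) ≤ Real.exp n := by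
      have := Real.add_one_le_exp (n : ℝ); linarith
    calc Real.exp (4 * n) * (2 * Real.exp (-(12 * n)))
        ≤ Real.exp (4 * n) * (Real.exp n * Real.exp (-(12 * n))) := by gcongr
      _ = Real.exp (-(7 * n)) := by rw [← Real.exp_add, ← Real.exp_add]; ring_nf
      _ ≤ Real.exp (-n) := by rw [Real.exp_le_exp]; linarith

/-- The truncated energy of the null columns in one direction is small when few of them
are selected. -/
lemma IsTrunc.measure_sum_sq_ge_le (hχ : IsTrunc n χ) (hn : 4 ≤ n) (p : ℕ) (h0 : 0 ≤ ε)
    (h1 : ε ≤ 1) (hτ : τ ≠ 0) {u : Euc n} (hu : ‖u‖ = 1)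
    (hm : p * ∫ z : Euc n, χ ‖z‖ ∂(stdG n) ≤ n / 1000) :
    Measure.pi (fun _ : Fin p => colLaw n ε τ)
      {y | (n : ℝ) / 4 ≤ ∑ j, nullSel χ (y j) * inner ℝ (y j).2 u ^ 2} ≤
      ENNReal.ofReal (Real.exp (-(n / 300))) := by
  set π := ∫ z : Euc n, χ ‖z‖ ∂(stdG n) with hπ
  have hπ0 : 0 ≤ π := hχ.mass_nonneg
  have hb : ∫ z : Euc n, Real.exp (χ ‖z‖ * (inner ℝ z u ^ 2 / 32)) ∂(stdG n) ≤
      Real.exp (3 * π) := by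
    rw [hχ.integral_comp_eq Real.continuous_exp (by fun_prop) Real.exp_zero]
    have h2 : ∫ z : Euc n, χ ‖z‖ * (Real.exp (inner ℝ z u ^ 2 / 32) - 1) ∂(stdG n) ≤ 3 * π :=
      (hχ.integral_mono (by fun_prop) (by fun_prop) fun z _ => by linarith).trans
        (hχ.integral_exp_inner_sq_le hn hu)
    have := Real.add_one_le_exp (3 * π)
    linarith
  have h := hχ.measure_sum_nullSel_ge_le p h0 h1 hτ (by fun_prop) (by positivity) hb (n / 128)
  refine (measure_mono ?_).trans (h.trans (ENNReal.ofReal_le_ofReal ?_))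
  · intro y hy
    simp only [Set.mem_ofPred_eq, mul_div_assoc', ← Finset.sum_div] at hy ⊢
    linarith
  · rw [Real.exp_le_exp]
    have : (0 : ℝ) ≤ n := by positivity
    nlinarith

/-- Uniform control of large one-dimensional projections. -/
lemma measure_sum_posPart_ge_le {p : ℕ} (hp : 0 < p) (h0 : 0 ≤ ε) (h1 : ε ≤ 1) {v : Euc n}
    (hv : ‖v‖ = 1) (t : ℝ) :
    Measure.pi (fun _ : Fin p => colLaw n ε τ)
      {y | t ≤ ∑ j, max (inner ℝ (y j).2 v ^ 2 - 8 * Real.log p) 0} ≤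
      ENNReal.ofReal (Real.exp (2 - t / 8)) := by
  have := isProbabilityMeasure_colLaw (n := n) (τ := τ) h0 h1
  have hp0 : (0 : ℝ) < p := by exact_mod_cast hp
  set f : Euc n → ℝ := fun z => max (inner ℝ z v ^ 2 - 8 * Real.log p) 0 / 8 with hf
  have hfc : Continuous f := by fun_prop
  have hi8 : Integrable (fun z : Euc n => Real.exp (1 / 8 * inner ℝ z v ^ 2)) (stdG n) :=
    integrable_exp_inner_sq hv (by norm_num)
  have hle : ∀ z, Real.exp (f z) ≤ 1 + (p : ℝ)⁻¹ * Real.exp (1 / 8 * inner ℝ z v ^ 2) := by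
    intro z
    have e : Real.exp ((inner ℝ z v ^ 2 - 8 * Real.log p) / 8) =
        (p : ℝ)⁻¹ * Real.exp (1 / 8 * inner ℝ z v ^ 2) := by
      rw [show (inner ℝ z v ^ 2 - 8 * Real.log p) / 8 =
        -Real.log p + 1 / 8 * inner ℝ z v ^ 2 by ring, Real.exp_add, Real.exp_neg,
        Real.exp_log hp0]
    simp only [hf]
    rcases le_total (inner ℝ z v ^ 2 - 8 * Real.log p) 0 with h | h
    · rw [max_eq_right h, zero_div, Real.exp_zero]
      have : 0 < (p : ℝ)⁻¹ * Real.exp (1 / 8 * inner ℝ z v ^ 2) := by positivity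
      linarith
    · rw [max_eq_left h, e]; linarith
  have hif : Integrable (fun z => Real.exp (f z)) (stdG n) := by
    refine Integrable.mono' (g := fun z => 1 + (p : ℝ)⁻¹ * Real.exp (1 / 8 * inner ℝ z v ^ 2))
      ((integrable_const 1).add (hi8.const_mul _))
      (by fun_prop) (Eventually.of_forall fun z => ?_)
    rw [Real.norm_eq_abs, Real.abs_exp]; exact hle z
  have h_int : ∫ z, Real.exp (f z) ∂(stdG n) ≤ Real.exp (2 / p) := by
    have h2 : ∫ z, Real.exp (f z) ∂(stdG n) ≤
        ∫ z, (1 + (p : ℝ)⁻¹ * Real.exp (1 / 8 * inner ℝ z v ^ 2)) ∂(stdG n) :=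
      integral_mono hif ((integrable_const 1).add (hi8.const_mul _)) hle
    rw [integral_add (integrable_const _) (hi8.const_mul _), integral_const_mul,
      integral_exp_inner_sq hv (by norm_num)] at h2
    have h3 : (√(1 - 2 * (1 / 8 : ℝ)))⁻¹ ≤ 2 := by
      rw [inv_le_comm₀ (by positivity) (by norm_num)]
      apply Real.le_sqrt_of_sq_le; norm_num
    have h4 : (p : ℝ)⁻¹ * (√(1 - 2 * (1 / 8 : ℝ)))⁻¹ ≤ (p : ℝ)⁻¹ * 2 := by gcongr
    have h5 := Real.add_one_le_exp (2 / (p : ℝ))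
    have h6 : (p : ℝ)⁻¹ * 2 = 2 / p := by rw [mul_comm, div_eq_mul_inv]
    simp at h2
    simp at h4
    linarith
  have hm : StronglyMeasurable (fun y : ℝ × Euc n => Real.exp (f y.2)) :=
    (Continuous.measurable (by fun_prop)).stronglyMeasurable
  have hb : ∫ y, Real.exp (f y.2) ∂(colLaw n ε τ) ≤ Real.exp (2 / p) := by
    rw [integral_colLaw h0 h1 hm hif hif]
    simp only [smul_eq_mul]; linarith
  have h := measure_sum_ge_le (colLaw n ε τ) p (integrable_colLaw hm hif hif) hb (t / 8)
  refine (measure_mono ?_).trans (h.trans (ENNReal.ofReal_le_ofReal ?_))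
  · intro y hy
    simp only [Set.mem_ofPred_eq, hf, ← Finset.sum_div] at hy ⊢
    linarith
  · rw [Real.exp_le_exp, mul_div_cancel₀ _ hp0.ne']

lemma measure_exists_sum_posPart_ge_le {p : ℕ} (hp : 0 < p) (hn : 4 ≤ n) (h0 : 0 ≤ ε)
    (h1 : ε ≤ 1) {N : Finset (Euc n)} (hN : N.card ≤ 25 ^ n) (hN1 : ∀ v ∈ N, ‖v‖ = 1) :
    Measure.pi (fun _ : Fin p => colLaw n ε τ)
      {y | ∃ v ∈ N, 60 * (n : ℝ) ≤ ∑ j, max (inner ℝ (y j).2 v ^ 2 - 8 * Real.log p) 0} ≤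
      ENNReal.ofReal (Real.exp (-n)) := by
  have hn0 : (4 : ℝ) ≤ n := by exact_mod_cast hn
  refine (measure_biUnion_finset_le_const _ N _ (K := Real.exp (4 * n)) ?_ (Real.exp_pos _).le
    (fun v hv => measure_sum_posPart_ge_le hp h0 h1 (hN1 v hv) (60 * n))).trans
    (ENNReal.ofReal_le_ofReal ?_)
  · refine le_trans ?_ (twentyFive_pow_le n)
    exact_mod_cast hN
  · rw [← Real.exp_add, Real.exp_le_exp]; linarith

lemma measure_exists_norm_sq_ge_le (n p : ℕ) (h0 : 0 ≤ ε) (h1 : ε ≤ 1) :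
    Measure.pi (fun _ : Fin p => colLaw n ε τ) {y | ∃ j, 2 * (n : ℝ) ≤ ‖(y j).2‖ ^ 2} ≤
      ENNReal.ofReal (p * Real.exp (-(n / 8))) := by
  have := isProbabilityMeasure_colLaw (n := n) (τ := τ) h0 h1
  have h := measure_exists_le (colLaw n ε τ) p {y | 2 * (n : ℝ) ≤ ‖y.2‖ ^ 2}
  have hm : MeasurableSet {y : ℝ × Euc n | 2 * (n : ℝ) ≤ ‖y.2‖ ^ 2} :=
    measurableSet_le measurable_const (by fun_prop)
  refine h.trans ?_
  rw [← ENNReal.ofReal_natCast, ← ofReal_measureReal, ← ENNReal.ofReal_mul (by positivity)]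
  refine ENNReal.ofReal_le_ofReal (mul_le_mul_of_nonneg_left ?_ (by positivity))
  rw [measureReal_colLaw h0 h1 hm]
  have h2 : (stdG n).real {z | 2 * (n : ℝ) ≤ ‖z‖ ^ 2} ≤ Real.exp (-(n / 8)) := by
    refine (measureReal_norm_sq_ge n (s := 1 / 4) (by norm_num) (by norm_num) (2 * n)).trans ?_
    have e : (√(1 - 2 * (1 / 4 : ℝ)))⁻¹ ≤ Real.exp (3 / 8) := by
      rw [inv_le_comm₀ (by positivity) (by positivity), ← Real.exp_neg]
      apply Real.le_sqrt_of_sq_le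
      rw [← Real.exp_nat_mul]
      have h3 : Real.exp (-Real.log 2) = 1 - 2 * (1 / 4 : ℝ) := by
        rw [Real.exp_neg, Real.exp_log (by norm_num)]; norm_num
      rw [← h3, Real.exp_le_exp]
      push_cast
      linarith [Real.log_two_lt_d9]
    calc Real.exp (-(1 / 4 * (2 * n))) * ((√(1 - 2 * (1 / 4 : ℝ)))⁻¹) ^ n
        ≤ Real.exp (-(1 / 4 * (2 * n))) * Real.exp (3 / 8) ^ n := by gcongr
      _ = Real.exp (-(n / 8)) := by
        rw [← Real.exp_nat_mul, ← Real.exp_add]; ring_nf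
  simp only [Set.mem_ofPred_eq]
  nlinarith

end

section

variable {n : ℕ} {ε τ : ℝ} {χ : ℝ → ℝ}

/-- Probability that a standard Gaussian vector is far from a typical one, with respect to its
norm or to a fixed direction. -/
lemma measureReal_atypical_le {u : Euc n} (hu : ‖u‖ = 1) :
    (stdG n).real {G | ‖G‖ ^ 2 ≤ n / 2 ∨ (n : ℝ) / 4 ≤ inner ℝ G u ^ 2 ∨ 2 * (n : ℝ) ≤ ‖G‖ ^ 2} ≤
      4 * Real.exp (-(n / 16)) := by
  have h1 : (stdG n).real {G | ‖G‖ ^ 2 ≤ n / 2} ≤ Real.exp (-(n / 16)) := by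
    refine (measureReal_norm_sq_le n (s := 1 / 2) (by norm_num) (n / 2)).trans ?_
    have e : (√(1 + 2 * (1 / 2 : ℝ)))⁻¹ ≤ Real.exp (-(5 / 16)) := by
      rw [Real.exp_neg]
      refine inv_anti₀ (Real.exp_pos _) (Real.le_sqrt_of_sq_le ?_)
      rw [← Real.exp_nat_mul]
      have h3 : Real.exp (Real.log 2) = 1 + 2 * (1 / 2 : ℝ) := by
        rw [Real.exp_log (by norm_num)]; norm_num
      rw [← h3, Real.exp_le_exp]
      push_cast
      linarith [Real.log_two_gt_d9]
    calc Real.exp (1 / 2 * (n / 2)) * ((√(1 + 2 * (1 / 2 : ℝ)))⁻¹) ^ n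
        ≤ Real.exp (1 / 2 * (n / 2)) * Real.exp (-(5 / 16)) ^ n := by gcongr
      _ = Real.exp (-(n / 16)) := by rw [← Real.exp_nat_mul, ← Real.exp_add]; ring_nf
  have h2 : (stdG n).real {G | 2 * (n : ℝ) ≤ ‖G‖ ^ 2} ≤ Real.exp (-(n / 16)) := by
    refine (measureReal_norm_sq_ge n (s := 1 / 4) (by norm_num) (by norm_num) (2 * n)).trans ?_
    have e : (√(1 - 2 * (1 / 4 : ℝ)))⁻¹ ≤ Real.exp (7 / 16) := by
      rw [inv_le_comm₀ (by positivity) (by positivity), ← Real.exp_neg]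
      apply Real.le_sqrt_of_sq_le
      rw [← Real.exp_nat_mul]
      have h3 : Real.exp (-Real.log 2) = 1 - 2 * (1 / 4 : ℝ) := by
        rw [Real.exp_neg, Real.exp_log (by norm_num)]; norm_num
      rw [← h3, Real.exp_le_exp]
      push_cast
      linarith [Real.log_two_lt_d9]
    calc Real.exp (-(1 / 4 * (2 * n))) * ((√(1 - 2 * (1 / 4 : ℝ)))⁻¹) ^ n
        ≤ Real.exp (-(1 / 4 * (2 * n))) * Real.exp (7 / 16) ^ n := by gcongr
      _ = Real.exp (-(n / 16)) := by
        rw [← Real.exp_nat_mul, ← Real.exp_add]; ring_nf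
  have h3 : (stdG n).real {G | (n : ℝ) / 4 ≤ inner ℝ G u ^ 2} ≤ 2 * Real.exp (-(n / 16)) := by
    have hi := integrable_exp_inner_sq hu (s := 1 / 4) (by norm_num)
    have hm := mul_meas_ge_le_integral_of_nonneg
      (Eventually.of_forall fun z : Euc n => (Real.exp_pos (1 / 4 * inner ℝ z u ^ 2)).le) hi
      (Real.exp (n / 16))
    rw [integral_exp_inner_sq hu (by norm_num)] at hm
    have hs : {G : Euc n | (n : ℝ) / 4 ≤ inner ℝ G u ^ 2} =
        {G | Real.exp (n / 16) ≤ Real.exp (1 / 4 * inner ℝ G u ^ 2)} := by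
      ext G
      simp only [Set.mem_ofPred_eq, Real.exp_le_exp]
      constructor <;> intro h <;> linarith
    have e : (√(1 - 2 * (1 / 4 : ℝ)))⁻¹ ≤ 2 := by
      rw [inv_le_comm₀ (by positivity) (by norm_num)]
      apply Real.le_sqrt_of_sq_le; norm_num
    rw [hs, Real.exp_neg, ← div_eq_mul_inv, le_div_iff₀ (Real.exp_pos _), mul_comm]
    exact hm.trans e
  have hsub : {G : Euc n | ‖G‖ ^ 2 ≤ n / 2 ∨ (n : ℝ) / 4 ≤ inner ℝ G u ^ 2 ∨
      2 * (n : ℝ) ≤ ‖G‖ ^ 2} = {G | ‖G‖ ^ 2 ≤ n / 2} ∪ ({G | (n : ℝ) / 4 ≤ inner ℝ G u ^ 2} ∪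
        {G | 2 * (n : ℝ) ≤ ‖G‖ ^ 2}) := rfl
  rw [hsub]
  have h4 := measureReal_union_le (μ := stdG n) {G : Euc n | ‖G‖ ^ 2 ≤ n / 2}
    ({G | (n : ℝ) / 4 ≤ inner ℝ G u ^ 2} ∪ {G | 2 * (n : ℝ) ≤ ‖G‖ ^ 2})
  have h5 := measureReal_union_le (μ := stdG n) {G : Euc n | (n : ℝ) / 4 ≤ inner ℝ G u ^ 2}
    {G | 2 * (n : ℝ) ≤ ‖G‖ ^ 2}
  linarith

/-- Characteristic function bound for one summand. -/
lemma IsTrunc.norm_charFun_le (hχ : IsTrunc n χ) (hn : 4 ≤ n) (h0 : 0 ≤ ε) (h1 : ε ≤ 1 / 2)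
    {u : Euc n} (hu : ‖u‖ = 1) {η : ℝ × Euc n → Euc n} (hη : Measurable η)
    (hη0 : ∀ z, η (0, z) = (χ ‖z‖ * inner ℝ z u) • orthPart u z) (t : Euc n) :
    ‖∫ y, Complex.exp ((inner ℝ t (η y) : ℝ) * Complex.I) ∂(colLaw n ε τ)‖ ≤ 1 ∧
    (‖orthPart u t‖ ^ 2 ≤ 1 / 10 ^ 9 →
      ‖∫ y, Complex.exp ((inner ℝ t (η y) : ℝ) * Complex.I) ∂(colLaw n ε τ)‖ ≤
        Real.exp (-((∫ z : Euc n, χ ‖z‖ ∂(stdG n)) * ‖orthPart u t‖ ^ 2 / 48))) := by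
  have := isProbabilityMeasure_colLaw (n := n) (τ := τ) h0 (h1.trans (by norm_num))
  have hm : StronglyMeasurable
      (fun y => Complex.exp ((inner ℝ t (η y) : ℝ) * Complex.I)) := by
    apply Measurable.stronglyMeasurable
    fun_prop
  have hb : ∀ {β : Type} [MeasurableSpace β] (ν : Measure β) [IsProbabilityMeasure ν] (g : β → ℝ),
      ‖∫ y, Complex.exp ((g y : ℝ) * Complex.I) ∂ν‖ ≤ 1 := by
    intro β _ ν _ g
    refine (norm_integral_le_integral_norm _).trans ?_
    simp [Complex.norm_exp_ofReal_mul_I]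
  refine ⟨hb _ _, fun ht => ?_⟩
  have hi : ∀ c : ℝ, Integrable
      (fun z => Complex.exp ((inner ℝ t (η (c, z)) : ℝ) * Complex.I)) (stdG n) := by
    intro c
    refine Integrable.of_bound (C := 1) (Measurable.aestronglyMeasurable (by fun_prop))
      (Eventually.of_forall fun z => ?_)
    rw [Complex.norm_exp_ofReal_mul_I]
  rw [integral_colLaw h0 (h1.trans (by norm_num)) hm (hi 0) (hi τ)]
  set π := ∫ z : Euc n, χ ‖z‖ ∂(stdG n) with hπ
  have hπ0 : 0 ≤ π := hχ.mass_nonneg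
  have hπ1 : π ≤ 1 := hχ.mass_le_one
  have e0 : ∀ z, inner ℝ t (η (0, z)) = χ ‖z‖ * (inner ℝ z u * inner ℝ z (orthPart u t)) := by
    intro z
    rw [hη0, real_inner_smul_right, ← inner_orthPart_comm, real_inner_comm z (orthPart u t)]; ring
  have hφ := hχ.norm_integral_cexp_le hn hu (inner_orthPart hu t) ht
  simp_rw [e0]
  rw [← hπ] at hφ
  set w := ‖orthPart u t‖ ^ 2 with hw
  have hw0 : 0 ≤ w := by positivity
  set x := π * w / 12 with hx
  have hx0 : 0 ≤ x := by positivity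
  have hx1 : x ≤ 1 := by
    have : π * w ≤ 1 * w := mul_le_mul_of_nonneg_right hπ1 hw0
    have : w ≤ 1 := ht.trans (by norm_num)
    rw [hx]; linarith
  have hex : Real.exp (-x) ≤ 1 - x / 2 := by
    have h2 := Real.add_one_le_exp x
    have h3 : Real.exp (-x) * Real.exp x = 1 := by rw [← Real.exp_add]; simp
    have h4 : (1 - x / 2) * (x + 1) ≥ 1 := by nlinarith
    have h5 : Real.exp (-x) * (x + 1) ≤ 1 :=
      (mul_le_mul_of_nonneg_left h2 (Real.exp_pos _).le).trans h3.le
    nlinarith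
  have h6 := Real.add_one_le_exp (-(x / 4))
  calc _ ≤ ‖(1 - ε) • ∫ z : Euc n, Complex.exp
          ((χ ‖z‖ * (inner ℝ z u * inner ℝ z (orthPart u t)) : ℝ) * Complex.I) ∂(stdG n)‖ +
        ‖ε • ∫ z, Complex.exp ((inner ℝ t (η (τ, z)) : ℝ) * Complex.I) ∂(stdG n)‖ :=
        norm_add_le _ _
    _ ≤ (1 - ε) * Real.exp (-x) + ε * 1 := by
        rw [norm_smul, norm_smul, Real.norm_eq_abs, Real.norm_eq_abs, abs_of_nonneg h0,
          abs_of_nonneg (by linarith)]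
        exact add_le_add (mul_le_mul_of_nonneg_left hφ (by linarith))
          (mul_le_mul_of_nonneg_left (hb _ _) h0)
    _ ≤ Real.exp (-(x / 4)) := by nlinarith
    _ = _ := by rw [hx]; ring_nf

/-- Small-ball estimate for the sum of cross terms of the selected columns. -/
lemma IsTrunc.measure_norm_sum_sq_le (hχ : IsTrunc n χ) (hn : 4 ≤ n) (p : ℕ) (h0 : 0 ≤ ε)
    (h1 : ε ≤ 1 / 2) {u : Euc n} (hu : ‖u‖ = 1) {η : ℝ × Euc n → Euc n} (hη : Measurable η)
    (hη0 : ∀ z, η (0, z) = (χ ‖z‖ * inner ℝ z u) • orthPart u z)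
    (hm0 : (n : ℝ) / 1000 ≤ p * ∫ z : Euc n, χ ‖z‖ ∂(stdG n)) :
    Measure.pi (fun _ : Fin p => colLaw n ε τ)
      {y | ‖∑ j, η (y j)‖ ^ 2 ≤ n * (p * ∫ z : Euc n, χ ‖z‖ ∂(stdG n)) / 200} ≤
      ENNReal.ofReal (5 * Real.exp (-(n / 10 ^ 16))) := by
  have := isProbabilityMeasure_colLaw (n := n) (τ := τ) h0 (h1.trans (by norm_num))
  have hn0 : (4 : ℝ) ≤ n := by exact_mod_cast hn
  set π := ∫ z : Euc n, χ ‖z‖ ∂(stdG n) with hπ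
  set m := p * π with hm
  have hmpos : 0 < m := by linarith
  set P := Measure.pi (fun _ : Fin p => colLaw n ε τ) with hP
  set s := √(5 / 10 ^ 13 / m) with hs
  have hs0 : 0 ≤ s := Real.sqrt_nonneg _
  have hs2 : s ^ 2 * m = 5 / 10 ^ 13 := by
    rw [hs, Real.sq_sqrt (by positivity)]; field_simp
  set h : (Fin p → ℝ × Euc n) → Euc n := fun y => ∑ j, η (y j) with hh
  have hhm : Measurable h := by
    simp only [hh]; fun_prop
  have hchar : ∀ y, (Real.exp (-(s ^ 2 * ‖h y‖ ^ 2 / 2)) : ℂ) =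
      ∫ G : Euc n, Complex.exp ((inner ℝ (s • G) (h y) : ℝ) * Complex.I) ∂(stdG n) := by
    intro y
    have := charFun_stdGaussian (E := Euc n) (s • h y)
    rw [charFun_apply] at this
    simp_rw [real_inner_smul_left, ← real_inner_smul_right]
    rw [this, norm_smul, Real.norm_eq_abs, abs_of_nonneg hs0]
    push_cast
    congr 1; ring
  have hintP : Integrable (fun y => Real.exp (-(s ^ 2 * ‖h y‖ ^ 2 / 2))) P := by
    refine Integrable.of_bound (C := 1) (Measurable.aestronglyMeasurable (by fun_prop))
      (Eventually.of_forall fun y => ?_)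
    rw [Real.norm_eq_abs, Real.abs_exp, Real.exp_le_one_iff]
    have : 0 ≤ s ^ 2 * ‖h y‖ ^ 2 / 2 := by positivity
    linarith
  have hswap : ((∫ y, Real.exp (-(s ^ 2 * ‖h y‖ ^ 2 / 2)) ∂P : ℝ) : ℂ) =
      ∫ G : Euc n, (∫ y, Complex.exp ((inner ℝ (s • G) (η y) : ℝ) * Complex.I)
        ∂(colLaw n ε τ)) ^ p ∂(stdG n) := by
    rw [← integral_complex_ofReal]
    simp_rw [hchar]
    rw [integral_integral_swap]
    · congr 1; ext G
      have hprod : ∀ y : Fin p → ℝ × Euc n,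
          Complex.exp ((inner ℝ (s • G) (h y) : ℝ) * Complex.I) =
          ∏ j, Complex.exp ((inner ℝ (s • G) (η (y j)) : ℝ) * Complex.I) := by
        intro y
        rw [← Complex.exp_sum, ← Finset.sum_mul, hh, inner_sum]
        push_cast; rfl
      simp_rw [hprod]
      rw [hP, integral_fintype_prod_eq_pow
        (fun y => Complex.exp ((inner ℝ (s • G) (η y) : ℝ) * Complex.I))]
      simp
    · refine Integrable.of_bound (C := 1) (Measurable.aestronglyMeasurable ?_)
        (Eventually.of_forall fun w => ?_)
      · simp only [Function.uncurry_def]; fun_prop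
      · simp only [Function.uncurry_def]; rw [Complex.norm_exp_ofReal_mul_I]
  set bad : Set (Euc n) :=
    {G | ‖G‖ ^ 2 ≤ n / 2 ∨ (n : ℝ) / 4 ≤ inner ℝ G u ^ 2 ∨ 2 * (n : ℝ) ≤ ‖G‖ ^ 2} with hbad
  have hbadm : MeasurableSet bad := by
    have m1 : Measurable fun G : Euc n => ‖G‖ ^ 2 := by fun_prop
    have m2 : Measurable fun G : Euc n => inner ℝ G u ^ 2 := by fun_prop
    exact (measurableSet_le m1 measurable_const).union
      ((measurableSet_le measurable_const m2).union (measurableSet_le measurable_const m1))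
  set c := Real.exp (-(5 / 10 ^ 13 * n / 192)) with hc
  have hE : ∫ y, Real.exp (-(s ^ 2 * ‖h y‖ ^ 2 / 2)) ∂P ≤ c + 4 * Real.exp (-(n / 16)) := by
    have h2 : ∫ y, Real.exp (-(s ^ 2 * ‖h y‖ ^ 2 / 2)) ∂P ≤
        ‖((∫ y, Real.exp (-(s ^ 2 * ‖h y‖ ^ 2 / 2)) ∂P : ℝ) : ℂ)‖ := by
      rw [Complex.norm_real]; exact Real.le_norm_self _
    refine h2.trans ?_
    rw [hswap]
    refine (norm_integral_le_integral_norm _).trans ?_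
    have hib : Integrable (bad.indicator (fun _ => (1 : ℝ))) (stdG n) :=
      (integrable_const _).indicator hbadm
    have h3 : ∫ G : Euc n, ‖(∫ y, Complex.exp ((inner ℝ (s • G) (η y) : ℝ) * Complex.I)
        ∂(colLaw n ε τ)) ^ p‖ ∂(stdG n) ≤ ∫ G, (c + bad.indicator (fun _ => (1 : ℝ)) G)
          ∂(stdG n) := by
      refine integral_mono_of_nonneg (Eventually.of_forall fun _ => norm_nonneg _)
        ((integrable_const c).add hib) (Eventually.of_forall fun G => ?_)
      obtain ⟨b1, b2⟩ := hχ.norm_charFun_le (τ := τ) hn h0 h1 hu hη hη0 (s • G)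
      simp only
      rw [norm_pow]
      by_cases hG : G ∈ bad
      · have hc0 : 0 < c := Real.exp_pos _
        simp only [hG, Set.indicator_of_mem]
        have := pow_le_one₀ (n := p) (norm_nonneg _) b1
        linarith
      · simp only [hG, not_false_eq_true, Set.indicator_of_notMem, add_zero]
        simp only [hbad, Set.mem_ofPred_eq, not_or, not_le] at hG
        obtain ⟨g1, g2, g3⟩ := hG
        have hnorm := norm_sq_orthPart hu G
        rw [real_inner_comm] at hnorm
        have ho : ‖orthPart u (s • G)‖ ^ 2 = s ^ 2 * ‖orthPart u G‖ ^ 2 := by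
          rw [orthPart_smul, norm_smul, mul_pow, Real.norm_eq_abs, sq_abs]
        have hlt : s ^ 2 * ‖orthPart u G‖ ^ 2 ≤ 1 / 10 ^ 9 := by
          have h4 : ‖orthPart u G‖ ^ 2 ≤ 2000 * m := by nlinarith [sq_nonneg (inner ℝ G u)]
          calc s ^ 2 * ‖orthPart u G‖ ^ 2 ≤ s ^ 2 * (2000 * m) :=
                mul_le_mul_of_nonneg_left h4 (sq_nonneg s)
            _ = 2000 * (s ^ 2 * m) := by ring
            _ ≤ 1 / 10 ^ 9 := by rw [hs2]; norm_num
        have b3 := b2 (by rw [ho]; exact hlt)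
        refine (pow_le_pow_left₀ (norm_nonneg _) b3 p).trans ?_
        rw [← Real.exp_nat_mul, hc, Real.exp_le_exp, ho, ← hπ]
        have h5 : (n : ℝ) / 4 ≤ ‖orthPart u G‖ ^ 2 := by linarith
        have h6 : s ^ 2 * m * (n / 4) ≤ s ^ 2 * m * ‖orthPart u G‖ ^ 2 :=
          mul_le_mul_of_nonneg_left h5 (by positivity)
        rw [hs2] at h6
        have h7 : (p : ℝ) * -(π * (s ^ 2 * ‖orthPart u G‖ ^ 2) / 48) =
            -(s ^ 2 * m * ‖orthPart u G‖ ^ 2 / 48) := by rw [hm]; ring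
        rw [h7, hs2]
        linarith
    refine h3.trans ?_
    rw [integral_add (integrable_const c) hib, integral_indicator hbadm]
    simp only [integral_const, probReal_univ, smul_eq_mul, one_mul, measureReal_restrict_apply,
      MeasurableSet.univ, Set.univ_inter, mul_one]
    exact add_le_add_right (measureReal_atypical_le hu) c
  have hmarkov := mul_meas_ge_le_integral_of_nonneg
    (Eventually.of_forall fun y => (Real.exp_pos (-(s ^ 2 * ‖h y‖ ^ 2 / 2))).le) hintP
    (Real.exp (-(5 / 10 ^ 13 * n / 400)))
  have hset : {y : Fin p → ℝ × Euc n | ‖∑ j, η (y j)‖ ^ 2 ≤ n * m / 200} ⊆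
      {y | Real.exp (-(5 / 10 ^ 13 * n / 400)) ≤ Real.exp (-(s ^ 2 * ‖h y‖ ^ 2 / 2))} := by
    intro y hy
    simp only [Set.mem_ofPred_eq, Real.exp_le_exp] at hy ⊢
    have h8 : s ^ 2 * ‖h y‖ ^ 2 ≤ s ^ 2 * (n * m / 200) :=
      mul_le_mul_of_nonneg_left hy (sq_nonneg s)
    have h9 : s ^ 2 * (n * m / 200) = s ^ 2 * m * n / 200 := by ring
    rw [h9, hs2] at h8
    linarith
  refine (measure_mono hset).trans ?_
  rw [← ofReal_measureReal]
  refine ENNReal.ofReal_le_ofReal ?_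
  have h10 : 4 * Real.exp (-(n / 16)) ≤ 4 * c := by
    refine mul_le_mul_of_nonneg_left (Real.exp_le_exp.2 ?_) (by norm_num)
    linarith
  have h11 : Real.exp (-(5 / 10 ^ 13 * n / 400)) * (5 * Real.exp (-(n / 10 ^ 16))) ≥ 5 * c := by
    have : Real.exp (-(5 / 10 ^ 13 * n / 400)) * (5 * Real.exp (-(n / 10 ^ 16))) =
        5 * Real.exp (-(5 / 10 ^ 13 * n / 400) + -(n / 10 ^ 16)) := by
      rw [Real.exp_add]; ring
    rw [this, hc]; gcongr; linarith
  refine le_of_mul_le_mul_left ?_ (Real.exp_pos (-(5 / 10 ^ 13 * (n : ℝ) / 400)))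
  linarith

end

section

variable {n p : ℕ} {ε τ : ℝ}

/-- Data column built from a signal coordinate and a noise column. -/
noncomputable def colVec (u : Euc n) (y : ℝ × Euc n) : Euc n := (y.1 * √n) • u + y.2

lemma measurable_colVec (u : Euc n) : Measurable (colVec u) := by
  unfold colVec; fun_prop

/-- Indicator of the window `[a, 2n]` for the squared norm. -/
noncomputable def window (n : ℕ) (a ρ : ℝ) : ℝ := if a ≤ ρ ^ 2 ∧ ρ ^ 2 ≤ 2 * n then 1 else 0

lemma isTrunc_window {a : ℝ} (ha : (n : ℝ) ≤ a) : IsTrunc n (window n a) where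
  meas := by
    unfold window
    refine Measurable.ite ?_ measurable_const measurable_const
    have m : Measurable fun ρ : ℝ => ρ ^ 2 := by fun_prop
    exact (measurableSet_le measurable_const m).inter (measurableSet_le m measurable_const)
  zero_or_one ρ := by unfold window; split <;> simp
  lower ρ h := by
    unfold window at h; split at h
    · rename_i h2; exact ha.trans h2.1
    · simp at h
  upper ρ h := by
    unfold window at h; split at h
    · rename_i h2; exact h2.2
    · simp at h

/-- Selected columns. -/
noncomputable def selIdx (u : Euc n) (a : ℝ) (y : Fin p → ℝ × Euc n) : Finset (Fin p) :=
  Finset.univ.filter fun j => a ≤ ‖colVec u (y j)‖ ^ 2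

/-- Values of a column leading to the selection of a useful feature. -/
def usefulSet (u : Euc n) (a : ℝ) : Set (ℝ × Euc n) := {y | y.1 ≠ 0 ∧ a ≤ ‖colVec u y‖ ^ 2}

lemma measurableSet_usefulSet (u : Euc n) (a : ℝ) : MeasurableSet (usefulSet u a) := by
  have h := measurable_colVec u
  have m : Measurable fun y : ℝ × Euc n => ‖colVec u y‖ ^ 2 := by fun_prop
  exact (measurable_fst (measurableSet_singleton 0).compl).inter
    (measurableSet_le measurable_const m)

/-- Selected useful columns. -/
noncomputable def usefulIdx (u : Euc n) (a : ℝ) (y : Fin p → ℝ × Euc n) : Finset (Fin p) :=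
  Finset.univ.filter fun j => y j ∈ usefulSet u a

/-- Selected null columns. -/
noncomputable def nullIdx (u : Euc n) (a : ℝ) (y : Fin p → ℝ × Euc n) : Finset (Fin p) :=
  (selIdx u a y).filter fun j => (y j).1 = 0

lemma mem_selIdx {u : Euc n} {a : ℝ} {y : Fin p → ℝ × Euc n} {j : Fin p} :
    j ∈ selIdx u a y ↔ a ≤ ‖colVec u (y j)‖ ^ 2 := by
  rw [selIdx, Finset.mem_filter]; simp

lemma mem_usefulIdx {u : Euc n} {a : ℝ} {y : Fin p → ℝ × Euc n} {j : Fin p} :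
    j ∈ usefulIdx u a y ↔ (y j).1 ≠ 0 ∧ a ≤ ‖colVec u (y j)‖ ^ 2 := by
  rw [usefulIdx, Finset.mem_filter, usefulSet, Set.mem_ofPred_eq]; simp

lemma mem_nullIdx {u : Euc n} {a : ℝ} {y : Fin p → ℝ × Euc n} {j : Fin p} :
    j ∈ nullIdx u a y ↔ a ≤ ‖colVec u (y j)‖ ^ 2 ∧ (y j).1 = 0 := by
  rw [nullIdx, Finset.mem_filter, mem_selIdx]

lemma selIdx_eq_union (u : Euc n) (a : ℝ) (y : Fin p → ℝ × Euc n) :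
    selIdx u a y = nullIdx u a y ∪ usefulIdx u a y := by
  ext j
  rw [Finset.mem_union, mem_selIdx, mem_nullIdx, mem_usefulIdx]
  tauto

lemma disjoint_nullIdx_usefulIdx (u : Euc n) (a : ℝ) (y : Fin p → ℝ × Euc n) :
    Disjoint (nullIdx u a y) (usefulIdx u a y) := by
  rw [Finset.disjoint_left]
  intro j h1 h2
  exact (mem_usefulIdx.1 h2).1 (mem_nullIdx.1 h1).2

lemma colVec_of_null (u : Euc n) {y : ℝ × Euc n} (h : y.1 = 0) : colVec u y = y.2 := by
  simp [colVec, h]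

lemma nullSel_eq_ite (u : Euc n) {a : ℝ} {y : Fin p → ℝ × Euc n}
    (hz : ∀ j, ‖(y j).2‖ ^ 2 < 2 * n) (j : Fin p) :
    nullSel (window n a) (y j) = if j ∈ nullIdx u a y then 1 else 0 := by
  simp only [nullSel, window, mem_nullIdx]
  by_cases h : (y j).1 = 0
  · simp [h, colVec_of_null u h, (hz j).le]
  · simp [h]

lemma sum_nullSel_mul (u : Euc n) {a : ℝ} {y : Fin p → ℝ × Euc n}
    (hz : ∀ j, ‖(y j).2‖ ^ 2 < 2 * n) (f : Fin p → ℝ) :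
    ∑ j, nullSel (window n a) (y j) * f j = ∑ j ∈ nullIdx u a y, f j := by
  simp_rw [nullSel_eq_ite u hz]
  simp [ite_mul, Finset.sum_ite_mem]

lemma sum_sq_le_of_posPart {v : Euc n} {y : Fin p → ℝ × Euc n} {t L : ℝ}
    (h : ∑ j, max (inner ℝ (y j).2 v ^ 2 - 8 * L) 0 ≤ t) (A : Finset (Fin p)) :
    ∑ j ∈ A, inner ℝ (y j).2 v ^ 2 ≤ t + 8 * L * A.card := by
  have h1 : ∑ j ∈ A, inner ℝ (y j).2 v ^ 2 ≤
      ∑ j ∈ A, (max (inner ℝ (y j).2 v ^ 2 - 8 * L) 0 + 8 * L) :=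
    Finset.sum_le_sum fun j _ => by
      have := le_max_left (inner ℝ (y j).2 v ^ 2 - 8 * L) 0; linarith
  have h2 : ∑ j ∈ A, max (inner ℝ (y j).2 v ^ 2 - 8 * L) 0 ≤
      ∑ j, max (inner ℝ (y j).2 v ^ 2 - 8 * L) 0 :=
    Finset.sum_le_sum_of_subset_of_nonneg (Finset.subset_univ A) fun j _ _ => le_max_right _ _
  rw [Finset.sum_add_distrib, Finset.sum_const, nsmul_eq_mul] at h1
  linarith

/-- Regularity of a configuration of columns: signals lie in `{0, τ}`, noise columns are not too
long, and the post-selection Gram matrix is close to its mean. -/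
structure IsRegular (u : Euc n) (τ a m : ℝ) (y : Fin p → ℝ × Euc n) : Prop where
  fst : ∀ j, (y j).1 = 0 ∨ (y j).1 = τ
  norm_lt : ∀ j, ‖(y j).2‖ ^ 2 < 2 * n
  close : ∃ c, ∀ v, |∑ j ∈ selIdx u a y, inner ℝ (colVec u (y j)) v ^ 2 - c * ‖v‖ ^ 2 -
    ((usefulIdx u a y).card * (τ * √n) ^ 2) * inner ℝ u v ^ 2| ≤
    (6400 * √(n * (m + n)) + 4 * (60 * n + 8 * Real.log p * (usefulIdx u a y).card) +
      2 * (τ * √n) * √((usefulIdx u a y).card *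
        (4 * (60 * n + 8 * Real.log p * (usefulIdx u a y).card)))) * ‖v‖ ^ 2

lemma measure_not_isRegular_le (hn : 4 ≤ n) (hp : 0 < p) (h0 : 0 ≤ ε) (h1 : ε ≤ 1) (hτ : 0 < τ)
    {u : Euc n} (hu : ‖u‖ = 1) {a m : ℝ} (ha : (n : ℝ) ≤ a)
    (hm : p * ∫ z : Euc n, window n a ‖z‖ ∂(stdG n) ≤ m) :
    Measure.pi (fun _ : Fin p => colLaw n ε τ) {y | ¬ IsRegular u τ a m y} ≤
      ENNReal.ofReal (2 * Real.exp (-n) + p * Real.exp (-(n / 8))) := by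
  obtain ⟨N, hN, hN1, hNT⟩ := exists_net n
  have hχ := isTrunc_window ha
  have hL : 0 ≤ Real.log p := Real.log_natCast_nonneg p
  have e1 := hχ.measure_exists_abs_sum_ge_le hn p h0 h1 hτ.ne' hN hN1 hm
  have e2 := measure_exists_sum_posPart_ge_le (τ := τ) hp hn h0 h1 hN hN1
  have e3 := measure_exists_norm_sq_ge_le (τ := τ) n p h0 h1
  have e4 := measure_pi_fst_notMem (n := n) (τ := τ) p h0 h1
  have hsub : {y : Fin p → ℝ × Euc n | ¬ IsRegular u τ a m y} ⊆
      (({y | ∃ v ∈ N, 1600 * √(n * (m + n)) ≤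
        |∑ j, nullSel (window n a) (y j) * (inner ℝ (y j).2 v ^ 2 - ‖(y j).2‖ ^ 2 / n)|} ∪
      {y | ∃ v ∈ N, 60 * (n : ℝ) ≤ ∑ j, max (inner ℝ (y j).2 v ^ 2 - 8 * Real.log p) 0}) ∪
      {y | ∃ j, 2 * (n : ℝ) ≤ ‖(y j).2‖ ^ 2}) ∪ {y | ∃ j, (y j).1 ≠ 0 ∧ (y j).1 ≠ τ} := by
    intro y hy
    by_contra hc
    simp only [Set.mem_union, Set.mem_ofPred_eq, not_or, not_exists, not_and, not_le, not_not]
      at hc hy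
    obtain ⟨⟨⟨c1, c2⟩, c3⟩, c4⟩ := hc
    refine hy ⟨fun j => ?_, c3, ∑ j ∈ nullIdx u a y, ‖(y j).2‖ ^ 2 / n, ?_⟩
    · by_cases h : (y j).1 = 0
      · exact Or.inl h
      · exact Or.inr (c4 j h)
    intro v
    refine abs_quad_sub_le (z := fun j => (y j).2) (by convert selIdx_eq_union u a y)
      (disjoint_nullIdx_usefulIdx u a y)
      hu (by positivity) (by positivity) ?_ ?_ ?_ ?_ v
    · intro j hj
      exact colVec_of_null u (mem_nullIdx.1 hj).2
    · intro j hj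
      have hj2 : (y j).1 ≠ 0 := (mem_usefulIdx.1 hj).1
      simp only [colVec, c4 j hj2]
    · intro w
      have := hNT (gramOp (nullIdx u a y) (fun j => (y j).2)
        (∑ j ∈ nullIdx u a y, ‖(y j).2‖ ^ 2 / n)) (gramOp_isSymmetric _ _ _)
        (1600 * √(n * (m + n))) (by positivity) (fun v hv => ?_) w
      · rw [inner_gramOp_self] at this
        refine this.trans (le_of_eq (by ring))
      · rw [inner_gramOp_self, hN1 v hv]
        have h := (c1 v hv).le
        rw [sum_nullSel_mul u c3, Finset.sum_sub_distrib] at h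
        simpa using h
    · intro w
      have := hNT (gramOp (usefulIdx u a y) (fun j => (y j).2) 0) (gramOp_isSymmetric _ _ _)
        (60 * n + 8 * Real.log p * (usefulIdx u a y).card) (by positivity) (fun v hv => ?_) w
      · rw [inner_gramOp_self] at this
        have h := (le_abs_self _).trans this
        linarith
      · rw [inner_gramOp_self, zero_mul, sub_zero,
          abs_of_nonneg (Finset.sum_nonneg fun _ _ => sq_nonneg _)]
        exact sum_sq_le_of_posPart (c2 v hv).le _
  refine (measure_mono hsub).trans ((measure_union_le _ _).trans ?_)
  rw [e4, add_zero]
  refine (measure_union_le _ _).trans ?_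
  rw [ENNReal.ofReal_add (by positivity) (by positivity), two_mul (Real.exp (-(n : ℝ))),
    ENNReal.ofReal_add (by positivity) (by positivity)]
  exact add_le_add ((measure_union_le _ _).trans (add_le_add e1 e2)) e3

end

section

variable {n p : ℕ} {ε τ : ℝ}

lemma toLp_signal_eq_colVec {ℓ : Fin n → ℝ} {u : Euc n} (hn : 0 < n)
    (hu : u = (√n)⁻¹ • (WithLp.toLp 2 ℓ : Euc n)) (y : ℝ × Euc n) :
    (WithLp.toLp 2 (fun i => ℓ i * y.1 + y.2 i) : Euc n) = colVec u y := by
  have hs : √(n : ℝ) ≠ 0 := (Real.sqrt_pos.2 (by exact_mod_cast hn)).ne'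
  ext i
  simp only [colVec, hu, PiLp.add_apply, PiLp.smul_apply, smul_eq_mul]
  field_simp

lemma chiSel_eq_selIdx {ℓ : Fin n → ℝ} {u : Euc n} (hn : 0 < n)
    (hu : u = (√n)⁻¹ • (WithLp.toLp 2 ℓ : Euc n)) (q : ℝ) (y : Fin p → ℝ × Euc n) :
    chiSel q (fun i j => ℓ i * (y j).1 + (y j).2 i) =
      selIdx u (n + √(2 * n) * √(2 * q * Real.log p)) y := by
  have hs : 0 < √(2 * (n : ℝ)) := Real.sqrt_pos.2 (by positivity)
  ext j
  rw [chiSel, Finset.mem_filter, mem_selIdx, ← toLp_signal_eq_colVec hn hu,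
    EuclideanSpace.norm_sq_eq, le_div_iff₀ hs]
  simp only [Finset.mem_univ, true_and, Real.norm_eq_abs, sq_abs]
  constructor <;> intro h <;> linarith

lemma exists_topEig_of_gramSel {ℓ : Fin n → ℝ} {u : Euc n} (hn : 0 < n)
    (hℓ : ∀ i, ℓ i = 1 ∨ ℓ i = -1) (hu : u = (√n)⁻¹ • (WithLp.toLp 2 ℓ : Euc n)) {q : ℝ}
    {y : Fin p → ℝ × Euc n} {ξ : Fin n → ℝ}
    (h : IsTopEigenvector (gramSel q (fun i j => ℓ i * (y j).1 + (y j).2 i)) ξ) :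
    ∃ lam, TopEig (selIdx u (n + √(2 * n) * √(2 * q * Real.log p)) y)
      (fun j => colVec u (y j)) (WithLp.toLp 2 ξ) lam ∧
      cosv ξ ℓ = |inner ℝ u (WithLp.toLp 2 ξ : Euc n)| := by
  unfold gramSel at h
  obtain ⟨lam, hl⟩ := exists_topEig_of_isTopEigenvector h
  rw [chiSel_eq_selIdx hn hu] at hl
  simp only [toLp_signal_eq_colVec hn hu] at hl
  exact ⟨lam, hl, cosv_eq hn hℓ hl.norm_eq hu⟩

lemma measureReal_usefulSet (h0 : 0 ≤ ε) (h1 : ε ≤ 1) (hτ : τ ≠ 0) (u : Euc n) (a : ℝ) :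
    (colLaw n ε τ).real (usefulSet u a) =
      ε * (stdG n).real {z | a ≤ ‖colVec u (τ, z)‖ ^ 2} := by
  rw [measureReal_colLaw h0 h1 (measurableSet_usefulSet u a)]
  simp [usefulSet, hτ]

lemma TopEig.norm_sq_le {ι : Type*} {S : Finset ι} {x : ι → Euc n} {ξ : Euc n} {lam : ℝ}
    (h : TopEig S x ξ lam) {j : ι} (hj : j ∈ S) (hx : 0 < ‖x j‖ ^ 2) : ‖x j‖ ^ 2 ≤ lam := by
  have h1 := h.le (x j)
  have h2 : inner ℝ (x j) (x j) ^ 2 ≤ ∑ i ∈ S, inner ℝ (x i) (x j) ^ 2 :=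
    Finset.single_le_sum (f := fun i => inner ℝ (x i) (x j) ^ 2) (fun _ _ => sq_nonneg _) hj
  rw [real_inner_self_eq_norm_sq] at h2
  nlinarith

/-- When enough useful columns are selected, the top eigenvector aligns with the signal. -/
lemma measure_topEig_lt_le (hn : 4 ≤ n) (hp : 0 < p) (h0 : 0 ≤ ε) (h1 : ε ≤ 1) (hτ : 0 < τ)
    {u : Euc n} (hu : ‖u‖ = 1) {a m M b R δ : ℝ} (ha : (n : ℝ) ≤ a)
    (hm : p * ∫ z : Euc n, window n a ‖z‖ ∂(stdG n) ≤ m) (hM0 : 0 < M)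
    (hM : M ≤ p * (ε * (stdG n).real {z | a ≤ ‖colVec u (τ, z)‖ ^ 2}))
    (hb : b = τ * √n) (hR : R = (960 * n / M + 32 * Real.log p) / b ^ 2)
    (hδ : 2 * (25600 * √(n * (m + n)) / (M * b ^ 2) + R + 2 * √R) ≤ δ) :
    Measure.pi (fun _ : Fin p => colLaw n ε τ) {y | ∃ ξ lam, TopEig (selIdx u a y)
      (fun j => colVec u (y j)) ξ lam ∧ |inner ℝ u ξ| < 1 - δ} ≤
      ENNReal.ofReal (2 * Real.exp (-n) + p * Real.exp (-(n / 8)) + Real.exp (-(M / 4))) := by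
  have := isProbabilityMeasure_colLaw (n := n) (τ := τ) h0 h1
  have hL : 0 ≤ Real.log p := Real.log_natCast_nonneg p
  have hn0 : (0 : ℝ) < n := by positivity
  have hb0 : 0 < b := by rw [hb]; positivity
  have e1 := measure_not_isRegular_le hn hp h0 h1 hτ hu ha hm
  have e2 := measure_card_le (colLaw n ε τ) p (measurableSet_usefulSet u a)
  rw [measureReal_usefulSet h0 h1 hτ.ne'] at e2
  have hsub : {y : Fin p → ℝ × Euc n | ∃ ξ lam, TopEig (selIdx u a y)
      (fun j => colVec u (y j)) ξ lam ∧ |inner ℝ u ξ| < 1 - δ} ⊆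
      {y | ¬ IsRegular u τ a m y} ∪
      {y | ((Finset.univ.filter fun j => y j ∈ usefulSet u a).card : ℝ) ≤
        p * (ε * (stdG n).real {z | a ≤ ‖colVec u (τ, z)‖ ^ 2}) / 4} := by
    rintro y ⟨ξ, lam, hT, hlt⟩
    by_contra hc
    simp only [Set.mem_union, Set.mem_ofPred_eq, not_or, not_not, not_le] at hc
    obtain ⟨⟨hf, hz, c, hQ⟩, hcard⟩ := hc
    change _ < ((usefulIdx u a y).card : ℝ) at hcard
    rw [← hb] at hQ
    set k : ℝ := ((usefulIdx u a y).card : ℝ)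
    have hk : M / 4 < k := by linarith
    have hk0 : 0 < k := by linarith
    have key := hT.one_sub_le hu (by positivity : 0 < k * b ^ 2) hQ
    have hBR : 4 * (60 * n + 8 * Real.log p * k) ≤ R * (k * b ^ 2) := by
      have : R * (k * b ^ 2) = 960 * n / M * k + 32 * Real.log p * k := by
        rw [hR]; field_simp
      rw [this]
      have : 960 * n / M * (M / 4) ≤ 960 * n / M * k := by gcongr
      have h3 : 960 * n / M * (M / 4) = 240 * n := by field_simp; norm_num
      linarith
    have hR0 : 0 ≤ R := by rw [hR]; positivity
    have h2 : √(k * (4 * (60 * n + 8 * Real.log p * k))) ≤ √R * (k * b) := by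
      rw [← Real.sqrt_sq (by positivity : 0 ≤ k * b), ← Real.sqrt_mul hR0]
      apply Real.sqrt_le_sqrt
      nlinarith
    have h3 : 6400 * √(n * (m + n)) ≤ 25600 * √(n * (m + n)) / (M * b ^ 2) * (k * b ^ 2) := by
      have e : 25600 * √(n * (m + n)) / (M * b ^ 2) * (k * b ^ 2) =
        6400 * √(n * (m + n)) * (k / (M / 4)) := by field_simp; ring
      rw [e]
      have : 1 ≤ k / (M / 4) := (one_le_div (by positivity)).2 hk.le
      exact le_mul_of_one_le_right (by positivity) this
    have h4 : 2 * (6400 * √(n * (m + n)) + 4 * (60 * n + 8 * Real.log p * k) +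
        2 * b * √(k * (4 * (60 * n + 8 * Real.log p * k)))) / (k * b ^ 2) ≤ δ := by
      rw [div_le_iff₀ (by positivity)]
      have h5 : 2 * b * √(k * (4 * (60 * n + 8 * Real.log p * k))) ≤ 2 * √R * (k * b ^ 2) := by
        calc _ ≤ 2 * b * (√R * (k * b)) := by gcongr
          _ = _ := by ring
      have h6 := mul_le_mul_of_nonneg_right hδ (by positivity : 0 ≤ k * b ^ 2)
      nlinarith
    linarith
  refine (measure_mono hsub).trans ((measure_union_le _ _).trans ?_)
  rw [ENNReal.ofReal_add (by positivity) (by positivity)]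
  refine add_le_add e1 (e2.trans (ENNReal.ofReal_le_ofReal (Real.exp_le_exp.2 ?_)))
  linarith

set_option maxHeartbeats 1000000 in
/-- Many selected null columns: the top eigenvector stays away from the signal. -/
lemma measure_topEig_gt_le_of_fat (hn : 4 ≤ n) (hp : 0 < p) (h0 : 0 ≤ ε) (h1 : ε ≤ 1 / 2)
    (hτ : 0 < τ) {u : Euc n} (hu : ‖u‖ = 1) {a m M b T c0 : ℝ} (ha : (n : ℝ) ≤ a)
    (hm : p * ∫ z : Euc n, window n a ‖z‖ ∂(stdG n) = m) (hm0 : (n : ℝ) / 1000 ≤ m)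
    (hM : p * (ε * (stdG n).real {z | a ≤ ‖colVec u (τ, z)‖ ^ 2}) ≤ M)
    (hb : b = τ * √n) (hT1 : Real.log p * T ≤ √(n * m)) (hT2 : T * b ^ 2 ≤ √(n * m))
    (hc0 : 0 ≤ c0) (hc : 800 * 220300 ^ 2 / (1 + 800 * 220300 ^ 2) ≤ c0 ^ 2) :
    Measure.pi (fun _ : Fin p => colLaw n ε τ) {y | ∃ ξ lam, TopEig (selIdx u a y)
      (fun j => colVec u (y j)) ξ lam ∧ c0 < |inner ℝ u ξ|} ≤
      ENNReal.ofReal (2 * Real.exp (-n) + p * Real.exp (-(n / 8)) +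
        5 * Real.exp (-(n / 10 ^ 16)) + Real.exp (2 * M - T)) := by
  have h1' : ε ≤ 1 := by linarith
  have := isProbabilityMeasure_colLaw (n := n) (τ := τ) h0 h1'
  have hL : 0 ≤ Real.log p := Real.log_natCast_nonneg p
  have hn0 : (0 : ℝ) < n := by positivity
  have hb0 : 0 < b := by rw [hb]; positivity
  set η : ℝ × Euc n → Euc n := fun y =>
    ((if y.1 = 0 then window n a ‖y.2‖ else (usefulSet u a).indicator (fun _ => 1) y) *
      inner ℝ (colVec u y) u) • orthPart u (colVec u y) with hη_def
  have hη : Measurable η := by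
    have m0 := measurable_colVec u
    have m1 : Measurable fun y : ℝ × Euc n => window n a ‖y.2‖ :=
      (isTrunc_window ha).meas.comp measurable_snd.norm
    have m2 : Measurable ((usefulSet u a).indicator (fun _ : ℝ × Euc n => (1 : ℝ))) :=
      measurable_const.indicator (measurableSet_usefulSet u a)
    have m3 : Measurable fun y : ℝ × Euc n =>
        (if y.1 = 0 then window n a ‖y.2‖ else (usefulSet u a).indicator (fun _ => 1) y) :=
      Measurable.ite (measurable_fst (measurableSet_singleton 0)) m1 m2
    have m4 : Measurable fun y : ℝ × Euc n => inner ℝ (colVec u y) u := by fun_prop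
    have m5 : Measurable fun y : ℝ × Euc n => orthPart u (colVec u y) := by
      unfold orthPart; fun_prop
    exact (m3.mul m4).smul m5
  have hη0 : ∀ z, η (0, z) = (window n a ‖z‖ * inner ℝ z u) • orthPart u z := by
    intro z; simp [hη_def, colVec]
  have e1 := measure_not_isRegular_le hn hp h0 h1' hτ hu ha hm.le
  have e2 := measure_le_card (colLaw n ε τ) p (measurableSet_usefulSet u a) T
  rw [measureReal_usefulSet h0 h1' hτ.ne'] at e2
  have e3 := (isTrunc_window ha).measure_norm_sum_sq_le hn p h0 h1 (τ := τ) hu hη hη0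
    (hm0.trans_eq hm.symm)
  rw [hm] at e3
  have hsub : {y : Fin p → ℝ × Euc n | ∃ ξ lam, TopEig (selIdx u a y)
      (fun j => colVec u (y j)) ξ lam ∧ c0 < |inner ℝ u ξ|} ⊆
      ({y | ¬ IsRegular u τ a m y} ∪ {y | ‖∑ j, η (y j)‖ ^ 2 ≤ n * m / 200}) ∪
      {y | T ≤ ((Finset.univ.filter fun j => y j ∈ usefulSet u a).card : ℝ)} := by
    rintro y ⟨ξ, lam, hTop, hlt⟩
    by_contra hc'
    simp only [Set.mem_union, Set.mem_ofPred_eq, not_or, not_not, not_le] at hc'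
    obtain ⟨⟨⟨hf, hz, c, hQ⟩, hH⟩, hcard⟩ := hc'
    change ((usefulIdx u a y).card : ℝ) < _ at hcard
    rw [← hb] at hQ
    set k : ℝ := ((usefulIdx u a y).card : ℝ)
    have hk0 : 0 ≤ k := Nat.cast_nonneg _
    set G : ℝ := √(n * m)
    have hm00 : 0 < m := by linarith [show (0 : ℝ) < n / 1000 by positivity]
    have hG0 : 0 < G := Real.sqrt_pos.2 (by positivity)
    have hG2 : G ^ 2 = n * m := Real.sq_sqrt (by positivity)
    have hnG : (n : ℝ) ≤ 32 * G := by nlinarith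
    have hsq : √(n * (m + n)) ≤ 32 * G := by
      rw [← Real.sqrt_sq (by positivity : 0 ≤ 32 * G)]
      apply Real.sqrt_le_sqrt; nlinarith
    have hkb : k * b ^ 2 ≤ G := by nlinarith [sq_nonneg b]
    have hLk : Real.log p * k ≤ G := by nlinarith
    set B := 4 * (60 * n + 8 * Real.log p * k)
    have hB : B ≤ 7712 * G := by simp only [B]; linarith
    have hB0 : 0 ≤ B := by positivity
    have hcross : 2 * b * √(k * B) ≤ 7713 * G := by
      have : 2 * b * √(k * B) ≤ k * b ^ 2 + B := by
        rw [Real.sqrt_mul hk0]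
        have s1 := Real.sq_sqrt hk0
        have s2 := Real.sq_sqrt hB0
        nlinarith [sq_nonneg (b * √k - √B)]
      linarith
    have hQ2 : ∀ v, |∑ j ∈ selIdx u a y, inner ℝ (colVec u (y j)) v ^ 2 - c * ‖v‖ ^ 2| ≤
        220300 * G * ‖v‖ ^ 2 := by
      intro v
      have h3 := abs_le.1 (hQ v)
      have h4 : inner ℝ u v ^ 2 ≤ ‖v‖ ^ 2 := by
        have := abs_real_inner_le_norm u v
        rw [hu, one_mul] at this
        exact sq_le_sq' (by linarith [neg_abs_le (inner ℝ u v)]) ((le_abs_self _).trans this)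
      have h5 : 0 ≤ k * b ^ 2 * inner ℝ u v ^ 2 := by positivity
      have h6 : k * b ^ 2 * inner ℝ u v ^ 2 ≤ G * ‖v‖ ^ 2 := by gcongr
      have h7 : (6400 * √(n * (m + n)) + B + 2 * b * √(k * B)) * ‖v‖ ^ 2 ≤
        (220299 * G) * ‖v‖ ^ 2 := by gcongr; linarith
      have h8 : 0 ≤ G * ‖v‖ ^ 2 := by positivity
      rw [abs_le]
      constructor <;> linarith [h3.1, h3.2]
    have hsum : ∑ j, η (y j) = ∑ j ∈ selIdx u a y,
        inner ℝ (colVec u (y j)) u • orthPart u (colVec u (y j)) := by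
      have : ∀ j, η (y j) = if j ∈ selIdx u a y then
          inner ℝ (colVec u (y j)) u • orthPart u (colVec u (y j)) else 0 := by
        intro j
        simp only [hη_def, mem_selIdx]
        by_cases hy : (y j).1 = 0
        · rw [if_pos hy, colVec_of_null u hy, window]
          simp [(hz j).le]
        · rw [if_neg hy]
          by_cases hs : a ≤ ‖colVec u (y j)‖ ^ 2
          · rw [Set.indicator_of_mem (show y j ∈ usefulSet u a from ⟨hy, hs⟩), if_pos hs, one_mul]
          · rw [Set.indicator_of_notMem (show y j ∉ usefulSet u a from fun h => hs h.2),
              if_neg hs, zero_mul, zero_smul]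
      simp_rw [this]
      rw [← Finset.sum_filter]
      congr 1
      ext j; simp
    rw [hsum] at hH
    have key := hTop.sq_inner_le hu (by positivity) hQ2 hH.le
    have hα : inner ℝ u ξ ^ 2 * (1 + 800 * 220300 ^ 2) ≤ 800 * 220300 ^ 2 := by
      rw [← hG2] at key
      refine le_of_mul_le_mul_left (a := G ^ 2) ?_ (by positivity)
      linarith
    have h9 : c0 ^ 2 < inner ℝ u ξ ^ 2 := by
      rw [← sq_abs (inner ℝ u ξ)]; gcongr
    rw [div_le_iff₀ (by positivity)] at hc
    linarith
  refine (measure_mono hsub).trans ((measure_union_le _ _).trans ?_)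
  rw [ENNReal.ofReal_add (by positivity) (by positivity),
    ENNReal.ofReal_add (by positivity) (by positivity)]
  refine add_le_add ((measure_union_le _ _).trans (add_le_add e1 e3))
    (e2.trans (ENNReal.ofReal_le_ofReal (Real.exp_le_exp.2 ?_)))
  linarith

set_option maxHeartbeats 1000000 in
/-- Few selected null columns and very few useful ones: a single null column already dominates
the signal direction. -/
lemma measure_topEig_gt_le_of_skinny (hn : 4 ≤ n) (hp : 0 < p) (h0 : 0 ≤ ε) (h1 : ε ≤ 1 / 2)
    (hτ : 0 < τ) {u : Euc n} (hu : ‖u‖ = 1) {a m M b T c0 : ℝ} (ha : (n : ℝ) ≤ a)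
    (hm : p * ∫ z : Euc n, window n a ‖z‖ ∂(stdG n) = m) (hm0 : m ≤ (n : ℝ) / 1000)
    (hM : p * (ε * (stdG n).real {z | a ≤ ‖colVec u (τ, z)‖ ^ 2}) ≤ M)
    (hb : b = τ * √n) (hT1 : 8 * Real.log p * T ≤ n / 100) (hT2 : T * b ^ 2 ≤ n / 100)
    (hc0 : 0 ≤ c0) (hc : 1 / 2 ≤ c0 ^ 2) :
    Measure.pi (fun _ : Fin p => colLaw n ε τ) {y | ∃ ξ lam, TopEig (selIdx u a y)
      (fun j => colVec u (y j)) ξ lam ∧ c0 < |inner ℝ u ξ|} ≤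
      ENNReal.ofReal (2 * Real.exp (-n) + p * Real.exp (-(n / 8)) +
        Real.exp (-(n / 300)) + Real.exp (2 - n / 800) + Real.exp (2 * M - T) +
        Real.exp (-(m / 8))) := by
  have h1' : ε ≤ 1 := by linarith
  have := isProbabilityMeasure_colLaw (n := n) (τ := τ) h0 h1'
  have hL : 0 ≤ Real.log p := Real.log_natCast_nonneg p
  have hn0 : (0 : ℝ) < n := by positivity
  have hb0 : 0 < b := by rw [hb]; positivity
  set A : Set (ℝ × Euc n) := {y | y.1 = 0 ∧ window n a ‖y.2‖ = 1} with hA_def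
  have hA : MeasurableSet A := by
    have m1 : Measurable fun y : ℝ × Euc n => window n a ‖y.2‖ :=
      (isTrunc_window ha).meas.comp measurable_snd.norm
    exact (measurable_fst (measurableSet_singleton 0)).inter (m1 (measurableSet_singleton 1))
  have hAr : (colLaw n ε τ).real A = (1 - ε) * ∫ z : Euc n, window n a ‖z‖ ∂(stdG n) := by
    rw [measureReal_colLaw h0 h1' hA]
    have m1 : Measurable fun z : Euc n => window n a ‖z‖ :=
      (isTrunc_window ha).meas.comp measurable_norm
    have : ∫ z : Euc n, window n a ‖z‖ ∂(stdG n) =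
        (stdG n).real {z | window n a ‖z‖ = 1} := by
      have hms : MeasurableSet {z : Euc n | window n a ‖z‖ = 1} := m1 (measurableSet_singleton 1)
      rw [← integral_indicator_one hms]
      congr 1
      ext z
      rcases (isTrunc_window ha).zero_or_one ‖z‖ with h | h <;> simp [Set.indicator, h]
    rw [this]
    simp [hA_def, hτ.ne']
  have e1 := measure_not_isRegular_le hn hp h0 h1' hτ hu ha hm.le
  have e2 := measure_le_card (colLaw n ε τ) p (measurableSet_usefulSet u a) T
  rw [measureReal_usefulSet h0 h1' hτ.ne'] at e2
  have e3 := (isTrunc_window ha).measure_sum_sq_ge_le hn p h0 h1' (τ := τ) hτ.ne' hu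
    (hm.trans_le hm0)
  have e4 := measure_sum_posPart_ge_le (τ := τ) hp h0 h1' hu (n / 100)
  have e5 := measure_card_le (colLaw n ε τ) p hA
  rw [hAr] at e5
  have hm00 : 0 ≤ m := by
    rw [← hm]
    refine mul_nonneg (Nat.cast_nonneg _) (integral_nonneg fun z => ?_)
    rcases (isTrunc_window ha).zero_or_one ‖z‖ with h | h <;> simp [h]
  have hpm : p * ((1 - ε) * ∫ z : Euc n, window n a ‖z‖ ∂(stdG n)) = (1 - ε) * m := by
    rw [← hm]; ring
  rw [hpm] at e5
  have e6 : ENNReal.ofReal (Real.exp (-((1 - ε) * m / 4))) ≤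
      ENNReal.ofReal (Real.exp (-(m / 8))) := by
    refine ENNReal.ofReal_le_ofReal (Real.exp_le_exp.2 ?_)
    nlinarith
  have hsub : {y : Fin p → ℝ × Euc n | ∃ ξ lam, TopEig (selIdx u a y)
      (fun j => colVec u (y j)) ξ lam ∧ c0 < |inner ℝ u ξ|} ⊆
      ((({y | ¬ IsRegular u τ a m y} ∪
      {y | (n : ℝ) / 4 ≤ ∑ j, nullSel (window n a) (y j) * inner ℝ (y j).2 u ^ 2}) ∪
      {y | (n : ℝ) / 100 ≤ ∑ j, max (inner ℝ (y j).2 u ^ 2 - 8 * Real.log p) 0}) ∪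
      {y | T ≤ ((Finset.univ.filter fun j => y j ∈ usefulSet u a).card : ℝ)}) ∪
      {y | ((Finset.univ.filter fun j => y j ∈ A).card : ℝ) ≤ (1 - ε) * m / 4} := by
    rintro y ⟨ξ, lam, hTop, hlt⟩
    by_contra hc'
    simp only [Set.mem_union, Set.mem_ofPred_eq, not_or, not_not, not_le] at hc'
    obtain ⟨⟨⟨⟨⟨hf, hz, c, hQ⟩, hnull⟩, hpos⟩, hcard⟩, hA'⟩ := hc'
    change ((usefulIdx u a y).card : ℝ) < _ at hcard
    set k : ℝ := ((usefulIdx u a y).card : ℝ) with hk_def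
    have hk0 : 0 ≤ k := Nat.cast_nonneg _
    have hex : 0 < (Finset.univ.filter fun j => y j ∈ A).card := by
      have : (0 : ℝ) ≤ (1 - ε) * m / 4 := by
        have : 0 ≤ 1 - ε := by linarith
        positivity
      exact_mod_cast this.trans_lt hA'
    obtain ⟨j, hj⟩ := Finset.card_pos.1 hex
    have hjA : y j ∈ A := (Finset.mem_filter.1 hj).2
    have hja : a ≤ ‖colVec u (y j)‖ ^ 2 := by
      rw [colVec_of_null u hjA.1]
      by_contra h
      have := hjA.2
      rw [window, if_neg (fun h' => h h'.1)] at this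
      exact zero_ne_one this
    have hlam : (n : ℝ) ≤ lam :=
      (ha.trans hja).trans (hTop.norm_sq_le (mem_selIdx.2 hja) (by linarith))
    have hD3 := hTop.sq_inner_mul_le u
    rw [sum_nullSel_mul u hz] at hnull
    have huse := sum_sq_le_of_posPart hpos.le (usefulIdx u a y)
    have hsplit : ∑ j ∈ selIdx u a y, inner ℝ (colVec u (y j)) u ^ 2 ≤
        ∑ j ∈ nullIdx u a y, inner ℝ (y j).2 u ^ 2 +
        ∑ j ∈ usefulIdx u a y, (2 * b ^ 2 + 2 * inner ℝ (y j).2 u ^ 2) := by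
      rw [selIdx_eq_union, Finset.sum_union (disjoint_nullIdx_usefulIdx u a y)]
      refine add_le_add (le_of_eq (Finset.sum_congr rfl fun i hi => ?_))
        (Finset.sum_le_sum fun i hi => ?_)
      · rw [colVec_of_null u (mem_nullIdx.1 hi).2]
      · have : (y i).1 = τ := (hf i).resolve_left (mem_usefulIdx.1 hi).1
        rw [colVec, this, ← hb, inner_add_left, real_inner_smul_left, real_inner_self_eq_norm_sq,
          hu]
        nlinarith [sq_nonneg (b - inner ℝ (y i).2 u)]
    rw [Finset.sum_add_distrib, Finset.sum_const, nsmul_eq_mul, ← Finset.mul_sum,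
      ← hk_def] at hsplit
    have hkb : k * b ^ 2 ≤ n / 100 := by nlinarith [sq_nonneg b]
    have hLk : 8 * Real.log p * k ≤ n / 100 := by nlinarith
    have h9 : c0 ^ 2 < inner ℝ u ξ ^ 2 := by
      rw [← sq_abs (inner ℝ u ξ)]; gcongr
    have h10 : (n : ℝ) * inner ℝ u ξ ^ 2 ≤ lam * inner ℝ u ξ ^ 2 := by gcongr
    have h11 : (n : ℝ) * (1 / 2) < n * inner ℝ u ξ ^ 2 :=
      mul_lt_mul_of_pos_left (hc.trans_lt h9) hn0
    linarith
  refine (measure_mono hsub).trans ((measure_union_le _ _).trans ?_)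
  rw [ENNReal.ofReal_add (by positivity) (by positivity),
    ENNReal.ofReal_add (by positivity) (by positivity),
    ENNReal.ofReal_add (by positivity) (by positivity),
    ENNReal.ofReal_add (by positivity) (by positivity)]
  refine add_le_add ((measure_union_le _ _).trans (add_le_add ((measure_union_le _ _).trans
    (add_le_add ((measure_union_le _ _).trans (add_le_add e1 e3))
      (e4.trans (ENNReal.ofReal_le_ofReal (Real.exp_le_exp.2 ?_)))))
    (e2.trans (ENNReal.ofReal_le_ofReal (Real.exp_le_exp.2 ?_)))))
    (by convert e5.trans e6)
  · linarith
  · linarith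

end

section

variable {n : ℕ}

lemma abs_half_log_one_sub_le {s : ℝ} (h0 : 0 ≤ s) (h1 : s ≤ 1 / 4) :
    |s + s ^ 2 + Real.log (1 - 2 * s) / 2| ≤ 8 * s ^ 3 := by
  have h := Real.abs_log_sub_add_sum_range_le (x := 2 * s)
    (by rw [abs_of_nonneg (by linarith)]; linarith) 2
  rw [abs_of_nonneg (by linarith : 0 ≤ 2 * s)] at h
  simp only [Finset.sum_range_succ, Finset.sum_range_zero] at h
  norm_num at h
  have h2 : (2 * s) ^ 3 / (1 - 2 * s) ≤ 16 * s ^ 3 := by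
    rw [div_le_iff₀ (by linarith)]
    have : 0 ≤ s ^ 3 := by positivity
    nlinarith
  have h3 := abs_le.1 (h.trans h2)
  rw [abs_le]
  constructor <;> nlinarith [h3.1, h3.2]

lemma integrable_exp_norm_sq_sub {s : ℝ} (h1 : s ≤ 1 / 4) (c : ℝ) :
    Integrable (fun z : Euc n => Real.exp (s * (‖z‖ ^ 2 - n) + c)) (stdG n) := by
  have h := (integrable_exp_norm_sq (n := n) (s := s) (by linarith)).mul_const
    (Real.exp (-(s * n) + c))
  refine h.congr (ae_of_all _ fun z => ?_)
  simp only [← Real.exp_add]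
  congr 1; ring

lemma integral_exp_norm_sq_sub {s : ℝ} (h1 : s ≤ 1 / 4) :
    ∫ z : Euc n, Real.exp (s * (‖z‖ ^ 2 - n)) ∂(stdG n) =
      Real.exp (n * (-s - Real.log (1 - 2 * s) / 2)) := by
  have e : ∀ z : Euc n, Real.exp (s * (‖z‖ ^ 2 - n)) =
      Real.exp (-(s * n)) * Real.exp (s * ‖z‖ ^ 2) := by
    intro z; rw [← Real.exp_add]; congr 1; ring
  simp_rw [e]
  rw [integral_const_mul, integral_exp_norm_sq (by linarith)]
  have h2 : (√(1 - 2 * s))⁻¹ = Real.exp (-(Real.log (1 - 2 * s) / 2)) := by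
    rw [Real.exp_neg, Real.exp_half, Real.exp_log (by linarith)]
  rw [h2, ← Real.exp_nat_mul, ← Real.exp_add]
  congr 1; ring

/-- Moderate-deviation estimate for the moment generating function of `‖z‖² - n`. -/
lemma integral_exp_norm_sq_sub_bounds {σ ϱ e : ℝ} (hσ : 0 ≤ σ) (hϱ : 0 ≤ ϱ)
    (h1 : σ * ϱ ≤ 1 / 4) (he : 8 * σ ^ 3 * ϱ ≤ e) :
    Real.exp ((σ ^ 2 - e) * (n * ϱ ^ 2)) ≤
      ∫ z : Euc n, Real.exp (σ * ϱ * (‖z‖ ^ 2 - n)) ∂(stdG n) ∧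
    ∫ z : Euc n, Real.exp (σ * ϱ * (‖z‖ ^ 2 - n)) ∂(stdG n) ≤
      Real.exp ((σ ^ 2 + e) * (n * ϱ ^ 2)) := by
  rw [integral_exp_norm_sq_sub h1]
  have h := abs_le.1 (abs_half_log_one_sub_le (mul_nonneg hσ hϱ) h1)
  have h2 : 8 * (σ * ϱ) ^ 3 ≤ e * ϱ ^ 2 := by
    calc 8 * (σ * ϱ) ^ 3 = 8 * σ ^ 3 * ϱ * ϱ ^ 2 := by ring
      _ ≤ _ := by gcongr
  have hn : (0 : ℝ) ≤ n := Nat.cast_nonneg n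
  constructor
  · refine Real.exp_le_exp.2 ?_
    calc (σ ^ 2 - e) * (n * ϱ ^ 2) = n * ((σ * ϱ) ^ 2 - e * ϱ ^ 2) := by ring
      _ ≤ _ := mul_le_mul_of_nonneg_left (by linarith [h.2]) hn
  · refine Real.exp_le_exp.2 ?_
    calc _ ≤ n * ((σ * ϱ) ^ 2 + e * ϱ ^ 2) :=
          mul_le_mul_of_nonneg_left (by linarith [h.1]) hn
      _ = _ := by ring

/-- Upper bound for moderate deviations of the chi-square distribution. -/
lemma measureReal_norm_sq_ge_le_exp {w ϱ e : ℝ} (hw : 0 ≤ w) (hϱ : 0 ≤ ϱ)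
    (h1 : w * ϱ ≤ 1 / 4) (he : 8 * w ^ 3 * ϱ ≤ e) :
    (stdG n).real {z | n + 2 * w * (n * ϱ) ≤ ‖z‖ ^ 2} ≤
      Real.exp (-((w ^ 2 - e) * (n * ϱ ^ 2))) := by
  have hi := integrable_exp_norm_sq_sub (n := n) h1 0
  simp only [add_zero] at hi
  have h := mul_meas_ge_le_integral_of_nonneg (μ := stdG n)
    (f := fun z => Real.exp (w * ϱ * (‖z‖ ^ 2 - n))) (ae_of_all _ fun z => (Real.exp_pos _).le)
    hi (Real.exp (2 * w ^ 2 * (n * ϱ ^ 2)))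
  have h2 := h.trans (integral_exp_norm_sq_sub_bounds hw hϱ h1 he).2
  have hsub : (stdG n).real {z | n + 2 * w * (n * ϱ) ≤ ‖z‖ ^ 2} ≤ (stdG n).real
      {z | Real.exp (2 * w ^ 2 * (n * ϱ ^ 2)) ≤ Real.exp (w * ϱ * (‖z‖ ^ 2 - n))} := by
    refine measureReal_mono fun z hz => ?_
    simp only [Set.mem_ofPred_eq, Real.exp_le_exp] at hz ⊢
    calc 2 * w ^ 2 * (n * ϱ ^ 2) = w * ϱ * (2 * w * (n * ϱ)) := by ring
      _ ≤ _ := mul_le_mul_of_nonneg_left (by linarith) (by positivity)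
  refine hsub.trans ?_
  rw [← le_div_iff₀' (Real.exp_pos _), ← Real.exp_sub] at h2
  refine h2.trans (Real.exp_le_exp.2 ?_)
  linarith

/-- Lower bound for moderate deviations of the chi-square distribution, by tilting. -/
lemma half_exp_le_measureReal_norm_sq {w κ ϱ : ℝ} (hw : 0 ≤ w) (hκ : 0 < κ) (hϱ : 0 ≤ ϱ)
    (h1 : (w + κ) * ϱ ≤ 1 / 4) (he : 8 * (w + κ) ^ 3 * ϱ ≤ κ ^ 2 / 16)
    (hL : 12 ≤ κ ^ 2 * (n * ϱ ^ 2)) :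
    Real.exp (-((w + κ) ^ 2 * (n * ϱ ^ 2))) / 2 ≤
      (stdG n).real {z | n + 2 * w * (n * ϱ) ≤ ‖z‖ ^ 2 ∧
        ‖z‖ ^ 2 ≤ n + 2 * (w + κ) * (n * ϱ)} := by
  set L := n * ϱ ^ 2 with hL_def
  set A : Set (Euc n) := {z | n + 2 * w * (n * ϱ) ≤ ‖z‖ ^ 2 ∧
        ‖z‖ ^ 2 ≤ n + 2 * (w + κ) * (n * ϱ)} with hA_def
  have hA : MeasurableSet A := by
    have m : Measurable fun z : Euc n => ‖z‖ ^ 2 := by fun_prop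
    exact (measurableSet_le measurable_const m).inter (measurableSet_le m measurable_const)
  have hmono : ∀ σ, 0 ≤ σ → σ ≤ w + κ → σ * ϱ ≤ 1 / 4 ∧ 8 * σ ^ 3 * ϱ ≤ κ ^ 2 / 16 := by
    intro σ h0 h
    refine ⟨(mul_le_mul_of_nonneg_right h hϱ).trans h1, le_trans ?_ he⟩
    gcongr
  have b0 := (integral_exp_norm_sq_sub_bounds (n := n) (σ := w + κ / 2) (by positivity) hϱ
    (hmono _ (by positivity) (by linarith)).1 (hmono _ (by positivity) (by linarith)).2).1
  have b1 := (integral_exp_norm_sq_sub_bounds (n := n) (σ := w + κ) (by positivity) hϱ h1 he).2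
  have b2 := (integral_exp_norm_sq_sub_bounds (n := n) (σ := w) hw hϱ
    (hmono _ hw (by linarith)).1 (hmono _ hw (by linarith)).2).2
  have i1 := integrable_exp_norm_sq_sub (n := n) h1 (-(κ * (w + κ) * L))
  have i2 := integrable_exp_norm_sq_sub (n := n) (hmono w hw (by linarith)).1 (κ * w * L)
  have i0 := integrable_exp_norm_sq_sub (n := n)
    (hmono (w + κ / 2) (by positivity) (by linarith)).1 0
  simp only [add_zero] at i0
  have iA : Integrable (A.indicator fun _ => Real.exp (2 * (w + κ / 2) * (w + κ) * L))
      (stdG n) := (integrable_const _).indicator hA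
  have hpt : ∀ z : Euc n, Real.exp ((w + κ / 2) * ϱ * (‖z‖ ^ 2 - n)) ≤
      A.indicator (fun _ => Real.exp (2 * (w + κ / 2) * (w + κ) * L)) z +
      (Real.exp ((w + κ) * ϱ * (‖z‖ ^ 2 - n) + -(κ * (w + κ) * L)) +
        Real.exp (w * ϱ * (‖z‖ ^ 2 - n) + κ * w * L)) := by
    intro z
    set D := ϱ * (‖z‖ ^ 2 - n) with hD
    have eL : ∀ c : ℝ, 2 * c * L = ϱ * (2 * c * (n * ϱ)) := fun c => by rw [hL_def]; ring
    have r0 : (w + κ / 2) * ϱ * (‖z‖ ^ 2 - n) = (w + κ / 2) * D := by rw [hD]; ring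
    have r1 : (w + κ) * ϱ * (‖z‖ ^ 2 - n) = (w + κ) * D := by rw [hD]; ring
    have r2 : w * ϱ * (‖z‖ ^ 2 - n) = w * D := by rw [hD]; ring
    rw [r0, r1, r2]
    have p1 := Real.exp_pos ((w + κ) * D + -(κ * (w + κ) * L))
    have p2 := Real.exp_pos (w * D + κ * w * L)
    by_cases hz : z ∈ A
    · rw [Set.indicator_of_mem hz]
      have hDle : D ≤ 2 * (w + κ) * L := by
        rw [eL, hD]
        exact mul_le_mul_of_nonneg_left (by linarith [hz.2]) hϱ
      have : Real.exp ((w + κ / 2) * D) ≤ Real.exp (2 * (w + κ / 2) * (w + κ) * L) := by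
        refine Real.exp_le_exp.2 ?_
        calc (w + κ / 2) * D ≤ (w + κ / 2) * (2 * (w + κ) * L) :=
              mul_le_mul_of_nonneg_left hDle (by positivity)
          _ = _ := by ring
      linarith
    · rw [Set.indicator_of_notMem hz, zero_add]
      by_cases hlow : n + 2 * w * (n * ϱ) ≤ ‖z‖ ^ 2
      · have hup : ¬ ‖z‖ ^ 2 ≤ n + 2 * (w + κ) * (n * ϱ) := fun h => hz ⟨hlow, h⟩
        have hDge : 2 * (w + κ) * L ≤ D := by
          rw [eL, hD]
          exact mul_le_mul_of_nonneg_left (by linarith) hϱ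
        have : Real.exp ((w + κ / 2) * D) ≤ Real.exp ((w + κ) * D + -(κ * (w + κ) * L)) :=
          Real.exp_le_exp.2 (by nlinarith)
        linarith
      · have hDle : D ≤ 2 * w * L := by
          rw [eL, hD]
          exact mul_le_mul_of_nonneg_left (by linarith) hϱ
        have : Real.exp ((w + κ / 2) * D) ≤ Real.exp (w * D + κ * w * L) :=
          Real.exp_le_exp.2 (by nlinarith)
        linarith
  have h_int := integral_mono i0 (iA.add (i1.add i2)) hpt
  rw [integral_add' iA (i1.add i2), integral_add' i1 i2, integral_indicator_const _ hA,
    smul_eq_mul] at h_int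
  simp only [Real.exp_add] at h_int
  rw [integral_mul_const, integral_mul_const] at h_int
  set X := (w ^ 2 + κ * w) * L with hX
  have c1 : (∫ z : Euc n, Real.exp ((w + κ) * ϱ * (‖z‖ ^ 2 - n)) ∂(stdG n)) *
      Real.exp (-(κ * (w + κ) * L)) ≤ Real.exp (X + κ ^ 2 / 16 * L) := by
    refine (mul_le_mul_of_nonneg_right b1 (Real.exp_pos _).le).trans ?_
    rw [← Real.exp_add]
    exact Real.exp_le_exp.2 (le_of_eq (by rw [hX]; ring))
  have c2 : (∫ z : Euc n, Real.exp (w * ϱ * (‖z‖ ^ 2 - n)) ∂(stdG n)) *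
      Real.exp (κ * w * L) ≤ Real.exp (X + κ ^ 2 / 16 * L) := by
    refine (mul_le_mul_of_nonneg_right b2 (Real.exp_pos _).le).trans ?_
    rw [← Real.exp_add]
    exact Real.exp_le_exp.2 (le_of_eq (by rw [hX]; ring))
  have c0 : Real.exp (X + 3 * κ ^ 2 / 16 * L) ≤
      ∫ z : Euc n, Real.exp ((w + κ / 2) * ϱ * (‖z‖ ^ 2 - n)) ∂(stdG n) := by
    refine le_trans (Real.exp_le_exp.2 (le_of_eq ?_)) b0
    rw [hX]; ring
  have c3 : 4 * Real.exp (X + κ ^ 2 / 16 * L) ≤ Real.exp (X + 3 * κ ^ 2 / 16 * L) := by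
    have h4 : (4 : ℝ) ≤ Real.exp (κ ^ 2 * L / 8) := by
      have h5 : Real.exp (1 + 1 / 2) ≤ Real.exp (κ ^ 2 * L / 8) :=
        Real.exp_le_exp.2 (by linarith)
      rw [Real.exp_add] at h5
      nlinarith [Real.exp_one_gt_d9, Real.add_one_le_exp (1 / 2 : ℝ)]
    calc _ ≤ Real.exp (κ ^ 2 * L / 8) * Real.exp (X + κ ^ 2 / 16 * L) := by gcongr
      _ = _ := by rw [← Real.exp_add]; congr 1; ring
  have c4 : Real.exp (X + 3 * κ ^ 2 / 16 * L) / 2 ≤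
      (stdG n).real A * Real.exp (2 * (w + κ / 2) * (w + κ) * L) := by linarith
  have c5 : Real.exp (-((w + κ) ^ 2 * L)) * Real.exp (2 * (w + κ / 2) * (w + κ) * L) ≤
      Real.exp (X + 3 * κ ^ 2 / 16 * L) := by
    rw [← Real.exp_add]
    refine Real.exp_le_exp.2 ?_
    rw [hX]
    nlinarith [sq_nonneg κ]
  have hpos := Real.exp_pos (2 * (w + κ / 2) * (w + κ) * L)
  refine le_of_mul_le_mul_right ?_ hpos
  linarith

end

section

variable {n : ℕ} {τ : ℝ}

lemma integral_window (a : ℝ) : ∫ z : Euc n, window n a ‖z‖ ∂(stdG n) =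
    (stdG n).real {z | a ≤ ‖z‖ ^ 2 ∧ ‖z‖ ^ 2 ≤ 2 * n} := by
  have m : Measurable fun z : Euc n => ‖z‖ ^ 2 := by fun_prop
  have hms : MeasurableSet {z : Euc n | a ≤ ‖z‖ ^ 2 ∧ ‖z‖ ^ 2 ≤ 2 * n} :=
    (measurableSet_le measurable_const m).inter (measurableSet_le m measurable_const)
  rw [← integral_indicator_one hms]
  congr 1
  ext z
  simp only [window, Set.indicator, Set.mem_ofPred_eq, Pi.one_apply]

lemma integral_window_le {s ϱ e : ℝ} (hs : 0 ≤ s) (hϱ : 0 ≤ ϱ)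
    (h1 : s * ϱ ≤ 1 / 4) (he : 8 * s ^ 3 * ϱ ≤ e) :
    ∫ z : Euc n, window n (n + 2 * s * (n * ϱ)) ‖z‖ ∂(stdG n) ≤
      Real.exp (-((s ^ 2 - e) * (n * ϱ ^ 2))) := by
  rw [integral_window]
  exact (measureReal_mono fun z hz => hz.1).trans (measureReal_norm_sq_ge_le_exp hs hϱ h1 he)

lemma le_integral_window {s κ ϱ : ℝ} (hs : 0 ≤ s) (hκ : 0 < κ) (hϱ : 0 ≤ ϱ)
    (h1 : (s + κ) * ϱ ≤ 1 / 4) (he : 8 * (s + κ) ^ 3 * ϱ ≤ κ ^ 2 / 16)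
    (hL : 12 ≤ κ ^ 2 * (n * ϱ ^ 2)) :
    Real.exp (-((s + κ) ^ 2 * (n * ϱ ^ 2))) / 2 ≤
      ∫ z : Euc n, window n (n + 2 * s * (n * ϱ)) ‖z‖ ∂(stdG n) := by
  rw [integral_window]
  refine (half_exp_le_measureReal_norm_sq hs hκ hϱ h1 he hL).trans
    (measureReal_mono fun z hz => ⟨hz.1, hz.2.trans ?_⟩)
  have hn : (0 : ℝ) ≤ n := Nat.cast_nonneg n
  have := mul_le_mul_of_nonneg_left h1 hn
  linarith

lemma norm_sq_colVec {u : Euc n} (hu : ‖u‖ = 1) (z : Euc n) : ‖colVec u (τ, z)‖ ^ 2 =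
    (τ * √n) ^ 2 + 2 * (τ * √n) * inner ℝ z u + ‖z‖ ^ 2 := by
  rw [colVec, norm_add_sq_real, norm_smul, hu, real_inner_smul_left, real_inner_comm u z]
  rw [Real.norm_eq_abs, mul_one, sq_abs]; ring

lemma measureReal_half_le (u : Euc n) (t : ℝ) :
    (stdG n).real {z | t ≤ ‖z‖ ^ 2} / 2 ≤
      (stdG n).real {z | t ≤ ‖z‖ ^ 2 ∧ 0 ≤ inner ℝ z u} := by
  have m : Measurable fun z : Euc n => ‖z‖ ^ 2 := by fun_prop
  have m2 : Measurable fun z : Euc n => inner ℝ z u := by fun_prop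
  have hA : MeasurableSet {z : Euc n | t ≤ ‖z‖ ^ 2 ∧ 0 ≤ inner ℝ z u} :=
    (measurableSet_le measurable_const m).inter (measurableSet_le measurable_const m2)
  have hB : MeasurableSet {z : Euc n | t ≤ ‖z‖ ^ 2 ∧ inner ℝ z u ≤ 0} :=
    (measurableSet_le measurable_const m).inter (measurableSet_le m2 measurable_const)
  have hsub : (stdG n).real {z | t ≤ ‖z‖ ^ 2} ≤
      (stdG n).real {z | t ≤ ‖z‖ ^ 2 ∧ 0 ≤ inner ℝ z u} +
      (stdG n).real {z | t ≤ ‖z‖ ^ 2 ∧ inner ℝ z u ≤ 0} := by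
    refine (measureReal_mono fun z hz => ?_).trans (measureReal_union_le _ _)
    rcases le_total 0 (inner ℝ z u : ℝ) with h | h
    · exact Or.inl ⟨hz, h⟩
    · exact Or.inr ⟨hz, h⟩
  have heq : (stdG n).real {z | t ≤ ‖z‖ ^ 2 ∧ inner ℝ z u ≤ 0} =
      (stdG n).real {z | t ≤ ‖z‖ ^ 2 ∧ 0 ≤ inner ℝ z u} := by
    rw [← integral_indicator_one hA, ← integral_indicator_one hB,
      ← integral_comp_isometry_stdG (LinearIsometryEquiv.neg ℝ)]
    congr 1
    ext z
    simp [Set.indicator, inner_neg_left]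
  linarith

/-- Lower bound for the selection probability of a useful column. -/
lemma le_measureReal_colVec {u : Euc n} (hu : ‖u‖ = 1) {s t w κ ϱ : ℝ} (hw : 0 ≤ w)
    (hwst : s - t ≤ w) (hκ : 0 < κ) (hϱ : 0 ≤ ϱ) (h1 : (w + κ) * ϱ ≤ 1 / 4)
    (he : 8 * (w + κ) ^ 3 * ϱ ≤ κ ^ 2 / 16) (hL : 12 ≤ κ ^ 2 * (n * ϱ ^ 2)) (hτ : 0 ≤ τ)
    (hb : 2 * t * (n * ϱ) ≤ (τ * √n) ^ 2) :
    Real.exp (-((w + κ) ^ 2 * (n * ϱ ^ 2))) / 4 ≤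
      (stdG n).real {z | n + 2 * s * (n * ϱ) ≤ ‖colVec u (τ, z)‖ ^ 2} := by
  have h2 : Real.exp (-((w + κ) ^ 2 * (n * ϱ ^ 2))) / 2 ≤
      (stdG n).real {z | n + 2 * w * (n * ϱ) ≤ ‖z‖ ^ 2} :=
    (half_exp_le_measureReal_norm_sq hw hκ hϱ h1 he hL).trans (measureReal_mono fun z hz => hz.1)
  have h3 := measureReal_half_le u (n + 2 * w * (n * ϱ))
  have h4 : (stdG n).real {z | n + 2 * w * (n * ϱ) ≤ ‖z‖ ^ 2 ∧ 0 ≤ inner ℝ z u} ≤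
      (stdG n).real {z | n + 2 * s * (n * ϱ) ≤ ‖colVec u (τ, z)‖ ^ 2} := by
    refine measureReal_mono fun z hz => ?_
    obtain ⟨z1, z2⟩ := hz
    simp only [Set.mem_ofPred_eq, norm_sq_colVec hu]
    have h5 : 0 ≤ 2 * (τ * √n) * inner ℝ z u := by positivity
    have h6 := mul_le_mul_of_nonneg_right hwst (by positivity : 0 ≤ (n : ℝ) * ϱ)
    linarith
  linarith

lemma measureReal_inner_ge_le {u : Euc n} (hu : ‖u‖ = 1) {t : ℝ} (ht : 0 ≤ t) :
    (stdG n).real {z | t ≤ inner ℝ z u} ≤ Real.exp (-(t ^ 2 / 2)) := by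
  have h := mul_meas_ge_le_integral_of_nonneg (μ := stdG n)
    (f := fun z => Real.exp (t * inner ℝ z u)) (ae_of_all _ fun z => (Real.exp_pos _).le)
    (integrable_exp_inner u t) (Real.exp (t * t))
  rw [integral_exp_inner, hu] at h
  have hsub : (stdG n).real {z | t ≤ inner ℝ z u} ≤
      (stdG n).real {z | Real.exp (t * t) ≤ Real.exp (t * inner ℝ z u)} := by
    refine measureReal_mono fun z hz => ?_
    simp only [Set.mem_ofPred_eq, Real.exp_le_exp] at hz ⊢
    exact mul_le_mul_of_nonneg_left hz ht
  refine hsub.trans ?_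
  rw [← le_div_iff₀' (Real.exp_pos _), ← Real.exp_sub] at h
  exact h.trans (Real.exp_le_exp.2 (by linarith))

/-- Upper bound for the selection probability of a useful column. -/
lemma measureReal_colVec_le {u : Euc n} (hu : ‖u‖ = 1) {s t w κ ϱ e : ℝ}
    (hw : w = max (s - t - 2 * κ) 0) (hw2 : w ^ 2 - e ≤ 2) (hϱ : 0 ≤ ϱ)
    (h1 : w * ϱ ≤ 1 / 4) (he : 8 * w ^ 3 * ϱ ≤ e) (hτ : 0 ≤ τ)
    (hb : (τ * √n) ^ 2 ≤ 2 * (t + κ) * (n * ϱ)) (hb2 : 2 * (τ * √n) ≤ κ * √n) :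
    (stdG n).real {z | n + 2 * s * (n * ϱ) ≤ ‖colVec u (τ, z)‖ ^ 2} ≤
      2 * Real.exp (-((w ^ 2 - e) * (n * ϱ ^ 2))) := by
  have hn : (0 : ℝ) ≤ n := Nat.cast_nonneg n
  have hw0 : 0 ≤ w := hw ▸ le_max_right _ _
  rcases le_total (s - t - 2 * κ) 0 with hle | hge
  · have hw' : w = 0 := by rw [hw, max_eq_right hle]
    have he0 : 0 ≤ e := by rw [hw'] at he; linarith
    have h2 : 1 ≤ Real.exp (-((w ^ 2 - e) * (n * ϱ ^ 2))) := by
      rw [hw', Real.one_le_exp_iff]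
      have : 0 ≤ e * (n * ϱ ^ 2) := by positivity
      linarith
    linarith [measureReal_le_one (μ := stdG n)
      (s := {z | n + 2 * s * (n * ϱ) ≤ ‖colVec u (τ, z)‖ ^ 2})]
  have hw' : w = s - t - 2 * κ := by rw [hw, max_eq_left hge]
  have h2 := measureReal_norm_sq_ge_le_exp (n := n) hw0 hϱ h1 he
  have h3 := measureReal_inner_ge_le hu (t := 2 * √n * ϱ) (by positivity)
  have e3 : (2 * √n * ϱ) ^ 2 / 2 = 2 * (n * ϱ ^ 2) := by
    rw [mul_pow, mul_pow, Real.sq_sqrt hn]; ring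
  rw [e3] at h3
  have h4 : Real.exp (-(2 * (n * ϱ ^ 2))) ≤ Real.exp (-((w ^ 2 - e) * (n * ϱ ^ 2))) := by
    refine Real.exp_le_exp.2 (neg_le_neg ?_)
    gcongr
  have hsub : (stdG n).real {z | n + 2 * s * (n * ϱ) ≤ ‖colVec u (τ, z)‖ ^ 2} ≤
      (stdG n).real {z | n + 2 * w * (n * ϱ) ≤ ‖z‖ ^ 2} +
      (stdG n).real {z | 2 * √n * ϱ ≤ inner ℝ z u} := by
    refine (measureReal_mono fun z hz => ?_).trans (measureReal_union_le _ _)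
    by_contra hc
    simp only [Set.mem_union, Set.mem_ofPred_eq, not_or, not_le] at hc hz
    rw [norm_sq_colVec hu] at hz
    have h5 : 2 * (τ * √n) * inner ℝ z u ≤ 2 * (τ * √n) * (2 * √n * ϱ) :=
      mul_le_mul_of_nonneg_left hc.2.le (by positivity)
    have h6 : 2 * (τ * √n) * (2 * √n * ϱ) ≤ κ * √n * (2 * √n * ϱ) :=
      mul_le_mul_of_nonneg_right hb2 (by positivity)
    have h7 : κ * √n * (2 * √n * ϱ) = 2 * κ * (n * ϱ) := by
      calc _ = 2 * κ * ((√n * √n) * ϱ) := by ring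
        _ = _ := by rw [Real.mul_self_sqrt hn]
    rw [hw'] at hc
    linarith [hc.1]
  linarith

end

/-- The phase function in terms of `m = 1 - θ` and `a = 1 - β - θ / 2`. -/
lemma rhoStarTheta_eq {θ β m a : ℝ} (hm : m = 1 - θ) (ha : a = 1 - β - θ / 2) (hm0 : 0 < m)
    (ha0 : 0 < a) :
    rhoStarTheta θ β = if m / 4 < a then m / 2 - a else (√m - √a) ^ 2 := by
  have hβ : β - 1 / 2 = m / 2 - a := by rw [hm, ha]; ring
  have hb : 1 / 2 + (m / 2 - a) / m = 1 - a / m := by field_simp; ring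
  have hmN : √m ≠ 0 := (Real.sqrt_pos.2 hm0).ne'
  rw [rhoStarTheta, rhoStar, ← hm, hβ, hb]
  by_cases h : m / 4 < a
  · have h' : 1 - a / m < 3 / 4 := by
      have : 1 / 4 < a / m := by rw [lt_div_iff₀ hm0]; linarith
      linarith
    rw [if_pos h, if_pos h']
    field_simp
    ring
  · have h' : ¬ 1 - a / m < 3 / 4 := by
      have : a / m ≤ 1 / 4 := by rw [div_le_iff₀ hm0]; linarith
      linarith
    rw [if_neg h, if_neg h', sub_sub_cancel, Real.sqrt_div ha0.le]
    have : √m ^ 2 = m := Real.sq_sqrt hm0.le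
    calc m * (1 - √a / √m) ^ 2 = √m ^ 2 * (1 - √a / √m) ^ 2 := by rw [this]
      _ = (√m - √a) ^ 2 := by field_simp

/-- Below the phase curve, the number of useful selected features is too small. -/
lemma exponent_lt_of_lt_rhoStarTheta {θ β r q : ℝ} (hθ1 : θ < 1)
    (hθ0 : 0 < θ) (hβu : β < 1 - θ / 2) (hr0 : 0 < r) (hq0 : 0 < q)
    (h : r < rhoStarTheta θ β) :
    1 - β - max (√q - √r) 0 ^ 2 < max (1 - q) θ / 2 := by
  obtain ⟨m, hm⟩ : ∃ m, m = 1 - θ := ⟨_, rfl⟩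
  obtain ⟨a, ha⟩ : ∃ a, a = 1 - β - θ / 2 := ⟨_, rfl⟩
  have hm0 : 0 < m := by linarith
  have ha0 : 0 < a := by linarith
  rw [rhoStarTheta_eq hm ha hm0 ha0] at h
  suffices a - max (√q - √r) 0 ^ 2 < (m - q) / 2 ∨ a < max (√q - √r) 0 ^ 2 by
    rcases this with h1 | h1
    · linarith [le_max_left (1 - q) θ]
    · linarith [le_max_right (1 - q) θ]
  have hx0 : 0 < √q := Real.sqrt_pos.2 hq0
  have ht0 : 0 < √r := Real.sqrt_pos.2 hr0
  have hxq : √q ^ 2 = q := Real.sq_sqrt hq0.le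
  have htr : √r ^ 2 = r := Real.sq_sqrt hr0.le
  set x := √q
  set t := √r
  by_cases hc : m / 4 < a
  · rw [if_pos hc] at h
    left
    rcases le_total x t with hxt | hxt
    · rw [max_eq_right (by linarith)]; nlinarith
    · rw [max_eq_left (by linarith)]; nlinarith [sq_nonneg (x - 2 * t)]
  · rw [if_neg hc] at h
    have hN0 : 0 < √m := Real.sqrt_pos.2 hm0
    have hα0 : 0 < √a := Real.sqrt_pos.2 ha0
    have hNm : √m ^ 2 = m := Real.sq_sqrt hm0.le
    have hαa : √a ^ 2 = a := Real.sq_sqrt ha0.le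
    set N := √m
    set α := √a
    have hαN : α ≤ N / 2 := by
      apply le_of_sq_le_sq _ (by positivity)
      rw [hαa, div_pow, hNm]; linarith
    have htN : t < N - α := by
      apply lt_of_pow_lt_pow_left₀ 2 (by linarith)
      rw [htr]; exact h
    rcases le_or_gt N x with hNx | hNx
    · right
      rw [max_eq_left (by linarith), ← hαa]
      exact pow_lt_pow_left₀ (by linarith) hα0.le two_ne_zero
    · left
      rcases lt_or_ge x (N - α) with hx | hx
      · nlinarith [sq_nonneg (max (x - t) 0)]
      · rw [max_eq_left (by linarith)]
        have : (x - N + α) ^ 2 < (x - t) ^ 2 :=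
          pow_lt_pow_left₀ (by linarith) (by linarith) two_ne_zero
        nlinarith [mul_nonneg (sub_nonneg.2 hNx.le) (sub_nonneg.2 hαN), sq_nonneg (N - x)]

/-- Above the phase curve and with the ideal threshold, the useful selected features dominate. -/
lemma exponent_gt_of_rhoStarTheta_lt {θ β r : ℝ} (hβl : 1 / 2 < β) (hβu : β < 1 - θ / 2)
    (hr0 : 0 < r) (h : rhoStarTheta θ β < r) :
    0 < qStar θ β r ∧
    max (1 - qStar θ β r) θ / 2 < 1 - β - max (√(qStar θ β r) - √r) 0 ^ 2 := by
  obtain ⟨m, hm⟩ : ∃ m, m = 1 - θ := ⟨_, rfl⟩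
  obtain ⟨a, ha⟩ : ∃ a, a = 1 - β - θ / 2 := ⟨_, rfl⟩
  have hm0 : 0 < m := by linarith
  have ha0 : 0 < a := by linarith
  have ham : a < m := by linarith
  rw [rhoStarTheta_eq hm ha hm0 ha0] at h
  have hB : β - θ / 2 = m - a := by rw [hm, ha]; ring
  obtain ⟨q, hq⟩ : ∃ q, q = qStar θ β r := ⟨_, rfl⟩
  rw [← hq]
  suffices 0 < q ∧ max (√q - √r) 0 ^ 2 < a ∧ (m - q) / 2 < a - max (√q - √r) 0 ^ 2 by
    obtain ⟨h0, h1, h2⟩ := this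
    refine ⟨h0, ?_⟩
    rw [div_lt_iff₀ two_pos]
    exact max_lt (by linarith) (by linarith)
  rw [qStar, hB] at hq
  have ht0 : 0 < √r := Real.sqrt_pos.2 hr0
  have htr : √r ^ 2 = r := Real.sq_sqrt hr0.le
  have hN0 : 0 < √m := Real.sqrt_pos.2 hm0
  have hα0 : 0 < √a := Real.sqrt_pos.2 ha0
  have hNm : √m ^ 2 = m := Real.sq_sqrt hm0.le
  have hαa : √a ^ 2 = a := Real.sq_sqrt ha0.le
  by_cases hc : (m - a) / 3 < r
  · rw [if_pos hc] at hq
    have hx : √q = (m - a + r) / (2 * √r) := by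
      rw [hq, Real.sqrt_div (sq_nonneg _), Real.sqrt_sq (by linarith), Real.sqrt_mul (by norm_num),
        show √(4 : ℝ) = 2 by rw [show (4 : ℝ) = 2 ^ 2 by norm_num, Real.sqrt_sq two_pos.le]]
    have hxt : √q - √r = (m - a - r) / (2 * √r) := by
      rw [hx]; field_simp; rw [htr]; ring
    have hq0 : 0 < q := by rw [hq]; exact div_pos (pow_pos (by linarith) 2) (by linarith)
    refine ⟨hq0, ?_⟩
    rw [hxt]
    rcases le_or_gt (m - a) r with hr | hr
    · rw [max_eq_right (div_nonpos_of_nonpos_of_nonneg (by linarith) (by positivity))]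
      have : m - a ≤ q := by
        rw [hq, le_div_iff₀ (by linarith)]
        nlinarith [sq_nonneg (m - a - r)]
      constructor <;> nlinarith
    · have hw : max ((m - a - r) / (2 * √r)) 0 ^ 2 = q - (m - a) := by
        rw [max_eq_left (div_nonneg (by linarith) (by positivity)), hq, div_pow, mul_pow, htr]
        field_simp
        ring
      rw [hw]
      suffices q - (m - a) < a by constructor <;> linarith
      have hlt : √m - √a < √r := by
        by_cases hc' : m / 4 < a
        · have hαN : √m / 2 < √a := by
            apply lt_of_pow_lt_pow_left₀ 2 hα0.le
            rw [hαa, div_pow, hNm]; linarith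
          have hNα : √a < √m := Real.sqrt_lt_sqrt ha0.le ham
          apply lt_of_pow_lt_pow_left₀ 2 ht0.le
          rw [htr]
          nlinarith [mul_pos (sub_pos.2 hNα) (sub_pos.2 hαN)]
        · rw [if_neg hc'] at h
          apply lt_of_pow_lt_pow_left₀ 2 ht0.le
          rwa [htr]
      rw [← hw, max_eq_left (div_nonneg (by linarith) (by positivity)), ← hαa]
      apply pow_lt_pow_left₀ _ (div_nonneg (by rw [hαa]; linarith) (by positivity)) two_ne_zero
      rw [div_lt_iff₀ (by positivity)]
      have : √m ^ 2 < (√r + √a) ^ 2 := pow_lt_pow_left₀ (by linarith) hN0.le two_ne_zero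
      nlinarith
  · rw [if_neg hc] at hq
    have hx : √q = 2 * √r := by
      rw [hq, Real.sqrt_mul (by norm_num),
        show √(4 : ℝ) = 2 by rw [show (4 : ℝ) = 2 ^ 2 by norm_num, Real.sqrt_sq two_pos.le]]
    have hw : max (√q - √r) 0 ^ 2 = r := by
      rw [hx, max_eq_left (by linarith), two_mul, add_sub_cancel_right, htr]
    rw [hw, hq]
    by_cases hc' : m / 4 < a
    · rw [if_pos hc'] at h
      refine ⟨?_, ?_, ?_⟩ <;> linarith
    · rw [if_neg hc'] at h
      exfalso
      have hαN : √a ≤ √m / 2 := by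
        apply le_of_sq_le_sq _ (by positivity)
        rw [hαa, div_pow, hNm]; linarith
      nlinarith [mul_nonneg (show 0 ≤ √m - √a by linarith) (sub_nonneg.2 hαN)]

/-- The strict inequality of the strong phase leaves room for small perturbations. -/
lemma exists_margin_of_exponent_gt {θ β q w : ℝ}
    (h : max (1 - q) θ / 2 < 1 - β - w ^ 2) :
    ∃ κ > 0, max (1 - q + κ) θ / 2 < 1 - β - (w + κ) ^ 2 := by
  have hc : Continuous fun κ : ℝ => 1 - β - (w + κ) ^ 2 - max (1 - q + κ) θ / 2 := by fun_prop
  have h0 : 0 < 1 - β - (w + 0) ^ 2 - max (1 - q + 0) θ / 2 := by simp only [add_zero]; linarith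
  have := (hc.tendsto 0).eventually (lt_mem_nhds h0)
  obtain ⟨κ, h1, h2⟩ := ((this.filter_mono nhdsWithin_le_nhds).and
    (self_mem_nhdsWithin : Set.Ioi (0 : ℝ) ∈ nhdsWithin 0 (Set.Ioi 0))).exists
  exact ⟨κ, h2, by linarith⟩

/-- The strict inequality of the weak phase leaves room for small perturbations. -/
lemma exists_margin_of_exponent_lt {θ β q t : ℝ} (hθ0 : 0 < θ) (hq1 : q < 1)
    (hq0 : 0 < q) (h : 1 - β - max (√q - t) 0 ^ 2 < max (1 - q) θ / 2) :
    ∃ κ > 0, ∃ γ > 0, κ ≤ 1 ∧ √q + κ < 1 ∧ 1 - β - max (√q - t - 2 * κ) 0 ^ 2 + κ < γ ∧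
      γ < max (1 - (√q + κ) ^ 2) θ / 2 := by
  have h' : max (1 - β - max (√q - t) 0 ^ 2) 0 < max (1 - q) θ / 2 :=
    max_lt h (by linarith [le_max_right (1 - q) θ])
  obtain ⟨γ, hγ1, hγ2⟩ := exists_between h'
  have hx : √q ^ 2 = q := Real.sq_sqrt hq0.le
  have hx1 : √q < 1 := by rw [Real.sqrt_lt' one_pos]; linarith
  have c1 : Continuous fun κ : ℝ => γ - (1 - β - max (√q - t - 2 * κ) 0 ^ 2 + κ) := by fun_prop
  have c2 : Continuous fun κ : ℝ => max (1 - (√q + κ) ^ 2) θ / 2 - γ := by fun_prop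
  have h1 : 0 < γ - (1 - β - max (√q - t - 2 * 0) 0 ^ 2 + 0) := by
    simp only [add_zero, mul_zero, sub_zero]
    linarith [le_max_left (1 - β - max (√q - t) 0 ^ 2) 0]
  have h2 : 0 < max (1 - (√q + 0) ^ 2) θ / 2 - γ := by
    simp only [add_zero, hx]; linarith
  have e1 := (c1.tendsto 0).eventually (lt_mem_nhds h1)
  have e2 := (c2.tendsto 0).eventually (lt_mem_nhds h2)
  have e3 : ∀ᶠ κ : ℝ in nhds 0, κ < 1 - √q := gt_mem_nhds (by linarith)
  have e4 : ∀ᶠ κ : ℝ in nhds 0, κ < 1 := gt_mem_nhds one_pos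
  obtain ⟨κ, ⟨⟨⟨k1, k2⟩, k3⟩, k4⟩, k5⟩ := (((((e1.and e2).and e3).and e4).filter_mono
    nhdsWithin_le_nhds).and
    (self_mem_nhdsWithin : Set.Ioi (0 : ℝ) ∈ nhdsWithin 0 (Set.Ioi 0))).exists
  exact ⟨κ, k5, γ, lt_of_le_of_lt (le_max_right _ _) hγ1, k4.le, by linarith, by linarith,
    by linarith⟩

/-- Polynomial factors are negligible against stretched exponentials. -/
lemma tendsto_pow_mul_exp_neg {c x : ℝ} (hc : 0 < c) (hx : 0 < x) (k : ℕ) {f : ℕ → ℝ}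
    (hf : ∀ᶠ p : ℕ in atTop, c * (p : ℝ) ^ x ≤ f p) :
    Tendsto (fun p : ℕ => (p : ℝ) ^ k * Real.exp (-(f p))) atTop (nhds 0) := by
  have h1 : Tendsto (fun p : ℕ => (p : ℝ) ^ x) atTop atTop :=
    (tendsto_rpow_atTop hx).comp tendsto_natCast_atTop_atTop
  have h2 := (tendsto_rpow_mul_exp_neg_mul_atTop_nhds_zero (k / x) c hc).comp h1
  refine squeeze_zero' (Eventually.of_forall fun p => by positivity) ?_ h2
  filter_upwards [hf] with p hp
  have : ((p : ℝ) ^ x) ^ ((k : ℝ) / x) = (p : ℝ) ^ k := by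
    rw [← Real.rpow_mul (Nat.cast_nonneg p), mul_div_cancel₀ _ hx.ne', Real.rpow_natCast]
  simp only [Function.comp, this]
  gcongr
  linarith

lemma eventually_log_le {c x : ℝ} (hc : 0 < c) (hx : 0 < x) :
    ∀ᶠ p : ℕ in atTop, Real.log p ≤ c * (p : ℝ) ^ x := by
  have := (isLittleO_log_rpow_atTop hx).bound hc
  filter_upwards [tendsto_natCast_atTop_atTop.eventually this] with p hp
  rw [Real.norm_eq_abs, Real.norm_eq_abs, abs_of_nonneg (Real.rpow_nonneg (Nat.cast_nonneg p) x)]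
    at hp
  exact (le_abs_self _).trans hp

lemma tendsto_natCast_rpow_neg {x : ℝ} (hx : x < 0) :
    Tendsto (fun p : ℕ => (p : ℝ) ^ x) atTop (nhds 0) := by
  have := (tendsto_rpow_neg_atTop (y := -x) (by linarith)).comp
    (tendsto_natCast_atTop_atTop (R := ℝ))
  simpa [Function.comp_def] using this

lemma eventually_mul_rpow_le {x y : ℝ} (C : ℝ) (h : x < y) :
    ∀ᶠ p : ℕ in atTop, C * (p : ℝ) ^ x ≤ (p : ℝ) ^ y := by
  have h1 : Tendsto (fun p : ℕ => (p : ℝ) ^ (y - x)) atTop atTop :=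
    (tendsto_rpow_atTop (sub_pos.2 h)).comp tendsto_natCast_atTop_atTop
  filter_upwards [h1.eventually_ge_atTop C, eventually_gt_atTop 0] with p hp h0
  calc C * (p : ℝ) ^ x ≤ (p : ℝ) ^ (y - x) * (p : ℝ) ^ x := by gcongr
    _ = (p : ℝ) ^ y := by
      rw [← Real.rpow_add (by exact_mod_cast h0), sub_add_cancel]

lemma tendsto_log_natCast : Tendsto (fun p : ℕ => Real.log p) atTop atTop :=
  Real.tendsto_log_atTop.comp tendsto_natCast_atTop_atTop

lemma rpow_le_nDim (p : ℕ) (θ : ℝ) : (p : ℝ) ^ θ ≤ nDim p θ := Nat.le_ceil _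

lemma nDim_le_add_one (p : ℕ) (θ : ℝ) : (nDim p θ : ℝ) ≤ (p : ℝ) ^ θ + 1 :=
  (Nat.ceil_lt_add_one (Real.rpow_nonneg (Nat.cast_nonneg p) θ)).le

lemma nDim_le {p : ℕ} {θ : ℝ} (hp : 0 < p) (hθ1 : θ ≤ 1) : nDim p θ ≤ p := by
  rw [nDim, Nat.ceil_le]
  calc (p : ℝ) ^ θ ≤ (p : ℝ) ^ (1 : ℝ) :=
        Real.rpow_le_rpow_of_exponent_le (by exact_mod_cast hp) hθ1
    _ = p := Real.rpow_one _

lemma tendsto_nDim {θ : ℝ} (hθ0 : 0 < θ) : Tendsto (fun p : ℕ => nDim p θ) atTop atTop :=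
  tendsto_nat_ceil_atTop.comp ((tendsto_rpow_atTop hθ0).comp tendsto_natCast_atTop_atTop)

/-- The moderate deviation rate `√(log p / n)`. -/
noncomputable def rate (p n : ℕ) : ℝ := √(Real.log p / n)

lemma rate_nonneg (p n : ℕ) : 0 ≤ rate p n := Real.sqrt_nonneg _

lemma mul_rate_sq {p n : ℕ} (hp : 0 < p) (hn : 0 < n) : n * rate p n ^ 2 = Real.log p := by
  have : 0 ≤ Real.log p := Real.log_nonneg (by exact_mod_cast hp)
  rw [rate, Real.sq_sqrt (by positivity)]
  field_simp

lemma mul_rate {p n : ℕ} (hp : 0 < p) (hn : 0 < n) : n * rate p n = √n * √(Real.log p) := by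
  have h0 : 0 ≤ Real.log p := Real.log_nonneg (by exact_mod_cast hp)
  have h1 : (0 : ℝ) < √n := Real.sqrt_pos.2 (by exact_mod_cast hn)
  rw [rate, Real.sqrt_div h0]
  nth_rewrite 1 [← Real.mul_self_sqrt (Nat.cast_nonneg (α := ℝ) n)]
  field_simp

lemma tendsto_rate {θ : ℝ} (hθ0 : 0 < θ) :
    Tendsto (fun p : ℕ => rate p (nDim p θ)) atTop (nhds 0) := by
  have h1 : Tendsto (fun p : ℕ => Real.log p / (nDim p θ : ℝ)) atTop (nhds 0) := by
    refine squeeze_zero' (g := fun p : ℕ => (p : ℝ) ^ (-(θ / 2))) ?_ ?_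
      (tendsto_natCast_rpow_neg (by linarith))
    · filter_upwards [eventually_gt_atTop 0] with p hp
      exact div_nonneg (Real.log_nonneg (by exact_mod_cast hp)) (Nat.cast_nonneg _)
    · filter_upwards [eventually_log_le one_pos (half_pos hθ0), eventually_gt_atTop 0] with p h hp
      have hp' : (0 : ℝ) < p := by exact_mod_cast hp
      have hn : (0 : ℝ) < nDim p θ := (Real.rpow_pos_of_pos hp' θ).trans_le (rpow_le_nDim p θ)
      rw [div_le_iff₀ hn]
      calc Real.log p ≤ (p : ℝ) ^ (-(θ / 2)) * (p : ℝ) ^ θ := by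
            rw [← Real.rpow_add hp', show -(θ / 2) + θ = θ / 2 by ring]; linarith
        _ ≤ _ := by gcongr; exact rpow_le_nDim p θ
  have := h1.sqrt
  rwa [Real.sqrt_zero] at this

lemma tauStar_pos {p : ℕ} {θ r : ℝ} (hp : 1 < p) (hr : 0 < r) : 0 < tauStar p θ r := by
  have hp' : (1 : ℝ) < p := by exact_mod_cast hp
  have := Real.log_pos hp'
  rw [tauStar]
  positivity

lemma tauStar_sq {p : ℕ} {θ r : ℝ} (hp : 0 < p) (hr : 0 ≤ r) :
    tauStar p θ r ^ 2 = (p : ℝ) ^ (-(θ / 2)) * (2 * √r * √(Real.log p)) := by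
  have h0 : 0 ≤ Real.log p := Real.log_nonneg (by exact_mod_cast hp)
  have h4 : √(4 : ℝ) = 2 := by rw [show (4 : ℝ) = 2 ^ 2 by norm_num, Real.sqrt_sq two_pos.le]
  rw [tauStar, mul_pow, ← Real.rpow_natCast, ← Real.rpow_mul (Nat.cast_nonneg p),
    ← Real.rpow_natCast, ← Real.rpow_mul (by positivity)]
  congr 1
  · congr 1; push_cast; ring
  · rw [show (1 : ℝ) / 4 * (2 : ℕ) = 1 / 2 by norm_num, ← Real.sqrt_eq_rpow,
      Real.sqrt_mul (by positivity), Real.sqrt_mul (by norm_num), h4]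

lemma signal_sq {p n : ℕ} {θ r : ℝ} (hp : 0 < p) (hn : 0 < n) (hr : 0 ≤ r) :
    (tauStar p θ r * √n) ^ 2 =
      2 * (√r * √((p : ℝ) ^ (-θ) * n)) * (n * rate p n) := by
  have hp' : (0 : ℝ) < p := by exact_mod_cast hp
  have h1 : √((p : ℝ) ^ (-θ)) = (p : ℝ) ^ (-(θ / 2)) := by
    rw [Real.sqrt_eq_rpow, ← Real.rpow_mul hp'.le]; congr 1; ring
  rw [mul_pow, tauStar_sq hp hr, mul_rate hp hn, Real.sqrt_mul (by positivity), h1]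
  have h2 : √(n : ℝ) ^ 2 = √n * √n := sq _
  rw [h2]
  ring

lemma le_signal_sq {p : ℕ} {θ r : ℝ} (hp : 0 < p) (hn : 0 < nDim p θ) (hr : 0 ≤ r) :
    2 * √r * (nDim p θ * rate p (nDim p θ)) ≤ (tauStar p θ r * √(nDim p θ)) ^ 2 := by
  have hp' : (0 : ℝ) < p := by exact_mod_cast hp
  rw [signal_sq hp hn hr]
  have : 1 ≤ √((p : ℝ) ^ (-θ) * nDim p θ) := by
    rw [Real.one_le_sqrt, Real.rpow_neg hp'.le, ← div_eq_inv_mul,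
      one_le_div (by positivity)]
    exact rpow_le_nDim p θ
  have h0 := rate_nonneg p (nDim p θ)
  have h1 : √r ≤ √r * √((p : ℝ) ^ (-θ) * nDim p θ) := le_mul_of_one_le_right (by positivity) this
  gcongr

lemma eventually_signal_sq_le {θ r κ : ℝ} (hθ0 : 0 < θ) (hr : 0 ≤ r) (hκ : 0 < κ) :
    ∀ᶠ p : ℕ in atTop, (tauStar p θ r * √(nDim p θ)) ^ 2 ≤
      2 * (√r + κ) * (nDim p θ * rate p (nDim p θ)) := by
  have h1 : Tendsto (fun p : ℕ => √r * √(1 + (p : ℝ) ^ (-θ))) atTop (nhds (√r * √(1 + 0))) :=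
    (((tendsto_natCast_rpow_neg (by linarith)).const_add 1).sqrt).const_mul _
  have h2 : ∀ᶠ p : ℕ in atTop, √r * √(1 + (p : ℝ) ^ (-θ)) < √r + κ :=
    h1.eventually (gt_mem_nhds (by simp [hκ]))
  filter_upwards [h2, eventually_gt_atTop 0, (tendsto_nDim hθ0).eventually_gt_atTop 0]
    with p h hp hn
  have hp' : (0 : ℝ) < p := by exact_mod_cast hp
  rw [signal_sq hp hn hr]
  have h0 := rate_nonneg p (nDim p θ)
  have h3 : √((p : ℝ) ^ (-θ) * nDim p θ) ≤ √(1 + (p : ℝ) ^ (-θ)) := by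
    apply Real.sqrt_le_sqrt
    calc (p : ℝ) ^ (-θ) * nDim p θ ≤ (p : ℝ) ^ (-θ) * ((p : ℝ) ^ θ + 1) := by
          gcongr; exact nDim_le_add_one p θ
      _ = 1 + (p : ℝ) ^ (-θ) := by
          rw [mul_add, ← Real.rpow_add hp', neg_add_cancel, Real.rpow_zero, mul_one]
  have h4 : √r * √((p : ℝ) ^ (-θ) * nDim p θ) ≤ √r + κ :=
    (mul_le_mul_of_nonneg_left h3 (by positivity)).trans h.le
  gcongr

lemma eventually_tauStar_le {θ r κ : ℝ} (hθ0 : 0 < θ) (hr : 0 < r) (hκ : 0 < κ) :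
    ∀ᶠ p : ℕ in atTop, 2 * tauStar p θ r ≤ κ := by
  have hc : 0 < (κ / 2) ^ 4 / (4 * r) := by positivity
  filter_upwards [eventually_log_le hc hθ0, eventually_gt_atTop 1] with p h hp
  have hp' : (0 : ℝ) < p := by exact_mod_cast one_pos.trans hp
  have h0 : 0 ≤ Real.log p := Real.log_nonneg (by exact_mod_cast hp.le)
  have : tauStar p θ r ^ 4 ≤ (κ / 2) ^ 4 := by
    rw [tauStar, mul_pow, ← Real.rpow_natCast, ← Real.rpow_mul hp'.le,
      ← Real.rpow_natCast ((4 * r * Real.log p) ^ ((1 : ℝ) / 4)), ← Real.rpow_mul (by positivity)]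
    norm_num
    rw [Real.rpow_neg hp'.le, inv_mul_le_iff₀ (by positivity)]
    calc 4 * r * Real.log p ≤ 4 * r * ((κ / 2) ^ 4 / (4 * r) * (p : ℝ) ^ θ) := by gcongr
      _ = _ := by field_simp
  have := le_of_pow_le_pow_left₀ (by norm_num) (by positivity) this
  linarith

/-- The screening threshold in terms of the rate. -/
lemma threshold_eq {p n : ℕ} (hp : 0 < p) (hn : 0 < n) {q : ℝ} (hq : 0 ≤ q) :
    (n : ℝ) + √(2 * n) * √(2 * q * Real.log p) = n + 2 * √q * (n * rate p n) := by
  have h2 : √(2 : ℝ) * √2 = 2 := Real.mul_self_sqrt two_pos.le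
  rw [mul_rate hp hn, Real.sqrt_mul two_pos.le, Real.sqrt_mul (by positivity),
    Real.sqrt_mul two_pos.le]
  linear_combination (√n * √q * √(Real.log p)) * h2

lemma exp_neg_mul_log {p : ℕ} (hp : 0 < p) (x : ℝ) :
    Real.exp (-(x * Real.log p)) = (p : ℝ) ^ (-x) := by
  rw [Real.rpow_def_of_pos (by exact_mod_cast hp)]; congr 1; ring

lemma isProbabilityMeasure_jointLaw {n p : ℕ} {ε τ : ℝ} (h0 : 0 ≤ ε) (h1 : ε ≤ 1) :
    IsProbabilityMeasure (jointLaw n p ε τ) := by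
  have := isProbabilityMeasure_muLaw (τ := τ) h0 h1
  have h2 : IsProbabilityMeasure signLaw := inferInstance
  have h3 : IsProbabilityMeasure (noiseLaw n p) := by rw [noiseLaw]; infer_instance
  rw [jointLaw]
  infer_instance

/-- Transfer of a bound on the bad event for the columns to the joint law. -/
lemma one_sub_le_toReal_jointLaw {n p : ℕ} {ε τ : ℝ} (hn : 0 < n) (h0 : 0 ≤ ε)
    (h1 : ε ≤ 1) {q η : ℝ} (hη : 0 ≤ η) {ξsel : (Fin n → Fin p → ℝ) → Fin n → ℝ}
    (hξ : ∀ X, IsTopEigenvector (gramSel q X) (ξsel X)) (P : ℝ → Prop)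
    (hB : ∀ u : Euc n, ‖u‖ = 1 → Measure.pi (fun _ : Fin p => colLaw n ε τ)
      {y | ∃ ξ lam, TopEig (selIdx u (n + √(2 * n) * √(2 * q * Real.log p)) y)
        (fun j => colVec u (y j)) ξ lam ∧ ¬ P |inner ℝ u ξ|} ≤ ENNReal.ofReal η) :
    1 - η ≤ ((jointLaw n p ε τ) {ω | P (cosv (ξsel (dataMap ω)) ω.1)}).toReal := by
  have hprob := isProbabilityMeasure_jointLaw (n := n) (p := p) (τ := τ) h0 h1
  have hbad := jointLaw_le_of_forall h0 h1 (η := ENNReal.ofReal η) (n := n) (p := p) (τ := τ)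
    (fun ℓ => {y | ∃ ξ, IsTopEigenvector (gramSel q (fun i j => ℓ i * (y j).1 + (y j).2 i)) ξ ∧
      ¬ P (cosv ξ ℓ)}) (by
    intro ℓ hℓ
    refine (measure_mono ?_).trans
      (hB ((√n)⁻¹ • (WithLp.toLp 2 ℓ : Euc n)) (norm_label hn hℓ))
    rintro y ⟨ξ, hξ1, hξ2⟩
    obtain ⟨lam, h2, h3⟩ := exists_topEig_of_gramSel hn hℓ rfl hξ1
    exact ⟨_, lam, h2, by rwa [← h3]⟩)
  set good : Set (Omega n p) := {ω | P (cosv (ξsel (dataMap ω)) ω.1)}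
  have hcov : (1 : ℝ≥0∞) ≤ jointLaw n p ε τ good + ENNReal.ofReal η := by
    rw [← measure_univ (μ := jointLaw n p ε τ)]
    refine (measure_mono (t := good ∪ goodᶜ) (by simp)).trans
      ((measure_union_le _ _).trans (add_le_add_right ((measure_mono ?_).trans hbad) _))
    intro ω hω
    exact ⟨ξsel (dataMap ω), hξ _, hω⟩
  have := ENNReal.toReal_mono (by finiteness) hcov
  rw [ENNReal.toReal_add (measure_ne_top _ _) (by finiteness), ENNReal.toReal_ofReal hη,
    ENNReal.toReal_one] at this
  linarith

/-- A bound on the error of the leading eigenvector in terms of the moderate deviation rate. -/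
lemma error_le_of_signal {n p : ℕ} {m M b t : ℝ} (hn : 0 < n) (hp : 0 < p)
    (hL : 1 ≤ Real.log p) (hm : 0 ≤ m) (hM : 0 < M) (ht : 0 < t)
    (hb : 2 * t * (n * rate p n) ≤ b ^ 2) :
    2 * (25600 * √(n * (m + n)) / (M * b ^ 2) + (960 * n / M + 32 * Real.log p) / b ^ 2 +
      2 * √((960 * n / M + 32 * Real.log p) / b ^ 2)) ≤
    2 * (12800 / t * (√(m + n) / M) + (480 / t * (√(m + n) / M) + 16 / t * rate p n) +
      2 * √(480 / t * (√(m + n) / M) + 16 / t * rate p n)) := by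
  have hn' : (0 : ℝ) < n := by exact_mod_cast hn
  have hr : 0 < rate p n := Real.sqrt_pos.2 (div_pos (by linarith) hn')
  have hsn : 0 < √(n : ℝ) := Real.sqrt_pos.2 hn'
  have hsL : 1 ≤ √(Real.log p) := Real.one_le_sqrt.2 hL
  have hb0 : 0 < b ^ 2 := lt_of_lt_of_le (by positivity) hb
  have hb1 : 2 * t * √n ≤ b ^ 2 := by
    refine le_trans ?_ hb
    rw [mul_rate hp hn]
    have : √(n : ℝ) ≤ √n * √(Real.log p) := le_mul_of_one_le_right hsn.le hsL
    gcongr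
  have h1 : 25600 * √(n * (m + n)) / (M * b ^ 2) ≤ 12800 / t * (√(m + n) / M) := by
    rw [Real.sqrt_mul hn'.le]
    calc 25600 * (√n * √(m + n)) / (M * b ^ 2)
        ≤ 25600 * (√n * √(m + n)) / (M * (2 * t * √n)) := by gcongr
      _ = 12800 / t * (√(m + n) / M) := by field_simp; norm_num
  have h2 : 960 * n / M / b ^ 2 ≤ 480 / t * (√(m + n) / M) := by
    calc 960 * n / M / b ^ 2 ≤ 960 * n / M / (2 * t * √n) := by gcongr
      _ = 960 * (√n * √n) / M / (2 * t * √n) := by rw [Real.mul_self_sqrt hn'.le]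
      _ = 480 / t * (√n / M) := by field_simp; norm_num
      _ ≤ 480 / t * (√(m + n) / M) := by gcongr; linarith
  have h3 : 32 * Real.log p / b ^ 2 ≤ 16 / t * rate p n := by
    calc 32 * Real.log p / b ^ 2 ≤ 32 * Real.log p / (2 * t * (n * rate p n)) := by
          gcongr
      _ = 32 * (n * rate p n ^ 2) / (2 * t * (n * rate p n)) := by rw [mul_rate_sq hp hn]
      _ = 16 / t * rate p n := by field_simp; norm_num
  have h4 : (960 * n / M + 32 * Real.log p) / b ^ 2 ≤
      480 / t * (√(m + n) / M) + 16 / t * rate p n := by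
    rw [add_div]; exact add_le_add h2 h3
  gcongr

/-- The noise is negligible in comparison with the useful selected features. -/
lemma tendsto_noise_ratio {θ q κ W : ℝ} (hθ0 : 0 < θ) (h : max (1 - q + κ) θ / 2 < W) :
    Tendsto (fun p : ℕ => √((p : ℝ) ^ (1 - q + κ) + nDim p θ) / ((p : ℝ) ^ W / 4)) atTop
      (nhds 0) := by
  set Y := max (1 - q + κ) θ
  have hY : 0 < Y := lt_of_lt_of_le hθ0 (le_max_right _ _)
  have h0 := (tendsto_natCast_rpow_neg (sub_neg.2 h)).const_mul 8
  rw [mul_zero] at h0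
  refine squeeze_zero' (Eventually.of_forall fun p => by positivity) ?_ h0
  filter_upwards [eventually_gt_atTop 0] with p hp
  have hp' : (0 : ℝ) < p := by exact_mod_cast hp
  have hp1 : (1 : ℝ) ≤ p := by exact_mod_cast hp
  have h1 : (p : ℝ) ^ (1 - q + κ) ≤ (p : ℝ) ^ Y :=
    Real.rpow_le_rpow_of_exponent_le hp1 (le_max_left _ _)
  have h2 : (p : ℝ) ^ θ ≤ (p : ℝ) ^ Y := Real.rpow_le_rpow_of_exponent_le hp1 (le_max_right _ _)
  have h3 : 1 ≤ (p : ℝ) ^ Y := Real.one_le_rpow hp1 hY.le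
  have h4 := nDim_le_add_one p θ
  have h5 : √((p : ℝ) ^ (1 - q + κ) + nDim p θ) ≤ 2 * (p : ℝ) ^ (Y / 2) := by
    apply Real.sqrt_le_iff.2 ⟨by positivity, ?_⟩
    rw [mul_pow, ← Real.rpow_natCast ((p : ℝ) ^ (Y / 2)), ← Real.rpow_mul hp'.le]
    norm_num
    linarith
  rw [Real.rpow_sub hp', div_le_iff₀ (by positivity)]
  refine h5.trans (le_of_eq ?_)
  field_simp
  norm_num

/-- In the strong phase, the leading left singular vector is consistent. -/
lemma tendsto_cosv_of_exponent_gt {θ β r q : ℝ} (hθ0 : 0 < θ) (hβ0 : 0 < β)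
    (hr0 : 0 < r) (hq0 : 0 < q)
    (h : max (1 - q) θ / 2 < 1 - β - max (√q - √r) 0 ^ 2)
    (ξsel : (p : ℕ) → (Fin (nDim p θ) → Fin p → ℝ) → Fin (nDim p θ) → ℝ)
    (hξ : ∀ p : ℕ, 1 ≤ p → ∀ X, IsTopEigenvector (gramSel q X) (ξsel p X)) :
    ∃ δ η : ℕ → ℝ,
      Tendsto δ atTop (nhds 0) ∧
      Tendsto (fun p : ℕ => (p : ℝ) ^ 2 * η p) atTop (nhds 0) ∧
      ∀ᶠ p : ℕ in atTop,
        1 - η p ≤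
          ((jointLaw (nDim p θ) p ((p : ℝ) ^ (-β)) (tauStar p θ r))
            {ω | 1 - δ p ≤ cosv (ξsel p (dataMap ω)) ω.1}).toReal := by
  obtain ⟨κ, hκ, hW⟩ := exists_margin_of_exponent_gt h
  set w := max (√q - √r) 0
  set W := 1 - β - (w + κ) ^ 2
  have hw0 : 0 ≤ w := le_max_right _ _
  have ht : 0 < √r := Real.sqrt_pos.2 hr0
  have hW0 : 0 < W := by linarith [le_max_right (1 - q + κ) θ]
  let A : ℕ → ℝ := fun p => √((p : ℝ) ^ (1 - q + κ) + nDim p θ) / ((p : ℝ) ^ W / 4)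
  let B : ℕ → ℝ := fun p => 480 / √r * A p + 16 / √r * rate p (nDim p θ)
  have hA : Tendsto A atTop (nhds 0) := tendsto_noise_ratio hθ0 hW
  have hB : Tendsto B atTop (nhds 0) := by
    have := (hA.const_mul (480 / √r)).add ((tendsto_rate hθ0).const_mul (16 / √r))
    simpa using this
  refine ⟨fun p => 2 * (12800 / √r * A p + B p + 2 * √(B p)),
    fun p => 2 * Real.exp (-(nDim p θ)) + p * Real.exp (-(nDim p θ / 8)) +
      Real.exp (-((p : ℝ) ^ W / 4 / 4)), ?_, ?_, ?_⟩
  · have := ((hA.const_mul (12800 / √r)).add hB).add (hB.sqrt.const_mul 2) |>.const_mul 2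
    simpa using this
  · have e1 := tendsto_pow_mul_exp_neg (c := 1) one_pos hθ0 2
      (f := fun p => (nDim p θ : ℝ)) (Eventually.of_forall fun p => by
        rw [one_mul]; exact rpow_le_nDim p θ)
    have e2 := tendsto_pow_mul_exp_neg (c := 1 / 8) (by norm_num) hθ0 3
      (f := fun p => (nDim p θ / 8 : ℝ)) (Eventually.of_forall fun p => by
        linarith [rpow_le_nDim p θ])
    have e3 := tendsto_pow_mul_exp_neg (c := 1 / 16) (by norm_num) hW0 2
      (f := fun p => ((p : ℝ) ^ W / 4 / 4)) (Eventually.of_forall fun p => by linarith)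
    have := ((e1.const_mul 2).add e2).add e3
    simp only [mul_zero, add_zero] at this
    refine this.congr fun p => ?_
    ring
  · have hϱ := tendsto_rate hθ0
    have f1 : ∀ᶠ p : ℕ in atTop, √q * rate p (nDim p θ) ≤ 1 / 4 := by
      have := hϱ.const_mul √q
      rw [mul_zero] at this
      exact this.eventually (ge_mem_nhds (by norm_num))
    have f2 : ∀ᶠ p : ℕ in atTop, 8 * √q ^ 3 * rate p (nDim p θ) ≤ κ := by
      have := hϱ.const_mul (8 * √q ^ 3)
      rw [mul_zero] at this
      exact this.eventually (ge_mem_nhds hκ)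
    have f3 : ∀ᶠ p : ℕ in atTop, (w + κ) * rate p (nDim p θ) ≤ 1 / 4 := by
      have := hϱ.const_mul (w + κ)
      rw [mul_zero] at this
      exact this.eventually (ge_mem_nhds (by norm_num))
    have f4 : ∀ᶠ p : ℕ in atTop, 8 * (w + κ) ^ 3 * rate p (nDim p θ) ≤ κ ^ 2 / 16 := by
      have := hϱ.const_mul (8 * (w + κ) ^ 3)
      rw [mul_zero] at this
      exact this.eventually (ge_mem_nhds (by positivity))
    filter_upwards [f1, f2, f3, f4, eventually_gt_atTop 1, (tendsto_nDim hθ0).eventually_ge_atTop 4,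
      tendsto_log_natCast.eventually_ge_atTop 1,
      (tendsto_log_natCast.const_mul_atTop (pow_pos hκ 2)).eventually_ge_atTop 12]
      with p f1 f2 f3 f4 hp hn hL1 hL
    have hp0 : 0 < p := one_pos.trans hp
    have hn0 : 0 < nDim p θ := by omega
    have hp' : (0 : ℝ) < p := by exact_mod_cast hp0
    have hsig := le_signal_sq (θ := θ) hp0 hn0 hr0.le
    have hτ : 0 < tauStar p θ r := tauStar_pos hp hr0
    refine one_sub_le_toReal_jointLaw hn0 (Real.rpow_nonneg hp'.le _)
      (Real.rpow_le_one_of_one_le_of_nonpos (by exact_mod_cast hp0) (by linarith)) (by positivity)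
      (hξ p hp0) (fun x => 1 - _ ≤ x) fun u hu => ?_
    simp only [not_le]
    rw [threshold_eq hp0 hn0 hq0.le]
    refine measure_topEig_lt_le hn hp0 (Real.rpow_nonneg hp'.le _)
      (Real.rpow_le_one_of_one_le_of_nonpos (by exact_mod_cast hp0) (by linarith)) hτ hu
      (m := (p : ℝ) ^ (1 - q + κ)) (M := (p : ℝ) ^ W / 4) ?_ ?_ (by positivity) ?_ rfl rfl ?_
    · have := rate_nonneg p (nDim p θ)
      have : 0 ≤ 2 * √q * (nDim p θ * rate p (nDim p θ)) := by positivity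
      linarith
    · have := integral_window_le (n := nDim p θ) (Real.sqrt_nonneg q)
        (rate_nonneg p (nDim p θ)) f1 f2
      rw [mul_rate_sq hp0 hn0, exp_neg_mul_log hp0, Real.sq_sqrt hq0.le] at this
      calc _ ≤ (p : ℝ) * (p : ℝ) ^ (-(q - κ)) := by gcongr
        _ = (p : ℝ) ^ (1 - q + κ) := by
          nth_rewrite 1 [← Real.rpow_one (p : ℝ)]
          rw [← Real.rpow_add hp']
          congr 1
          ring
    · have := le_measureReal_colVec hu hw0 (le_max_left (√q - √r) 0) hκ (rate_nonneg p (nDim p θ))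
        f3 f4 (by rwa [mul_rate_sq hp0 hn0]) hτ.le hsig
      rw [mul_rate_sq hp0 hn0, exp_neg_mul_log hp0] at this
      calc (p : ℝ) ^ W / 4 = p * ((p : ℝ) ^ (-β) * ((p : ℝ) ^ (-(w + κ) ^ 2) / 4)) := by
            rw [← mul_div_assoc, ← mul_div_assoc, ← Real.rpow_add hp']
            nth_rewrite 2 [← Real.rpow_one (p : ℝ)]
            rw [← Real.rpow_add hp']
            congr 2
            ring
        _ ≤ _ := by gcongr
    · exact error_le_of_signal hn0 hp0 hL1 (by positivity) (by positivity) ht hsig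

lemma mul_le_of_sq_log_le {n T L b Y : ℝ} (hn : 0 ≤ n) (hT : 0 ≤ T) (hL : 0 ≤ L) (hY : 0 ≤ Y)
    (hb : b ^ 2 ≤ 4 * √(n * L)) (h : 16 * (T ^ 2 * L) * n ≤ Y ^ 2) : T * b ^ 2 ≤ Y := by
  refine (mul_le_mul_of_nonneg_left hb hT).trans ?_
  apply le_of_sq_le_sq _ hY
  rw [mul_pow, mul_pow, Real.sq_sqrt (by positivity)]
  linarith

lemma signal_bounds_of_fat {n m T L b : ℝ} (hn : 1 ≤ n) (hT : 0 < T) (hL : 1 ≤ L)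
    (hb : b ^ 2 ≤ 4 * √(n * L)) (hm : 10 ^ 9 * (T * L) ^ 2 ≤ 1000 * m) :
    L * T ≤ √(n * m) ∧ T * b ^ 2 ≤ √(n * m) := by
  have h0 : 0 < (T * L) ^ 2 := by positivity
  have hTL : T ^ 2 * L ≤ (T * L) ^ 2 := by
    rw [mul_pow]
    exact mul_le_mul_of_nonneg_left (by nlinarith) (sq_nonneg T)
  have hm0 : 0 ≤ m := by linarith
  constructor
  · apply Real.le_sqrt_of_sq_le
    rw [mul_comm L T]
    nlinarith
  · refine mul_le_of_sq_log_le (by linarith) hT.le (by linarith) (Real.sqrt_nonneg _) hb ?_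
    rw [Real.sq_sqrt (by positivity), mul_comm]
    exact mul_le_mul_of_nonneg_left (by linarith) (by linarith)

lemma signal_bounds_of_skinny {n T L b : ℝ} (hn : 1 ≤ n) (hT : 0 < T) (hL : 1 ≤ L)
    (hb : b ^ 2 ≤ 4 * √(n * L)) (hm : 10 ^ 9 * (T * L) ^ 2 ≤ n) :
    8 * L * T ≤ n / 100 ∧ T * b ^ 2 ≤ n / 100 := by
  have h0 : 0 < (T * L) ^ 2 := by positivity
  have hTL : T ^ 2 * L ≤ (T * L) ^ 2 := by
    rw [mul_pow]
    exact mul_le_mul_of_nonneg_left (by nlinarith) (sq_nonneg T)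
  constructor
  · apply le_of_sq_le_sq _ (by positivity)
    rw [show 8 * L * T = 8 * (T * L) by ring]
    nlinarith
  · refine mul_le_of_sq_log_le (by linarith) hT.le (by linarith) (by positivity) hb ?_
    rw [show (n / 100) ^ 2 = n / 10000 * n by ring]
    exact mul_le_mul_of_nonneg_right (by linarith) (by linarith)

set_option maxHeartbeats 1000000 in
/-- In the weak phase, the leading left singular vector stays away from the labels. -/
lemma tendsto_cosv_of_exponent_lt {θ β r q c0 : ℝ} (hθ0 : 0 < θ) (hθ1 : θ < 1) (hβ0 : 0 < β)
    (hr0 : 0 < r) (hr1 : r < 1) (hq0 : 0 < q) (hq1 : q < 1)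
    (h : 1 - β - max (√q - √r) 0 ^ 2 < max (1 - q) θ / 2) (hc0 : 0 ≤ c0)
    (hc : 800 * 220300 ^ 2 / (1 + 800 * 220300 ^ 2) ≤ c0 ^ 2)
    (ξsel : (p : ℕ) → (Fin (nDim p θ) → Fin p → ℝ) → Fin (nDim p θ) → ℝ)
    (hξ : ∀ p : ℕ, 1 ≤ p → ∀ X, IsTopEigenvector (gramSel q X) (ξsel p X)) :
    ∃ η : ℕ → ℝ,
      Tendsto (fun p : ℕ => (nDim p θ : ℝ) * η p) atTop (nhds 0) ∧
      ∀ᶠ p : ℕ in atTop,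
        1 - η p ≤
          ((jointLaw (nDim p θ) p ((p : ℝ) ^ (-β)) (tauStar p θ r))
            {ω | cosv (ξsel p (dataMap ω)) ω.1 ≤ c0}).toReal := by
  obtain ⟨κ, hκ, γ, hγ0, hκ1, hqκ, hMT, hTX⟩ := exists_margin_of_exponent_lt hθ0 hq1 hq0 h
  have hs : √q ^ 2 = q := Real.sq_sqrt hq0.le
  have hs0 : 0 ≤ √q := Real.sqrt_nonneg q
  have ht0 : 0 ≤ √r := Real.sqrt_nonneg r
  have ht1 : √r ≤ 1 := Real.sqrt_le_one.2 hr1.le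
  obtain ⟨w, hw⟩ : ∃ w, w = max (√q - √r - 2 * κ) 0 := ⟨_, rfl⟩
  have hw0 : 0 ≤ w := hw ▸ le_max_right _ _
  have hwq : w ≤ √q := hw ▸ max_le (by linarith) hs0
  have hw2 : w ^ 2 - κ ≤ 2 := by nlinarith
  rw [← hw] at hMT
  set W := 1 - β - w ^ 2 + κ with hWdef
  obtain ⟨G, hG⟩ : ∃ G, G = 1 - (√q + κ) ^ 2 := ⟨_, rfl⟩
  rw [← hG] at hTX
  have hG0 : 0 < G := by nlinarith
  let e1 : ℕ → ℝ := fun p => 2 * Real.exp (-(nDim p θ)) + p * Real.exp (-(nDim p θ / 8))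
  let e2 : ℕ → ℝ := fun p => 5 * Real.exp (-(nDim p θ / 10 ^ 16)) +
    Real.exp (-((p : ℝ) ^ γ / 2))
  let e3 : ℕ → ℝ := fun p => Real.exp (-(nDim p θ / 300)) +
    Real.exp 2 * Real.exp (-(nDim p θ / 800)) + Real.exp (-((p : ℝ) ^ G / 2 / 8))
  refine ⟨fun p => e1 p + e2 p + e3 p, ?_, ?_⟩
  · have t (c : ℝ) (hc : 0 < c) (k : ℕ) := tendsto_pow_mul_exp_neg (one_div_pos.2 hc) hθ0 k
      (f := fun p => (nDim p θ / c : ℝ)) (Eventually.of_forall fun p => by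
        rw [div_mul_eq_mul_div, one_mul]
        exact div_le_div_of_nonneg_right (rpow_le_nDim p θ) hc.le)
    have t1 := t 1 (by norm_num) 1
    have t2 := t 8 (by norm_num) 2
    have t3 := t (10 ^ 16) (by norm_num) 1
    have t4 := t 300 (by norm_num) 1
    have t5 := t 800 (by norm_num) 1
    have t6 := tendsto_pow_mul_exp_neg (c := 1 / 2) (by norm_num) hγ0 1
      (f := fun p => (p : ℝ) ^ γ / 2) (Eventually.of_forall fun p => by linarith)
    have t7 := tendsto_pow_mul_exp_neg (c := 1 / 16) (by norm_num) hG0 1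
      (f := fun p => (p : ℝ) ^ G / 2 / 8) (Eventually.of_forall fun p => by linarith)
    have t8 := (((t1.const_mul 2).add t2).add ((t3.const_mul 5).add t6)).add
      ((t4.add (t5.const_mul (Real.exp 2))).add t7)
    simp only [mul_zero, add_zero] at t8
    refine squeeze_zero' (Eventually.of_forall fun p => by positivity) ?_ t8
    filter_upwards [eventually_gt_atTop 0] with p hp
    have hnp : (nDim p θ : ℝ) ≤ p := by exact_mod_cast nDim_le hp hθ1.le
    calc (nDim p θ : ℝ) * (e1 p + e2 p + e3 p) ≤ p * (e1 p + e2 p + e3 p) := by gcongr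
      _ = _ := by simp only [e1, e2, e3, pow_one, div_one]; ring
  · have hϱ := tendsto_rate hθ0
    have f1 : ∀ᶠ p : ℕ in atTop, (√q + κ) * rate p (nDim p θ) ≤ 1 / 4 := by
      have := hϱ.const_mul (√q + κ)
      rw [mul_zero] at this
      exact this.eventually (ge_mem_nhds (by norm_num))
    have f2 : ∀ᶠ p : ℕ in atTop, 8 * (√q + κ) ^ 3 * rate p (nDim p θ) ≤ κ ^ 2 / 16 := by
      have := hϱ.const_mul (8 * (√q + κ) ^ 3)
      rw [mul_zero] at this
      exact this.eventually (ge_mem_nhds (by positivity))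
    have f3 : ∀ᶠ p : ℕ in atTop, w * rate p (nDim p θ) ≤ 1 / 4 := by
      have := hϱ.const_mul w
      rw [mul_zero] at this
      exact this.eventually (ge_mem_nhds (by norm_num))
    have f4 : ∀ᶠ p : ℕ in atTop, 8 * w ^ 3 * rate p (nDim p θ) ≤ κ := by
      have := hϱ.const_mul (8 * w ^ 3)
      rw [mul_zero] at this
      exact this.eventually (ge_mem_nhds hκ)
    have f5 : ∀ᶠ p : ℕ in atTop, (p : ℝ) ^ (-β) < 1 / 2 :=
      (tendsto_natCast_rpow_neg (by linarith)).eventually (gt_mem_nhds (by norm_num))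
    have f6 := eventually_mul_rpow_le 8 hMT
    have f7 : ∀ᶠ p : ℕ in atTop, 10 ^ 9 * ((p : ℝ) ^ γ * Real.log p) ^ 2 ≤
        max ((p : ℝ) ^ G / 2) (nDim p θ) := by
      obtain ⟨x, hx0, hx⟩ : ∃ x, 0 < x ∧ 2 * γ + 2 * x < max G θ :=
        ⟨(max G θ - 2 * γ) / 4, by linarith, by linarith⟩
      filter_upwards [eventually_log_le one_pos hx0, eventually_mul_rpow_le (2 * 10 ^ 9) hx,
        eventually_gt_atTop 0] with p h1 h2 hp
      have hp' : (0 : ℝ) < p := by exact_mod_cast hp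
      have hL : 0 ≤ Real.log p := Real.log_nonneg (by exact_mod_cast hp)
      have h3 : ((p : ℝ) ^ γ * Real.log p) ^ 2 ≤ (p : ℝ) ^ (2 * γ + 2 * x) := by
        calc ((p : ℝ) ^ γ * Real.log p) ^ 2 ≤ ((p : ℝ) ^ γ * (p : ℝ) ^ x) ^ 2 := by
              gcongr; linarith
          _ = _ := by
            rw [← Real.rpow_add hp', ← Real.rpow_natCast, ← Real.rpow_mul hp'.le]
            congr 1; push_cast; ring
      rcases le_total G θ with hGθ | hGθ
      · rw [max_eq_right hGθ] at h2
        refine le_trans ?_ (le_max_right _ _)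
        have := rpow_le_nDim p θ
        have := sq_nonneg ((p : ℝ) ^ γ * Real.log p)
        linarith
      · rw [max_eq_left hGθ] at h2
        refine le_trans ?_ (le_max_left _ _)
        linarith
    filter_upwards [f1, f2, f3, f4, f5, f6, f7, eventually_gt_atTop 1,
      (tendsto_nDim hθ0).eventually_ge_atTop 4, tendsto_log_natCast.eventually_ge_atTop 1,
      (tendsto_log_natCast.const_mul_atTop (pow_pos hκ 2)).eventually_ge_atTop 12,
      eventually_signal_sq_le hθ0 hr0.le hκ, eventually_tauStar_le hθ0 hr0 hκ]
      with p f1 f2 f3 f4 f5 f6 f7 hp hn hL1 hL hsig hτκ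
    have hp0 : 0 < p := one_pos.trans hp
    have hn0 : 0 < nDim p θ := by omega
    have hp' : (0 : ℝ) < p := by exact_mod_cast hp0
    have hτ : 0 < tauStar p θ r := tauStar_pos hp hr0
    have hε0 : 0 ≤ (p : ℝ) ^ (-β) := Real.rpow_nonneg hp'.le _
    refine one_sub_le_toReal_jointLaw hn0 hε0 (by linarith) (by positivity)
      (hξ p hp0) (fun x => x ≤ c0) fun u hu => ?_
    simp only [not_le]
    rw [threshold_eq hp0 hn0 hq0.le]
    have hn1 : (1 : ℝ) ≤ nDim p θ := by exact_mod_cast hn0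
    have ha : (nDim p θ : ℝ) ≤ nDim p θ + 2 * √q * (nDim p θ * rate p (nDim p θ)) := by
      have := rate_nonneg p (nDim p θ)
      have : 0 ≤ 2 * √q * (nDim p θ * rate p (nDim p θ)) := by positivity
      linarith
    obtain ⟨m, hm⟩ : ∃ m, p * ∫ z : Euc (nDim p θ), window (nDim p θ)
      (nDim p θ + 2 * √q * (nDim p θ * rate p (nDim p θ))) ‖z‖ ∂(stdG (nDim p θ)) = m := ⟨_, rfl⟩
    have hGm : (p : ℝ) ^ G / 2 ≤ m := by
      have := le_integral_window (n := nDim p θ) hs0 hκ (rate_nonneg p (nDim p θ)) f1 f2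
        (by rwa [mul_rate_sq hp0 hn0])
      rw [mul_rate_sq hp0 hn0, exp_neg_mul_log hp0] at this
      calc (p : ℝ) ^ G / 2 = p * ((p : ℝ) ^ (-(√q + κ) ^ 2) / 2) := by
            rw [← mul_div_assoc]
            nth_rewrite 2 [← Real.rpow_one (p : ℝ)]
            rw [← Real.rpow_add hp', hG, ← sub_eq_add_neg]
        _ ≤ _ := by rw [← hm]; gcongr
    have hM : p * ((p : ℝ) ^ (-β) * (stdG (nDim p θ)).real
        {z | nDim p θ + 2 * √q * (nDim p θ * rate p (nDim p θ)) ≤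
          ‖colVec u (tauStar p θ r, z)‖ ^ 2}) ≤ 2 * (p : ℝ) ^ W := by
      have := measureReal_colVec_le hu hw hw2 (rate_nonneg p (nDim p θ)) f3 f4 hτ.le hsig (by
        rw [← mul_assoc]; gcongr)
      rw [mul_rate_sq hp0 hn0, exp_neg_mul_log hp0] at this
      calc _ ≤ (p : ℝ) * ((p : ℝ) ^ (-β) * (2 * (p : ℝ) ^ (-(w ^ 2 - κ)))) := by gcongr
        _ = 2 * ((p : ℝ) ^ (1 : ℝ) * (p : ℝ) ^ (-β) * (p : ℝ) ^ (-(w ^ 2 - κ))) := by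
          rw [Real.rpow_one]; ring
        _ = 2 * (p : ℝ) ^ W := by
          rw [← Real.rpow_add hp', ← Real.rpow_add hp', hWdef]
          congr 2
          ring
    obtain ⟨T, hT⟩ : ∃ T, (p : ℝ) ^ γ = T := ⟨_, rfl⟩
    have hT0 : 0 < T := hT ▸ Real.rpow_pos_of_pos hp' γ
    rw [hT] at f6 f7
    obtain ⟨L, hLp⟩ : ∃ L, Real.log p = L := ⟨_, rfl⟩
    rw [hLp] at f7 hL1
    obtain ⟨b, hb⟩ : ∃ b, b = tauStar p θ r * √(nDim p θ) := ⟨_, rfl⟩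
    have hb2 : b ^ 2 ≤ 4 * √(nDim p θ * L) := by
      rw [hb]
      refine hsig.trans ?_
      rw [mul_rate hp0 hn0, hLp, Real.sqrt_mul (Nat.cast_nonneg _)]
      have : 0 ≤ √(nDim p θ : ℝ) * √L := by positivity
      exact mul_le_mul_of_nonneg_right (by linarith) this
    have hX : 10 ^ 9 * (T * L) ^ 2 ≤ max m (nDim p θ) := f7.trans (max_le_max_right _ hGm)
    have hexp : Real.exp (2 * (2 * (p : ℝ) ^ W) - T) ≤ Real.exp (-((p : ℝ) ^ γ / 2)) := by
      rw [hT]; gcongr; linarith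
    rcases le_total ((nDim p θ : ℝ) / 1000) m with hcase | hcase
    · have hmX : 10 ^ 9 * (T * L) ^ 2 ≤ 1000 * m := hX.trans (max_le (by linarith) (by linarith))
      obtain ⟨h1, h2⟩ := signal_bounds_of_fat hn1 hT0 hL1 hb2 hmX
      refine (measure_topEig_gt_le_of_fat hn hp0 hε0 f5.le hτ hu (T := T) ha hm hcase hM hb
        (by rwa [hLp]) h2 hc0 hc).trans (ENNReal.ofReal_le_ofReal ?_)
      · have : 0 ≤ e3 p := by positivity
        simp only [e1, e2]
        linarith
    · have hmX : 10 ^ 9 * (T * L) ^ 2 ≤ nDim p θ := hX.trans (max_le (by linarith) (by linarith))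
      obtain ⟨h1, h2⟩ := signal_bounds_of_skinny hn1 hT0 hL1 hb2 hmX
      refine (measure_topEig_gt_le_of_skinny hn hp0 hε0 f5.le hτ hu (T := T) ha hm hcase hM hb
        (by rwa [hLp]) h2 hc0 (le_trans (by norm_num) hc)).trans (ENNReal.ofReal_le_ofReal ?_)
      · have h1 : Real.exp (-(m / 8)) ≤ Real.exp (-((p : ℝ) ^ G / 2 / 8)) := by gcongr
        have h2 : Real.exp (2 - (nDim p θ : ℝ) / 800) =
            Real.exp 2 * Real.exp (-(nDim p θ / 800)) := by rw [← Real.exp_add, sub_eq_add_neg]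
        have h3 := Real.exp_pos (-((nDim p θ : ℝ) / 10 ^ 16))
        simp only [e1, e2, e3]
        rw [h2]
        linarith

end ARWPaper

open ARWPaper Filter in
/-- phase transition for IF-PCA under the calibration
`τ_p* = p^{-θ/4} (4 r log p)^{1/4}`. (i) If `r > ρ*_θ(β)`, then with the ideal
threshold `q*`, `cos(ξ^{(q*)}, ℓ) → 1` with probability `1 - o(p^{-2})`.
(ii) If `r < ρ*_θ(β)`, there is a constant `c₀ ∈ (0,1)` such that for every fixed
`q ∈ (0,1)`, `cos(ξ^{(q)}, ℓ) ≤ c₀` with probability `1 - o(n^{-1})`. -/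
theorem ifpca_phase_transition
    (θ β r : ℝ) (hθ0 : 0 < θ) (hθ1 : θ < 1) (hβl : 1 / 2 < β) (hβu : β < 1 - θ / 2)
    (hr0 : 0 < r) (hr1 : r < 1) :
    (rhoStarTheta θ β < r →
      ∀ ξsel : (p : ℕ) → (Fin (nDim p θ) → Fin p → ℝ) → Fin (nDim p θ) → ℝ,
        (∀ p : ℕ, 1 ≤ p → ∀ X, IsTopEigenvector (gramSel (qStar θ β r) X) (ξsel p X)) →
        ∃ δ η : ℕ → ℝ,
          Tendsto δ atTop (nhds 0) ∧
          Tendsto (fun p : ℕ => (p : ℝ) ^ 2 * η p) atTop (nhds 0) ∧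
          ∀ᶠ p : ℕ in atTop,
            1 - η p ≤
              ((jointLaw (nDim p θ) p ((p : ℝ) ^ (-β)) (tauStar p θ r))
                {ω | 1 - δ p ≤ cosv (ξsel p (dataMap ω)) ω.1}).toReal) ∧
    (r < rhoStarTheta θ β →
      ∃ c0 : ℝ, 0 < c0 ∧ c0 < 1 ∧
        ∀ q : ℝ, 0 < q → q < 1 →
        ∀ ξsel : (p : ℕ) → (Fin (nDim p θ) → Fin p → ℝ) → Fin (nDim p θ) → ℝ,
          (∀ p : ℕ, 1 ≤ p → ∀ X, IsTopEigenvector (gramSel q X) (ξsel p X)) →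
          ∃ η : ℕ → ℝ,
            Tendsto (fun p : ℕ => (nDim p θ : ℝ) * η p) atTop (nhds 0) ∧
            ∀ᶠ p : ℕ in atTop,
              1 - η p ≤
                ((jointLaw (nDim p θ) p ((p : ℝ) ^ (-β)) (tauStar p θ r))
                  {ω | cosv (ξsel p (dataMap ω)) ω.1 ≤ c0}).toReal) := by
  have hβ0 : 0 < β := by linarith
  refine ⟨fun h ξsel hξ => ?_, fun h => ?_⟩
  · obtain ⟨hq, hexp⟩ := exponent_gt_of_rhoStarTheta_lt hβl hβu hr0 h
    exact tendsto_cosv_of_exponent_gt hθ0 hβ0 hr0 hq hexp ξsel hξ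
  · have hc : (0 : ℝ) < 800 * 220300 ^ 2 / (1 + 800 * 220300 ^ 2) := by norm_num
    refine ⟨√(800 * 220300 ^ 2 / (1 + 800 * 220300 ^ 2)), Real.sqrt_pos.2 hc, ?_, ?_⟩
    · rw [Real.sqrt_lt' one_pos]
      norm_num
    · intro q hq0 hq1 ξsel hξ
      exact tendsto_cosv_of_exponent_lt hθ0 hθ1 hβ0 hr0 hr1 hq0 hq1
        (exponent_lt_of_lt_rhoStarTheta hθ1 hθ0 hβu hr0 hq0 h) (Real.sqrt_nonneg _)
        (Real.sq_sqrt hc.le).ge ξsel hξ
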